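/- arXiv:1902.05617 — 6 statements merged into one kernel-verified Lean document; each statement's English description precedes it below -/
import Mathlib

section
/- There exists a finite subset S of (F_{2d}')^δ = {w ∈ F_{2d}' : δ(w) = 0} such that (F_{2d}')^δ is the smallest K-linear subspace of F_{2d} containing S and closed under the operators w ↦ [w, x_i] for i = 1,…,d and w ↦ [[w, x_p], y_q] − [[w, x_q], y_p] for 1 ≤ p < q ≤ d. (Equivalently, the vector space of constants of δ in the commutator ideal F_{2d}' is a finitely generated module over the algebra of constants K[X_d,Y_d]^δ acting via adjoint operators.) -/
noncomputable section

/-- The free metabelian Lie algebra of rank `2d` over `K`: the quotient of the free Lie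
algebra on `x₁,…,x_d,y₁,…,y_d` (indexed by `Fin d ⊕ Fin d`) by its second derived ideal. -/
abbrev FreeMetabelian (K : Type*) [Field K] (d : ℕ) :=
  FreeLieAlgebra K (Fin d ⊕ Fin d) ⧸
    LieAlgebra.derivedSeries K (FreeLieAlgebra K (Fin d ⊕ Fin d)) 2

variable (K : Type*) [Field K] (d : ℕ)

/-- The image of the free generator `xᵢ` in the free metabelian Lie algebra. -/
def xL (i : Fin d) : FreeMetabelian K d :=
  LieSubmodule.Quotient.mk' _ (FreeLieAlgebra.of K (Sum.inl i))

/-- The image of the free generator `yᵢ` in the free metabelian Lie algebra. -/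
def yL (i : Fin d) : FreeMetabelian K d :=
  LieSubmodule.Quotient.mk' _ (FreeLieAlgebra.of K (Sum.inr i))

section Eigenvectors

open Polynomial in
/-- A vector killed by an endomorphism and lying in the span of a set of eigenvectors lies in
the span of those eigenvectors that are killed. -/
theorem mem_span_ker_of_mem_span_eigenvectors {𝕜 M : Type*} [Field 𝕜] [AddCommGroup M]
    [Module 𝕜 M] (T : Module.End 𝕜 M) (X : Set M) (hX : ∀ v ∈ X, ∃ μ : 𝕜, T v = μ • v)
    {w : M} (hw : w ∈ Submodule.span 𝕜 X) (hTw : T w = 0) :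
    w ∈ Submodule.span 𝕜 {v | v ∈ X ∧ T v = 0} := by
  have key : ∃ a ∈ Submodule.span 𝕜 {v | v ∈ X ∧ T v = 0},
      ∃ p : 𝕜[X], p.eval 0 ≠ 0 ∧ aeval T p (w - a) = 0 := by
    clear hTw
    induction hw using Submodule.span_induction with
    | mem v hv =>
      obtain ⟨μ, hμ⟩ := hX v hv
      by_cases h : μ = 0
      · exact ⟨v, Submodule.subset_span ⟨hv, by simp [hμ, h]⟩, 1, by simp, by simp⟩
      · refine ⟨0, Submodule.zero_mem _, Polynomial.X - C μ, by simpa using h, ?_⟩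
        simp [hμ, Module.algebraMap_end_apply]
    | zero => exact ⟨0, Submodule.zero_mem _, 1, by simp, by simp⟩
    | add u v _ _ hu hv =>
      obtain ⟨a, ha, p, hp, hpa⟩ := hu
      obtain ⟨b, hb, q, hq, hqb⟩ := hv
      refine ⟨a + b, Submodule.add_mem _ ha hb, p * q, by simp [hp, hq], ?_⟩
      rw [add_sub_add_comm, map_add]
      nth_rewrite 1 [mul_comm p q]
      simp [map_mul, Module.End.mul_apply, hpa, hqb]
    | smul c v _ hv =>
      obtain ⟨a, ha, p, hp, hpa⟩ := hv
      exact ⟨c • a, Submodule.smul_mem _ _ ha, p, hp, by rw [← smul_sub, map_smul, hpa, smul_zero]⟩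
  obtain ⟨a, ha, p, hp, hpa⟩ := key
  have hTa : T a = 0 := by
    have : Submodule.span 𝕜 {v | v ∈ X ∧ T v = 0} ≤ LinearMap.ker T :=
      Submodule.span_le.2 fun v hv => hv.2
    exact this ha
  have h0 : p.eval 0 • (w - a) = 0 := by
    rw [← divX_mul_X_add p] at hpa
    simpa [Module.End.mul_apply, hTw, hTa, Module.algebraMap_end_apply,
      coeff_zero_eq_eval_zero] using hpa
  rw [smul_eq_zero, or_iff_right hp, sub_eq_zero] at h0
  exact h0 ▸ ha

end Eigenvectors

/-- A metabelian Lie algebra generated by pairs `xᵢ, yᵢ`, each spanning a copy of the natural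
two-dimensional representation of `sl₂`, whose raising and lowering operators `δ` and `E` act
by derivations. -/
structure IsSl2Metabelian {𝕜 L ι : Type*} [Field 𝕜] [LieRing L] [LieAlgebra 𝕜 L]
    (δ E : LieDerivation 𝕜 L L) (x y : ι → L) : Prop where
  raise_x : ∀ i, δ (x i) = 0
  raise_y : ∀ i, δ (y i) = x i
  lower_x : ∀ i, E (x i) = y i
  lower_y : ∀ i, E (y i) = 0
  lieSpan_eq_top : LieSubalgebra.lieSpan 𝕜 L (Set.range x ∪ Set.range y) = ⊤
  lie_lie_eq_zero : ∀ u ∈ LieAlgebra.derivedSeries 𝕜 L 1, ∀ a b : L, ⁅u, ⁅a, b⁆⁆ = 0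

theorem lie_mem_derivedSeries_one {𝕜 L : Type*} [Field 𝕜] [LieRing L] [LieAlgebra 𝕜 L]
    (a b : L) : ⁅a, b⁆ ∈ LieAlgebra.derivedSeries 𝕜 L 1 :=
  LieSubmodule.lie_mem_lie (LieSubmodule.mem_top a) (LieSubmodule.mem_top b)

/-- The action of the minor `x_p y_q - x_q y_p` on the commutator ideal. -/
def lieMinor {L ι : Type*} [LieRing L] (x y : ι → L) (p q : ι) (w : L) : L :=
  ⁅⁅w, x p⁆, y q⁆ - ⁅⁅w, x q⁆, y p⁆

/-- Projection of `g ⊗ (Kxᵢ + Kyᵢ)` to its component of lower highest weight, for `g` a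
highest weight vector of weight `m`. -/
def lieDescend {𝕜 L ι : Type*} [Field 𝕜] [LieRing L] [LieAlgebra 𝕜 L]
    (E : LieDerivation 𝕜 L L) (x y : ι → L) (i : ι) (m : ℕ) (g : L) : L :=
  ⁅E g, x i⁆ - (m : 𝕜) • ⁅g, y i⁆

/-- The highest weight vectors, with their weights, that generate all constants. -/
inductive IsSeed {𝕜 L ι : Type*} [Field 𝕜] [LieRing L] [LieAlgebra 𝕜 L]
    (E : LieDerivation 𝕜 L L) (x y : ι → L) : ℕ → L → Prop
  | lie_x (i j : ι) : IsSeed E x y 2 ⁅x i, x j⁆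
  | det (i j : ι) : IsSeed E x y 0 (⁅x i, y j⁆ - ⁅y i, x j⁆)
  | descend (i j k : ι) : IsSeed E x y 1 (lieDescend E x y k 2 ⁅x i, x j⁆)
  | descend_descend (i j k l : ι) :
      IsSeed E x y 0 (lieDescend E x y l 1 (lieDescend E x y k 2 ⁅x i, x j⁆))

/-- Products of seeds with the `xᵢ` and the minors, with their weights. -/
inductive IsSeedProduct {𝕜 L ι : Type*} [Field 𝕜] [LieRing L] [LieAlgebra 𝕜 L]
    (E : LieDerivation 𝕜 L L) (x y : ι → L) : ℕ → L → Prop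
  | seed {m : ℕ} {g : L} : IsSeed E x y m g → IsSeedProduct E x y m g
  | lie_x {m : ℕ} {g : L} (i : ι) : IsSeedProduct E x y m g → IsSeedProduct E x y (m + 1) ⁅g, x i⁆
  | minor {m : ℕ} {g : L} (p q : ι) :
      IsSeedProduct E x y m g → IsSeedProduct E x y m (lieMinor x y p q g)

/-- Highest weight vectors of weight `m` on which the commutator ideal acts trivially. -/
structure IsHighestWeight {𝕜 L : Type*} [Field 𝕜] [LieRing L] [LieAlgebra 𝕜 L]
    (δ E : LieDerivation 𝕜 L L) (m : ℕ) (g : L) : Prop where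
  raise : δ g = 0
  raise_lower : δ (E g) = (m : 𝕜) • g
  lower_iterate : E^[m + 1] g = 0
  lie_lie : ∀ a b : L, ⁅g, ⁅a, b⁆⁆ = 0

theorem lie_lie_comm_of_lie_lie_eq_zero {L : Type*} [LieRing L] {g : L}
    (hg : ∀ a b : L, ⁅g, ⁅a, b⁆⁆ = 0) (a b : L) : ⁅⁅g, a⁆, b⁆ = ⁅⁅g, b⁆, a⁆ := by
  have h := hg a b
  rw [leibniz_lie, ← lie_skew a ⁅g, b⁆, add_neg_eq_zero] at h
  exact h

theorem LieDerivation.iterate_lie_lie_eq_zero {𝕜 L : Type*} [Field 𝕜] [LieRing L]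
    [LieAlgebra 𝕜 L] (E : LieDerivation 𝕜 L L) {g : L} (hg : ∀ a b : L, ⁅g, ⁅a, b⁆⁆ = 0)
    (k : ℕ) : ∀ a b : L, ⁅E^[k] g, ⁅a, b⁆⁆ = 0 := by
  induction k with
  | zero => simpa using hg
  | succ k ih =>
    intro a b
    rw [Function.iterate_succ_apply']
    have h := E.apply_lie_eq_add (E^[k] g) ⁅a, b⁆
    rw [ih, E.apply_lie_eq_add a b, lie_add, ih, ih] at h
    simpa using h.symm

namespace IsSl2Metabelian

variable {𝕜 L ι : Type*} [Field 𝕜] [LieRing L] [LieAlgebra 𝕜 L]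
  {δ E : LieDerivation 𝕜 L L} {x y : ι → L}

theorem lie_lie_lie_eq_zero (h : IsSl2Metabelian δ E x y) (a b c d : L) :
    ⁅⁅a, b⁆, ⁅c, d⁆⁆ = 0 :=
  h.lie_lie_eq_zero _ (lie_mem_derivedSeries_one a b) c d

theorem commutator_lower (h : IsSl2Metabelian δ E x y) (a : L) :
    δ (E (E a)) = (2 : 𝕜) • E (δ (E a)) - E (E (δ a)) - (2 : 𝕜) • E a := by
  have key : ⁅⁅δ, E⁆, E⁆ = -((2 : 𝕜) • E) := by
    refine LieDerivation.ext_of_lieSpan_eq_top _ h.lieSpan_eq_top ?_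
    rintro _ (⟨i, rfl⟩ | ⟨i, rfl⟩)
    · simp only [LieDerivation.lie_apply, LieDerivation.neg_apply, LieDerivation.smul_apply,
        h.raise_x, h.raise_y, h.lower_x, h.lower_y, map_zero, map_sub]
      module
    · simp only [LieDerivation.lie_apply, LieDerivation.neg_apply, LieDerivation.smul_apply,
        h.raise_y, h.lower_x, h.lower_y, map_zero, map_sub]
      module
  have := LieDerivation.congr_fun key a
  simp only [LieDerivation.lie_apply, map_sub, LieDerivation.neg_apply,
    LieDerivation.smul_apply] at this
  rw [← sub_eq_zero] at this ⊢
  rw [← this]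
  module

theorem iterate_lie_y (h : IsSl2Metabelian δ E x y) (k : ℕ) (g : L) (i : ι) :
    E^[k] ⁅g, y i⁆ = ⁅E^[k] g, y i⁆ := by
  induction k with
  | zero => rfl
  | succ k ih =>
    simp only [Function.iterate_succ_apply', ih, E.apply_lie_eq_add, h.lower_y, lie_zero, zero_add]

theorem iterate_lie_x (h : IsSl2Metabelian δ E x y) (k : ℕ) (g : L) (i : ι) :
    E^[k + 1] ⁅g, x i⁆ = ⁅E^[k + 1] g, x i⁆ + ((k : 𝕜) + 1) • ⁅E^[k] g, y i⁆ := by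
  induction k with
  | zero => simp [E.apply_lie_eq_add, h.lower_x, -LieDerivation.apply_lie_eq_sub, add_comm]
  | succ k ih =>
    rw [Function.iterate_succ_apply', ih]
    simp only [map_add, map_smul, E.apply_lie_eq_add, h.lower_x, h.lower_y, lie_zero, zero_add,
      ← Function.iterate_succ_apply' E]
    push_cast
    module

theorem iterate_descend (h : IsSl2Metabelian δ E x y) (k m : ℕ) (g : L) (i : ι) :
    E^[k] (lieDescend E x y i m g) =
      ⁅E^[k + 1] g, x i⁆ + ((k : 𝕜) - m) • ⁅E^[k] g, y i⁆ := by
  induction k with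
  | zero => simp [lieDescend, sub_eq_add_neg]
  | succ k ih =>
    rw [Function.iterate_succ_apply', ih]
    simp only [map_add, map_smul, E.apply_lie_eq_add, h.lower_x, h.lower_y, lie_zero, zero_add,
      ← Function.iterate_succ_apply' E]
    push_cast
    module

theorem iterate_minor (h : IsSl2Metabelian δ E x y) {g : L}
    (hg : ∀ a b : L, ⁅g, ⁅a, b⁆⁆ = 0) (k : ℕ) (p q : ι) :
    E^[k] (lieMinor x y p q g) = lieMinor x y p q (E^[k] g) := by
  induction k with
  | zero => rfl
  | succ k ih =>
    rw [Function.iterate_succ_apply', ih, Function.iterate_succ_apply']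
    have := lie_lie_comm_of_lie_lie_eq_zero (E.iterate_lie_lie_eq_zero hg k) (y p) (y q)
    simp only [lieMinor, map_sub, E.apply_lie_eq_add, h.lower_x, h.lower_y, lie_zero, zero_add,
      add_lie, this]
    abel

theorem raise_iterate (h : IsSl2Metabelian δ E x y) {m : ℕ} {g : L}
    (hg : IsHighestWeight δ E m g) (k : ℕ) :
    δ (E^[k + 1] g) = (((k : 𝕜) + 1) * (m - k)) • E^[k] g := by
  induction k using Nat.twoStepInduction with
  | zero => simp [hg.raise_lower]
  | one =>
    have := h.commutator_lower g
    rw [hg.raise_lower, hg.raise, map_smul] at this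
    simp only [Function.iterate_succ_apply', Function.iterate_zero, id, this, map_zero]
    push_cast
    module
  | more k ih₁ ih₂ =>
    have := h.commutator_lower (E^[k + 1] g)
    simp only [Function.iterate_succ_apply'] at this ih₁ ih₂
    simp only [Function.iterate_succ_apply', this, ih₂, ih₁]
    simp only [map_smul]
    push_cast
    module

theorem highestWeight_lie_x (h : IsSl2Metabelian δ E x y) {m : ℕ} {g : L}
    (hg : IsHighestWeight δ E m g) (i : ι) : IsHighestWeight δ E (m + 1) ⁅g, x i⁆ where
  raise := by simp [h.raise_x, hg.raise]
  raise_lower := by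
    simp only [LieDerivation.apply_lie_eq_add, h.lower_x, map_add, h.raise_y, hg.raise,
      hg.raise_lower, h.raise_x, lie_zero, zero_lie, smul_lie]
    push_cast
    module
  lower_iterate := by
    rw [h.iterate_lie_x, Function.iterate_succ_apply', hg.lower_iterate]
    simp
  lie_lie := h.lie_lie_lie_eq_zero _ _

theorem highestWeight_minor (h : IsSl2Metabelian δ E x y) {m : ℕ} {g : L}
    (hg : IsHighestWeight δ E m g) (p q : ι) :
    IsHighestWeight δ E m (lieMinor x y p q g) where
  raise := by
    simp only [lieMinor, map_sub, LieDerivation.apply_lie_eq_add, h.raise_x, h.raise_y, hg.raise,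
      lie_zero, zero_lie, add_zero, lie_lie_comm_of_lie_lie_eq_zero hg.lie_lie (x p) (x q),
      sub_self]
  raise_lower := by
    have h₁ := h.iterate_minor hg.lie_lie 1 p q
    simp only [Function.iterate_one] at h₁
    have h₂ := lie_lie_comm_of_lie_lie_eq_zero (E.iterate_lie_lie_eq_zero hg.lie_lie 1) (x p) (x q)
    simp only [Function.iterate_one] at h₂
    rw [h₁]
    simp only [lieMinor, map_sub, LieDerivation.apply_lie_eq_add, h.raise_x, h.raise_y,
      hg.raise_lower, lie_zero, smul_lie, zero_add, h₂]
    module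
  lower_iterate := by
    rw [h.iterate_minor hg.lie_lie, hg.lower_iterate]
    simp [lieMinor]
  lie_lie a b := by simp [lieMinor, sub_lie, h.lie_lie_lie_eq_zero]

theorem highestWeight_descend (h : IsSl2Metabelian δ E x y) {m : ℕ} {g : L}
    (hg : IsHighestWeight δ E (m + 1) g) (i : ι) :
    IsHighestWeight δ E m (lieDescend E x y i (m + 1) g) where
  raise := by
    simp only [lieDescend, map_sub, map_smul, LieDerivation.apply_lie_eq_add, h.raise_x,
      h.raise_y, hg.raise, hg.raise_lower, lie_zero, zero_lie, smul_lie, add_zero, zero_add,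
      sub_self]
  raise_lower := by
    have h₁ := h.iterate_descend 1 (m + 1) g i
    have h₂ := h.raise_iterate hg 1
    simp only [Function.iterate_succ_apply', Function.iterate_zero, id, Nat.reduceAdd] at h₁ h₂
    rw [h₁]
    simp only [lieDescend, map_add, map_smul, LieDerivation.apply_lie_eq_add, h.raise_x,
      h.raise_y, h₂, hg.raise_lower, lie_zero, smul_lie]
    push_cast
    module
  lower_iterate := by
    rw [h.iterate_descend, hg.lower_iterate]
    simp
  lie_lie a b := by simp [lieDescend, sub_lie, h.lie_lie_lie_eq_zero]

theorem highestWeight_of_isSeed (h : IsSl2Metabelian δ E x y) {m : ℕ} {g : L}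
    (hg : IsSeed E x y m g) : IsHighestWeight δ E m g := by
  have hA (i j : ι) : IsHighestWeight δ E 2 ⁅x i, x j⁆ :=
    { raise := by simp [h.raise_x]
      raise_lower := by
        simp only [LieDerivation.apply_lie_eq_add, h.lower_x, map_add, h.raise_y, h.raise_x,
          lie_zero, zero_lie]
        push_cast
        module
      lower_iterate := by
        simp [LieDerivation.apply_lie_eq_add, -LieDerivation.apply_lie_eq_sub, h.lower_x, h.lower_y]
      lie_lie := h.lie_lie_lie_eq_zero _ _ }
  cases hg with
  | lie_x i j => exact hA i j
  | det i j =>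
    refine ⟨?_, ?_, ?_, fun a b => by simp [sub_lie, h.lie_lie_lie_eq_zero]⟩ <;>
      simp [LieDerivation.apply_lie_eq_add, -LieDerivation.apply_lie_eq_sub, h.lower_x, h.lower_y,
        h.raise_x, h.raise_y]
  | descend i j k => exact h.highestWeight_descend (hA i j) k
  | descend_descend i j k l =>
    exact h.highestWeight_descend (h.highestWeight_descend (hA i j) k) l

theorem highestWeight_of_isSeedProduct (h : IsSl2Metabelian δ E x y) {m : ℕ} {g : L}
    (hg : IsSeedProduct E x y m g) : IsHighestWeight δ E m g := by
  induction hg with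
  | seed hg => exact h.highestWeight_of_isSeed hg
  | lie_x i _ ih => exact h.highestWeight_lie_x ih i
  | minor p q _ ih => exact h.highestWeight_minor ih p q

theorem descend_lie_x (h : IsSl2Metabelian δ E x y) {g : L}
    (hg : ∀ a b : L, ⁅g, ⁅a, b⁆⁆ = 0) (m : ℕ) (i j : ι) :
    lieDescend E x y i (m + 1) ⁅g, x j⁆ =
      ⁅lieDescend E x y i m g, x j⁆ + lieMinor x y i j g := by
  have h₁ := lie_lie_comm_of_lie_lie_eq_zero hg (y j) (x i)
  have h₂ := lie_lie_comm_of_lie_lie_eq_zero (E.iterate_lie_lie_eq_zero hg 1) (x j) (x i)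
  have h₃ := lie_lie_comm_of_lie_lie_eq_zero hg (y i) (x j)
  simp only [Function.iterate_one] at h₂
  simp only [lieDescend, lieMinor, E.apply_lie_eq_add, h.lower_x, add_lie, sub_lie, smul_lie,
    h₁, h₂, h₃]
  push_cast
  module

theorem descend_minor (h : IsSl2Metabelian δ E x y) {g : L}
    (hg : ∀ a b : L, ⁅g, ⁅a, b⁆⁆ = 0) (m : ℕ) (i p q : ι) :
    lieDescend E x y i m (lieMinor x y p q g) =
      lieMinor x y p q (lieDescend E x y i m g) := by
  have key {u : L} (hu : ∀ a b : L, ⁅u, ⁅a, b⁆⁆ = 0) (a b c : L) :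
      ⁅⁅⁅u, a⁆, b⁆, c⁆ = ⁅⁅⁅u, c⁆, a⁆, b⁆ := by
    rw [lie_lie_comm_of_lie_lie_eq_zero (h.lie_lie_lie_eq_zero u a) b c,
      lie_lie_comm_of_lie_lie_eq_zero hu a c]
  have h₁ := h.iterate_minor hg 1 p q
  have hE := E.iterate_lie_lie_eq_zero hg 1
  simp only [Function.iterate_one] at h₁ hE
  rw [lieDescend, h₁]
  simp only [lieDescend, lieMinor, sub_lie, smul_lie, key hg _ _ (y i), key hE _ _ (x i)]
  module

theorem descend_mem_span (h : IsSl2Metabelian δ E x y) {m : ℕ} {g : L}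
    (hg : IsSeedProduct E x y m g) (i : ι) :
    lieDescend E x y i m g ∈
      Submodule.span 𝕜 {v | ∃ n, n + 1 = m ∧ IsSeedProduct E x y n v} := by
  have hzero {g : L} (hg : IsHighestWeight δ E 0 g) : lieDescend E x y i 0 g = 0 := by
    have := hg.lower_iterate
    simp only [zero_add, Function.iterate_one] at this
    simp [lieDescend, this]
  induction hg with
  | seed hg =>
    have hw := h.highestWeight_of_isSeed hg
    cases hg with
    | lie_x j k => exact Submodule.subset_span ⟨1, rfl, .seed (.descend j k i)⟩
    | det j k => rw [hzero hw]; exact Submodule.zero_mem _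
    | descend j k l => exact Submodule.subset_span ⟨0, rfl, .seed (.descend_descend j k l i)⟩
    | descend_descend j k l r => rw [hzero hw]; exact Submodule.zero_mem _
  | @lie_x m g j hg ih =>
    rw [h.descend_lie_x (h.highestWeight_of_isSeedProduct hg).lie_lie]
    refine Submodule.add_mem _ ?_ (Submodule.subset_span ⟨m, rfl, hg.minor i j⟩)
    generalize lieDescend E x y i m g = v at ih
    induction ih using Submodule.span_induction with
    | mem v hv =>
      obtain ⟨n, rfl, hv⟩ := hv
      exact Submodule.subset_span ⟨n + 1, rfl, hv.lie_x j⟩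
    | zero => simp
    | add u v _ _ hu hv => rw [add_lie]; exact Submodule.add_mem _ hu hv
    | smul c v _ hv => rw [smul_lie]; exact Submodule.smul_mem _ _ hv
  | @minor m g p q hg ih =>
    rw [h.descend_minor (h.highestWeight_of_isSeedProduct hg).lie_lie]
    generalize lieDescend E x y i m g = v at ih
    induction ih using Submodule.span_induction with
    | mem v hv =>
      obtain ⟨n, rfl, hv⟩ := hv
      exact Submodule.subset_span ⟨n, rfl, hv.minor p q⟩
    | zero => simp [lieMinor]
    | add u v _ _ hu hv =>
      convert Submodule.add_mem _ hu hv using 1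
      simp only [lieMinor, add_lie]
      abel
    | smul c v _ hv =>
      convert Submodule.smul_mem _ c hv using 1
      simp only [lieMinor, smul_lie, smul_sub]

end IsSl2Metabelian

/-- The span of the `E`-strings starting at products of seeds. -/
def seedStringSpan {𝕜 L ι : Type*} [Field 𝕜] [LieRing L] [LieAlgebra 𝕜 L]
    (E : LieDerivation 𝕜 L L) (x y : ι → L) : Submodule 𝕜 L :=
  Submodule.span 𝕜 {v | ∃ m g k, IsSeedProduct E x y m g ∧ E^[k] g = v}

namespace IsSl2Metabelian

variable {𝕜 L ι : Type*} [Field 𝕜] [LieRing L] [LieAlgebra 𝕜 L]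
  {δ E : LieDerivation 𝕜 L L} {x y : ι → L}

theorem iterate_mem_seedStringSpan {m : ℕ} {g : L} (hg : IsSeedProduct E x y m g) (k : ℕ) :
    E^[k] g ∈ seedStringSpan E x y :=
  Submodule.subset_span ⟨m, g, k, hg, rfl⟩

theorem lower_mem_seedStringSpan {v : L} (hv : v ∈ seedStringSpan E x y) (k : ℕ) :
    E^[k] v ∈ seedStringSpan E x y := by
  induction k with
  | zero => exact hv
  | succ k ih =>
    rw [Function.iterate_succ_apply']
    refine Submodule.span_le (p := (seedStringSpan E x y).comap (E : L →ₗ[𝕜] L)) |>.2 ?_ ih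
    rintro _ ⟨m, g, n, hg, rfl⟩
    have := iterate_mem_seedStringSpan hg (n + 1)
    rw [Function.iterate_succ_apply'] at this
    exact this

theorem iterate_lie_y_mem [CharZero 𝕜] (h : IsSl2Metabelian δ E x y) {m : ℕ} {g : L}
    (hg : IsSeedProduct E x y m g) (k : ℕ) (i : ι) :
    ⁅E^[k] g, y i⁆ ∈ seedStringSpan E x y := by
  have h₁ := iterate_mem_seedStringSpan (hg.lie_x i) (k + 1)
  have hd : lieDescend E x y i m g ∈ seedStringSpan E x y := by
    refine Submodule.span_mono ?_ (h.descend_mem_span hg i)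
    rintro v ⟨n, -, hv⟩
    exact ⟨n, v, 0, hv, rfl⟩
  have h₂ := lower_mem_seedStringSpan hd k
  rw [h.iterate_descend] at h₂
  rw [h.iterate_lie_x] at h₁
  have h₃ := Submodule.smul_mem _ ((m : 𝕜) + 1)⁻¹ (Submodule.sub_mem _ h₁ h₂)
  convert h₃ using 1
  rw [add_sub_add_left_eq_sub, ← sub_smul, smul_smul]
  have : (m : 𝕜) + 1 ≠ 0 := Nat.cast_add_one_ne_zero m
  rw [show (k : 𝕜) + 1 - (k - m) = m + 1 by ring, inv_mul_cancel₀ this, one_smul]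

theorem iterate_lie_x_mem [CharZero 𝕜] (h : IsSl2Metabelian δ E x y) {m : ℕ} {g : L}
    (hg : IsSeedProduct E x y m g) (k : ℕ) (i : ι) :
    ⁅E^[k] g, x i⁆ ∈ seedStringSpan E x y := by
  cases k with
  | zero => exact iterate_mem_seedStringSpan (hg.lie_x i) 0
  | succ k =>
    rw [eq_sub_of_add_eq (h.iterate_lie_x k g i).symm]
    exact Submodule.sub_mem _ (iterate_mem_seedStringSpan (hg.lie_x i) (k + 1))
      (Submodule.smul_mem _ _ (h.iterate_lie_y_mem hg k i))

theorem lie_mem_seedStringSpan_of_mem [CharZero 𝕜] (h : IsSl2Metabelian δ E x y) (z : L) :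
    ∀ v ∈ seedStringSpan E x y, ⁅v, z⁆ ∈ seedStringSpan E x y := by
  have hz : z ∈ LieSubalgebra.lieSpan 𝕜 L (Set.range x ∪ Set.range y) := by
    simp [h.lieSpan_eq_top]
  induction hz using LieSubalgebra.lieSpan_induction with
  | mem z hz =>
    intro v hv
    induction hv using Submodule.span_induction with
    | mem v hv =>
      obtain ⟨m, g, k, hg, rfl⟩ := hv
      obtain ⟨i, rfl⟩ | ⟨i, rfl⟩ := hz
      · exact h.iterate_lie_x_mem hg k i
      · exact h.iterate_lie_y_mem hg k i
    | zero => simp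
    | add u v _ _ hu hv => rw [add_lie]; exact Submodule.add_mem _ hu hv
    | smul c v _ hv => rw [smul_lie]; exact Submodule.smul_mem _ _ hv
  | zero => simp
  | add a b _ _ ha hb =>
    intro v hv
    rw [lie_add]
    exact Submodule.add_mem _ (ha v hv) (hb v hv)
  | smul c a _ ha =>
    intro v hv
    rw [lie_smul]
    exact Submodule.smul_mem _ _ (ha v hv)
  | lie a b _ _ ha hb =>
    intro v hv
    rw [leibniz_lie, ← lie_skew a, ← sub_eq_add_neg]
    exact Submodule.sub_mem _ (hb _ (ha v hv)) (ha _ (hb v hv))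

theorem generator_lie_generator_mem [CharZero 𝕜] (h : IsSl2Metabelian δ E x y) {u v : L}
    (hu : u ∈ Set.range x ∪ Set.range y) (hv : v ∈ Set.range x ∪ Set.range y) :
    ⁅u, v⁆ ∈ seedStringSpan E x y := by
  have h₁ (i j : ι) : ⁅x i, y j⁆ + ⁅y i, x j⁆ ∈ seedStringSpan E x y := by
    have := iterate_mem_seedStringSpan (.seed (.lie_x (E := E) (x := x) (y := y) i j)) 1
    simpa [LieDerivation.apply_lie_eq_add, -LieDerivation.apply_lie_eq_sub, h.lower_x] using this
  have h₂ (i j : ι) : ⁅x i, y j⁆ - ⁅y i, x j⁆ ∈ seedStringSpan E x y :=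
    iterate_mem_seedStringSpan (.seed (.det (E := E) (x := x) (y := y) i j)) 0
  have hxy (i j : ι) : ⁅x i, y j⁆ ∈ seedStringSpan E x y := by
    convert Submodule.smul_mem _ (2 : 𝕜)⁻¹ (Submodule.add_mem _ (h₁ i j) (h₂ i j)) using 1
    module
  obtain ⟨i, rfl⟩ | ⟨i, rfl⟩ := hu <;> obtain ⟨j, rfl⟩ | ⟨j, rfl⟩ := hv
  · exact iterate_mem_seedStringSpan (.seed (.lie_x i j)) 0
  · exact hxy i j
  · rw [← lie_skew]
    exact Submodule.neg_mem _ (hxy j i)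
  · have := iterate_mem_seedStringSpan (.seed (.lie_x (E := E) (x := x) (y := y) i j)) 2
    simp only [LieDerivation.apply_lie_eq_add, Function.iterate_succ_apply', h.lower_x, h.lower_y,
      Function.iterate_zero, id, map_add, lie_zero, zero_lie, zero_add, add_zero] at this
    convert Submodule.smul_mem _ (2 : 𝕜)⁻¹ this using 1
    module

theorem lie_mem_seedStringSpan [CharZero 𝕜] (h : IsSl2Metabelian δ E x y) (a b : L) :
    ⁅a, b⁆ ∈ seedStringSpan E x y := by
  have htop (z : L) : z ∈ LieSubalgebra.lieSpan 𝕜 L (Set.range x ∪ Set.range y) := by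
    simp [h.lieSpan_eq_top]
  have extend (z : L) (hz : ∀ u ∈ Set.range x ∪ Set.range y, ⁅u, z⁆ ∈ seedStringSpan E x y)
      (a : L) : ⁅a, z⁆ ∈ seedStringSpan E x y := by
    have ha := htop a
    induction ha using LieSubalgebra.lieSpan_induction with
    | mem a ha => exact hz a ha
    | zero => simp
    | add u v _ _ hu hv => rw [add_lie]; exact Submodule.add_mem _ hu hv
    | smul c v _ hv => rw [smul_lie]; exact Submodule.smul_mem _ _ hv
    | lie u v _ _ hu hv =>
      rw [lie_lie, ← lie_skew u ⁅v, z⁆, ← lie_skew v ⁅u, z⁆]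
      exact Submodule.sub_mem _ (Submodule.neg_mem _ (h.lie_mem_seedStringSpan_of_mem u _ hv))
        (Submodule.neg_mem _ (h.lie_mem_seedStringSpan_of_mem v _ hu))
  refine extend b (fun u hu => ?_) a
  rw [← lie_skew]
  exact Submodule.neg_mem _ (extend u (fun v hv => h.generator_lie_generator_mem hv hu) b)

theorem mem_seedStringSpan_of_mem_derivedSeries [CharZero 𝕜] (h : IsSl2Metabelian δ E x y)
    {w : L} (hw : w ∈ LieAlgebra.derivedSeries 𝕜 L 1) : w ∈ seedStringSpan E x y := by
  change w ∈ (⁅(⊤ : LieIdeal 𝕜 L), (⊤ : LieIdeal 𝕜 L)⁆ : LieIdeal 𝕜 L).toSubmodule at hw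
  rw [LieSubmodule.lieIdeal_oper_eq_linear_span'] at hw
  refine Submodule.span_le.2 ?_ hw
  rintro _ ⟨a, -, b, -, rfl⟩
  exact h.lie_mem_seedStringSpan a b

theorem mem_span_isSeedProduct [CharZero 𝕜] (h : IsSl2Metabelian δ E x y) {w : L}
    (hw : w ∈ LieAlgebra.derivedSeries 𝕜 L 1) (hδ : δ w = 0) :
    w ∈ Submodule.span 𝕜 {g | ∃ m, IsSeedProduct E x y m g} := by
  have hT (m : ℕ) (g : L) (hg : IsSeedProduct E x y m g) (k : ℕ) :
      E (δ (E^[k + 1] g)) = (((k : 𝕜) + 1) * (m - k)) • E^[k + 1] g := by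
    rw [h.raise_iterate (h.highestWeight_of_isSeedProduct hg), map_smul,
      ← Function.iterate_succ_apply' E]
  have key := mem_span_ker_of_mem_span_eigenvectors
    ((E : L →ₗ[𝕜] L) ∘ₗ (δ : L →ₗ[𝕜] L)) _ ?_ (h.mem_seedStringSpan_of_mem_derivedSeries hw)
    (by simp [hδ])
  · refine Submodule.span_le.2 ?_ key
    rintro _ ⟨⟨m, g, k, hg, rfl⟩, hk⟩
    cases k with
    | zero => exact Submodule.subset_span ⟨m, hg⟩
    | succ k =>
      have hk' : E (δ (E^[k + 1] g)) = 0 := hk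
      suffices E^[k + 1] g = 0 by rw [this]; exact Submodule.zero_mem _
      rw [hT m g hg k, smul_eq_zero, mul_eq_zero] at hk'
      obtain (hk' | hk') | hk' := hk'
      · exact absurd hk' (Nat.cast_add_one_ne_zero k)
      · rw [sub_eq_zero, Nat.cast_inj] at hk'
        exact hk' ▸ (h.highestWeight_of_isSeedProduct hg).lower_iterate
      · exact hk'
  · rintro _ ⟨m, g, k, hg, rfl⟩
    cases k with
    | zero => exact ⟨0, by simp [(h.highestWeight_of_isSeedProduct hg).raise]⟩
    | succ k => exact ⟨_, hT m g hg k⟩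

theorem isSeed_mem_derivedSeries {m : ℕ} {g : L} (hg : IsSeed E x y m g) :
    g ∈ LieAlgebra.derivedSeries 𝕜 L 1 := by
  have hd (i : ι) (m : ℕ) (g : L) : lieDescend E x y i m g ∈ LieAlgebra.derivedSeries 𝕜 L 1 :=
    sub_mem (lie_mem_derivedSeries_one _ _)
      (SMulMemClass.smul_mem _ (lie_mem_derivedSeries_one _ _))
  cases hg with
  | lie_x i j => exact lie_mem_derivedSeries_one _ _
  | det i j => exact sub_mem (lie_mem_derivedSeries_one _ _) (lie_mem_derivedSeries_one _ _)
  | descend i j k => exact hd _ _ _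
  | descend_descend i j k l => exact hd _ _ _

theorem finite_isSeed [Finite ι] (E : LieDerivation 𝕜 L L) (x y : ι → L) :
    {g | ∃ m, IsSeed E x y m g}.Finite := by
  refine (((Set.finite_range fun p : ι × ι => ⁅x p.1, x p.2⁆).union
    (Set.finite_range fun p : ι × ι => ⁅x p.1, y p.2⁆ - ⁅y p.1, x p.2⁆)).union
    ((Set.finite_range fun p : ι × ι × ι => lieDescend E x y p.2.2 2 ⁅x p.1, x p.2.1⁆).union
    (Set.finite_range fun p : ι × ι × ι × ι =>
      lieDescend E x y p.2.2.2 1 (lieDescend E x y p.2.2.1 2 ⁅x p.1, x p.2.1⁆)))).subset ?_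
  rintro g ⟨m, hg⟩
  cases hg with
  | lie_x i j => exact .inl (.inl ⟨(i, j), rfl⟩)
  | det i j => exact .inl (.inr ⟨(i, j), rfl⟩)
  | descend i j k => exact .inr (.inl ⟨(i, j, k), rfl⟩)
  | descend_descend i j k l => exact .inr (.inr ⟨(i, j, k, l), rfl⟩)

theorem exists_finset_generating_constants [CharZero 𝕜] [Finite ι] [LinearOrder ι]
    (h : IsSl2Metabelian δ E x y) :
    ∃ S : Finset L,
      (∀ g ∈ S, g ∈ LieAlgebra.derivedSeries 𝕜 L 1 ∧ δ g = 0) ∧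
      {w : L | w ∈ LieAlgebra.derivedSeries 𝕜 L 1 ∧ δ w = 0} =
        ⋂ V ∈ {V : Submodule 𝕜 L | (S : Set L) ⊆ (V : Set L) ∧
            (∀ w ∈ V, ∀ i : ι, ⁅w, x i⁆ ∈ V) ∧
            (∀ w ∈ V, ∀ p q : ι, p < q → ⁅⁅w, x p⁆, y q⁆ - ⁅⁅w, x q⁆, y p⁆ ∈ V)},
          (V : Set L) := by
  have hS : ∀ g ∈ (finite_isSeed E x y).toFinset,
      g ∈ LieAlgebra.derivedSeries 𝕜 L 1 ∧ δ g = 0 := by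
    intro g hg
    obtain ⟨m, hg⟩ := (finite_isSeed E x y).mem_toFinset.1 hg
    exact ⟨isSeed_mem_derivedSeries hg, (h.highestWeight_of_isSeed hg).raise⟩
  refine ⟨(finite_isSeed E x y).toFinset, hS, ?_⟩
  apply Set.Subset.antisymm
  · rintro w ⟨hw, hδ⟩
    refine Set.mem_iInter₂.2 fun V ⟨hSV, hVx, hVm⟩ => ?_
    refine Submodule.span_le.2 ?_ (h.mem_span_isSeedProduct hw hδ)
    rintro g ⟨m, hg⟩
    change g ∈ V
    induction hg with
    | seed hg => exact hSV ((finite_isSeed E x y).mem_toFinset.2 ⟨_, hg⟩)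
    | lie_x i _ ih => exact hVx _ ih i
    | minor p q _ ih =>
      rcases lt_trichotomy p q with hpq | rfl | hpq
      · exact hVm _ ih p q hpq
      · simp [lieMinor]
      · rw [lieMinor, ← neg_sub]
        exact V.neg_mem (hVm _ ih q p hpq)
  · intro w hw
    refine Set.mem_iInter₂.1 hw ((LieAlgebra.derivedSeries 𝕜 L 1).toSubmodule ⊓
      LinearMap.ker (δ : L →ₗ[𝕜] L)) ⟨hS, ?_, ?_⟩
    · rintro w ⟨-, hw⟩ i
      have hw' : δ w = 0 := hw
      exact ⟨lie_mem_derivedSeries_one _ _, by simp [hw', h.raise_x]⟩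
    · rintro w ⟨hw, hδ⟩ p q -
      have hδ' : δ w = 0 := hδ
      refine ⟨sub_mem (lie_mem_derivedSeries_one _ _) (lie_mem_derivedSeries_one _ _), ?_⟩
      have := lie_lie_comm_of_lie_lie_eq_zero (h.lie_lie_eq_zero w hw) (x p) (x q)
      change δ _ = 0
      simp only [map_sub, LieDerivation.apply_lie_eq_add, h.raise_x, h.raise_y, hδ', lie_zero,
        zero_lie, add_zero, this, sub_self]

end IsSl2Metabelian

section FreeMetabelian

variable {𝕜 : Type*} [Field 𝕜] {n : ℕ}

/-- The quotient map from the free Lie algebra to the free metabelian Lie algebra. -/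
def FreeMetabelian.mkHom (𝕜 : Type*) [Field 𝕜] (n : ℕ) :
    FreeLieAlgebra 𝕜 (Fin n ⊕ Fin n) →ₗ⁅𝕜⁆ FreeMetabelian 𝕜 n :=
  { (LieSubmodule.Quotient.mk' _ : _ →ₗ⁅𝕜, FreeLieAlgebra 𝕜 (Fin n ⊕ Fin n)⁆
      FreeMetabelian 𝕜 n).toLinearMap with
    map_lie' := rfl }

theorem FreeMetabelian.mkHom_surjective : Function.Surjective (FreeMetabelian.mkHom 𝕜 n) :=
  LieSubmodule.Quotient.surjective_mk' _

theorem FreeMetabelian.mkHom_eq_zero {a : FreeLieAlgebra 𝕜 (Fin n ⊕ Fin n)} :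
    FreeMetabelian.mkHom 𝕜 n a = 0 ↔
      a ∈ LieAlgebra.derivedSeries 𝕜 (FreeLieAlgebra 𝕜 (Fin n ⊕ Fin n)) 2 :=
  LieSubmodule.Quotient.mk_eq_zero _

theorem FreeMetabelian.lieSpan_generators :
    LieSubalgebra.lieSpan 𝕜 (FreeMetabelian 𝕜 n) (Set.range (xL 𝕜 n) ∪ Set.range (yL 𝕜 n)) =
      ⊤ := by
  set S := LieSubalgebra.lieSpan 𝕜 (FreeMetabelian 𝕜 n)
    (Set.range (xL 𝕜 n) ∪ Set.range (yL 𝕜 n))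
  have hmem : ∀ z : Fin n ⊕ Fin n, FreeMetabelian.mkHom 𝕜 n (FreeLieAlgebra.of 𝕜 z) ∈ S := by
    rintro (i | i)
    · exact LieSubalgebra.subset_lieSpan (.inl ⟨i, rfl⟩)
    · exact LieSubalgebra.subset_lieSpan (.inr ⟨i, rfl⟩)
  have hlift : S.incl.comp (FreeLieAlgebra.lift 𝕜 fun z => (⟨_, hmem z⟩ : S)) =
      FreeMetabelian.mkHom 𝕜 n :=
    FreeLieAlgebra.hom_ext fun z => by simp
  refine eq_top_iff.2 fun a _ => ?_
  obtain ⟨b, rfl⟩ := FreeMetabelian.mkHom_surjective a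
  rw [← hlift]
  exact Subtype.property _

theorem FreeMetabelian.derivedSeries_two :
    LieAlgebra.derivedSeries 𝕜 (FreeMetabelian 𝕜 n) 2 = ⊥ := by
  rw [← LieIdeal.derivedSeries_map_eq 2 FreeMetabelian.mkHom_surjective, eq_bot_iff,
    LieIdeal.map_le_iff_le_comap]
  intro a ha
  simpa [LieIdeal.mem_comap] using FreeMetabelian.mkHom_eq_zero.2 ha

theorem FreeMetabelian.lie_lie_eq_zero (u : FreeMetabelian 𝕜 n)
    (hu : u ∈ LieAlgebra.derivedSeries 𝕜 (FreeMetabelian 𝕜 n) 1) (a b : FreeMetabelian 𝕜 n) :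
    ⁅u, ⁅a, b⁆⁆ = 0 := by
  have h : ⁅u, ⁅a, b⁆⁆ ∈ LieAlgebra.derivedSeries 𝕜 (FreeMetabelian 𝕜 n) 2 :=
    LieSubmodule.lie_mem_lie hu (lie_mem_derivedSeries_one a b)
  rwa [FreeMetabelian.derivedSeries_two, LieSubmodule.mem_bot] at h

theorem FreeMetabelian.exists_swap : ∃ σ : FreeMetabelian 𝕜 n →ₗ⁅𝕜⁆ FreeMetabelian 𝕜 n,
    (∀ i, σ (xL 𝕜 n i) = yL 𝕜 n i) ∧ (∀ i, σ (yL 𝕜 n i) = xL 𝕜 n i) := by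
  let φ : FreeLieAlgebra 𝕜 (Fin n ⊕ Fin n) →ₗ⁅𝕜⁆ FreeMetabelian 𝕜 n :=
    FreeLieAlgebra.lift 𝕜 (Sum.elim (yL 𝕜 n) (xL 𝕜 n))
  have hφ : ∀ a ∈ LieAlgebra.derivedSeries 𝕜 (FreeLieAlgebra 𝕜 (Fin n ⊕ Fin n)) 2,
      φ a = 0 := by
    intro a ha
    have h := LieIdeal.derivedSeries_map_le (f := φ) 2 (LieIdeal.mem_map ha)
    rwa [FreeMetabelian.derivedSeries_two, LieSubmodule.mem_bot] at h
  let σ : FreeMetabelian 𝕜 n →ₗ[𝕜] FreeMetabelian 𝕜 n :=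
    Submodule.liftQ _ (φ : FreeLieAlgebra 𝕜 (Fin n ⊕ Fin n) →ₗ[𝕜] FreeMetabelian 𝕜 n) hφ
  have hσ (a : FreeLieAlgebra 𝕜 (Fin n ⊕ Fin n)) : σ (FreeMetabelian.mkHom 𝕜 n a) = φ a :=
    Submodule.liftQ_apply _ _ _
  refine ⟨{ σ with map_lie' := ?_ }, fun i => ?_, fun i => ?_⟩
  · intro a b
    obtain ⟨a, rfl⟩ := FreeMetabelian.mkHom_surjective a
    obtain ⟨b, rfl⟩ := FreeMetabelian.mkHom_surjective b
    change σ _ = ⁅σ _, σ _⁆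
    rw [← LieHom.map_lie, hσ, hσ, hσ, LieHom.map_lie]
  · exact (hσ _).trans (by simp [φ])
  · exact (hσ _).trans (by simp [φ])

theorem FreeMetabelian.exists_isSl2Metabelian
    (δ : LieDerivation 𝕜 (FreeMetabelian 𝕜 n) (FreeMetabelian 𝕜 n))
    (hx : ∀ i, δ (xL 𝕜 n i) = 0) (hy : ∀ i, δ (yL 𝕜 n i) = xL 𝕜 n i) :
    ∃ E, IsSl2Metabelian δ E (xL 𝕜 n) (yL 𝕜 n) := by
  obtain ⟨σ, hσx, hσy⟩ := FreeMetabelian.exists_swap (𝕜 := 𝕜) (n := n)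
  have hσ (a : FreeMetabelian 𝕜 n) : σ (σ a) = a := by
    have ha : a ∈ LieSubalgebra.lieSpan 𝕜 (FreeMetabelian 𝕜 n)
        (Set.range (xL 𝕜 n) ∪ Set.range (yL 𝕜 n)) := by
      simp [FreeMetabelian.lieSpan_generators]
    induction ha using LieSubalgebra.lieSpan_induction with
    | mem a ha => obtain ⟨i, rfl⟩ | ⟨i, rfl⟩ := ha <;> simp [hσx, hσy]
    | zero => simp
    | add u v _ _ hu hv => simp [hu, hv]
    | smul c v _ hv => simp [hv]
    | lie u v _ _ hu hv => simp [hu, hv]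
  refine ⟨⟨(σ : FreeMetabelian 𝕜 n →ₗ[𝕜] FreeMetabelian 𝕜 n) ∘ₗ
    (δ : FreeMetabelian 𝕜 n →ₗ[𝕜] FreeMetabelian 𝕜 n) ∘ₗ
    (σ : FreeMetabelian 𝕜 n →ₗ[𝕜] FreeMetabelian 𝕜 n), fun a b => ?_⟩,
    hx, hy, fun i => ?_, fun i => ?_, FreeMetabelian.lieSpan_generators,
    FreeMetabelian.lie_lie_eq_zero⟩
  · simp [hσ]
  · change σ (δ (σ _)) = _
    rw [hσx, hy, hσx]
  · change σ (δ (σ _)) = _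
    rw [hσy, hx, map_zero]

end FreeMetabelian

/-- The vector space `(F_{2d}')^δ` of constants of `δ` in the commutator ideal of the
free metabelian Lie algebra `F_{2d}` is a finitely generated module over the algebra of
constants `K[X_d,Y_d]^δ`: there is a finite set `S` of constants in `F_{2d}'` such that
`(F_{2d}')^δ` is the smallest `K`-subspace containing `S` and closed under the operators
`w ↦ [w, xᵢ]` and `w ↦ [[w, x_p], y_q] - [[w, x_q], y_p]` (`p < q`). -/
theorem constants_finitely_generated (K : Type*) [Field K] [CharZero K] (d : ℕ) (hd : 2 ≤ d)
    (δ : LieDerivation K (FreeMetabelian K d) (FreeMetabelian K d))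
    (hx : ∀ i : Fin d, δ (xL K d i) = 0)
    (hy : ∀ i : Fin d, δ (yL K d i) = xL K d i) :
    ∃ S : Finset (FreeMetabelian K d),
      (∀ g ∈ S, g ∈ LieAlgebra.derivedSeries K (FreeMetabelian K d) 1 ∧ δ g = 0) ∧
      {w : FreeMetabelian K d |
          w ∈ LieAlgebra.derivedSeries K (FreeMetabelian K d) 1 ∧ δ w = 0} =
        ⋂ V ∈ {V : Submodule K (FreeMetabelian K d) |
            (S : Set (FreeMetabelian K d)) ⊆ (V : Set (FreeMetabelian K d)) ∧
            (∀ w ∈ V, ∀ i : Fin d, ⁅w, xL K d i⁆ ∈ V) ∧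
            (∀ w ∈ V, ∀ p q : Fin d, p < q →
              ⁅⁅w, xL K d p⁆, yL K d q⁆ - ⁅⁅w, xL K d q⁆, yL K d p⁆ ∈ V)},
          (V : Set (FreeMetabelian K d)) := by
  obtain ⟨E, h⟩ := FreeMetabelian.exists_isSl2Metabelian δ hx hy
  exact h.exists_finset_generating_constants

end
end

section
/- (Nowicki conjecture.) The algebra of constants K[X_d,Y_d]^δ = {f ∈ K[X_d,Y_d] : δ(f) = 0} is equal to the K-subalgebra of K[X_d,Y_d] generated by the set {x_1,…,x_d} ∪ {u_{pq} = x_p·y_q − x_q·y_p : 1 ≤ p < q ≤ d}. -/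
open MvPolynomial

namespace Nowicki

section Homogeneous

variable {R σ M : Type*} [CommSemiring R]

theorem isWeightedHomogeneous_derivation_monomial [AddCommMonoid M] {w : σ → M} {k : M}
    (D : Derivation R (MvPolynomial σ R) (MvPolynomial σ R))
    (hD : ∀ i, IsWeightedHomogeneous w (D (X i)) (w i + k)) (s : σ →₀ ℕ) (c : R) :
    IsWeightedHomogeneous w (D (monomial s c)) (Finsupp.weight w s + k) := by
  have hmk : D = mkDerivation R (fun i => D (X i)) :=
    derivation_ext fun i => (mkDerivation_X R (fun i => D (X i)) i).symm
  rw [hmk, mkDerivation_monomial, smul_eq_C_mul]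
  refine IsWeightedHomogeneous.C_mul ?_ c
  rw [Finsupp.sum]
  refine IsWeightedHomogeneous.sum _ _ _ fun i hi => ?_
  rw [smul_eq_mul]
  have h := (isWeightedHomogeneous_monomial w (s - Finsupp.single i 1) ((s i : ℕ) : R) rfl).mul
    (hD i)
  rwa [← add_assoc, Finsupp.weight_sub_single_add (Finsupp.mem_support_iff.mp hi)] at h

theorem weightedHomogeneousComponent_derivation [AddCancelCommMonoid M] {w : σ → M} {k : M}
    (D : Derivation R (MvPolynomial σ R) (MvPolynomial σ R))
    (hD : ∀ i, IsWeightedHomogeneous w (D (X i)) (w i + k)) (n : M) (f : MvPolynomial σ R) :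
    weightedHomogeneousComponent w (n + k) (D f) = D (weightedHomogeneousComponent w n f) := by
  classical
  induction f using MvPolynomial.induction_on' with
  | monomial s c =>
    rw [weightedHomogeneousComponent_of_mem (isWeightedHomogeneous_derivation_monomial D hD s c),
      weightedHomogeneousComponent_of_mem (isWeightedHomogeneous_monomial w s c rfl)]
    simp only [add_left_inj]
    split_ifs <;> simp
  | add p q hp hq => simp only [map_add, hp, hq]

theorem isWeightedHomogeneous_pderiv_sub {w : σ → ℕ} {n : ℕ} {f : MvPolynomial σ R}
    (h : IsWeightedHomogeneous w f n) (i : σ) :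
    IsWeightedHomogeneous w (pderiv i f) (n - w i) := by
  intro s hs
  rw [coeff_pderiv] at hs
  have := h (left_ne_zero_of_mul hs)
  rw [map_add, Finsupp.weight_single, one_smul] at this
  omega

theorem isWeightedHomogeneous_component_of_isWeightedHomogeneous {N : Type*} [AddCommMonoid M]
    [AddCommMonoid N] {w : σ → M} {v : σ → N} {n : N} {f : MvPolynomial σ R}
    (h : IsWeightedHomogeneous v f n) (m : M) :
    IsWeightedHomogeneous v (weightedHomogeneousComponent w m f) n := by
  classical
  intro s hs
  rw [coeff_weightedHomogeneousComponent] at hs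
  exact h (fun h0 => hs (by simp [h0]))

theorem mem_of_weightedHomogeneousComponent_mem [AddCommMonoid M] (w : σ → M)
    (A : Subalgebra R (MvPolynomial σ R)) {f : MvPolynomial σ R}
    (h : ∀ m, weightedHomogeneousComponent w m f ∈ A) : f ∈ A := by
  rw [← sum_weightedHomogeneousComponent w f]
  exact finsum_induction (· ∈ A) A.zero_mem (fun _ _ => A.add_mem) h

theorem pderiv_comm (i j : σ) (f : MvPolynomial σ R) :
    pderiv i (pderiv j f) = pderiv j (pderiv i f) := by
  ext s
  simp only [coeff_pderiv, Finsupp.add_apply, add_right_comm s (Finsupp.single i 1)]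
  by_cases h : i = j
  · subst h; rfl
  · simp only [Finsupp.single_eq_of_ne h, Finsupp.single_eq_of_ne (Ne.symm h), add_zero]
    ring

end Homogeneous

variable {K : Type*} [Field K] {d : ℕ}

/-- The weight counting the degree in the `x` variables. -/
def xWeight (d : ℕ) : Fin d ⊕ Fin d → ℕ := Sum.elim 1 0

/-- The second-order operator `∂²/∂x_p∂y_q - ∂²/∂x_q∂y_p`. -/
noncomputable def cayleyOmega (p q : Fin d) (f : MvPolynomial (Fin d ⊕ Fin d) K) :
    MvPolynomial (Fin d ⊕ Fin d) K :=
  pderiv (Sum.inl p) (pderiv (Sum.inr q) f) - pderiv (Sum.inl q) (pderiv (Sum.inr p) f)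

section Derivation

variable {δ : Derivation K (MvPolynomial (Fin d ⊕ Fin d) K) (MvPolynomial (Fin d ⊕ Fin d) K)}

theorem derivation_eq_sum (hx : ∀ i : Fin d, δ (X (Sum.inl i)) = 0)
    (hy : ∀ i : Fin d, δ (X (Sum.inr i)) = X (Sum.inl i))
    (f : MvPolynomial (Fin d ⊕ Fin d) K) :
    δ f = ∑ p, X (Sum.inl p) * pderiv (Sum.inr p) f := by
  let D : Derivation K (MvPolynomial (Fin d ⊕ Fin d) K) (MvPolynomial (Fin d ⊕ Fin d) K) :=
    ∑ p : Fin d, (X (Sum.inl p) : MvPolynomial (Fin d ⊕ Fin d) K) • pderiv (Sum.inr p)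
  have hD : ∀ g, D g = ∑ p, X (Sum.inl p) * pderiv (Sum.inr p) g := fun g => by
    change Derivation.coeFnAddMonoidHom D g = _
    simp [D, map_sum, Derivation.coeFnAddMonoidHom]
  have h : δ = D := by
    refine derivation_ext fun i => ?_
    rw [hD]
    rcases i with i | i
    · simp [hx, pderiv_X]
    · simp [hy, pderiv_X, Pi.single_apply]
  rw [h, hD]

theorem derivation_pderiv_inr (hx : ∀ i : Fin d, δ (X (Sum.inl i)) = 0)
    (hy : ∀ i : Fin d, δ (X (Sum.inr i)) = X (Sum.inl i))
    (q : Fin d) (f : MvPolynomial (Fin d ⊕ Fin d) K) :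
    δ (pderiv (Sum.inr q) f) = pderiv (Sum.inr q) (δ f) := by
  simp only [derivation_eq_sum hx hy, map_sum, pderiv_mul]
  refine Finset.sum_congr rfl fun p _ => ?_
  rw [pderiv_X_of_ne (by simp), pderiv_comm]
  ring

theorem derivation_pderiv_inl (hx : ∀ i : Fin d, δ (X (Sum.inl i)) = 0)
    (hy : ∀ i : Fin d, δ (X (Sum.inr i)) = X (Sum.inl i))
    (q : Fin d) (f : MvPolynomial (Fin d ⊕ Fin d) K) :
    δ (pderiv (Sum.inl q) f) = pderiv (Sum.inl q) (δ f) - pderiv (Sum.inr q) f := by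
  simp only [derivation_eq_sum hx hy, map_sum, pderiv_mul, Finset.sum_add_distrib]
  simp [pderiv_X, Pi.single_apply, pderiv_comm (Sum.inl q)]

theorem derivation_cayleyOmega (hx : ∀ i : Fin d, δ (X (Sum.inl i)) = 0)
    (hy : ∀ i : Fin d, δ (X (Sum.inr i)) = X (Sum.inl i))
    (p q : Fin d) (f : MvPolynomial (Fin d ⊕ Fin d) K) :
    δ (cayleyOmega p q f) = cayleyOmega p q (δ f) := by
  simp only [cayleyOmega, map_sub, derivation_pderiv_inl hx hy, derivation_pderiv_inr hx hy]
  rw [pderiv_comm (Sum.inr p) (Sum.inr q)]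
  ring

/-- A form of the Capelli identity on bihomogeneous constants of `δ`. -/
theorem sum_sum_mul_cayleyOmega (hx : ∀ i : Fin d, δ (X (Sum.inl i)) = 0)
    (hy : ∀ i : Fin d, δ (X (Sum.inr i)) = X (Sum.inl i))
    {f : MvPolynomial (Fin d ⊕ Fin d) K} {a n : ℕ}
    (hn : IsHomogeneous f n) (ha : IsWeightedHomogeneous (xWeight d) f a) (hf : δ f = 0) :
    ∑ p, ∑ q, (X (Sum.inl p) * X (Sum.inr q) - X (Sum.inl q) * X (Sum.inr p)) * cayleyOmega p q f =
      C (2 * ((a + 1) * (n - a)) : K) * f := by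
  have euler_x : ∀ {g : MvPolynomial (Fin d ⊕ Fin d) K},
      IsWeightedHomogeneous (xWeight d) g a →
        ∑ p, X (Sum.inl p) * pderiv (Sum.inl p) g = (a : MvPolynomial (Fin d ⊕ Fin d) K) * g := by
    intro g hg
    simpa [xWeight] using hg.sum_weight_X_mul_pderiv
  have euler_y : ∑ q, X (Sum.inr q) * pderiv (Sum.inr q) f =
      ((n : MvPolynomial (Fin d ⊕ Fin d) K) - a) * f := by
    have h := hn.sum_X_mul_pderiv
    rw [Fintype.sum_sum_type, euler_x ha, nsmul_eq_mul] at h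
    rw [sub_mul, ← h]
    ring
  have h₁ : ∑ q, ∑ p, X (Sum.inr q) *
      (X (Sum.inl p) * pderiv (Sum.inl p) (pderiv (Sum.inr q) f)) =
        (a : MvPolynomial (Fin d ⊕ Fin d) K) * ((n - a) * f) := by
    rw [← euler_y, Finset.mul_sum]
    refine Finset.sum_congr rfl fun q _ => ?_
    rw [← Finset.mul_sum, euler_x (ha.pderiv (by simp [xWeight]))]
    ring
  have h₂ : ∑ q, ∑ p, X (Sum.inr q) *
      (X (Sum.inl p) * pderiv (Sum.inr p) (pderiv (Sum.inl q) f)) =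
        -(((n : MvPolynomial (Fin d ⊕ Fin d) K) - a) * f) := by
    rw [← euler_y, ← Finset.sum_neg_distrib]
    refine Finset.sum_congr rfl fun q _ => ?_
    rw [← Finset.mul_sum, ← derivation_eq_sum hx hy, derivation_pderiv_inl hx hy, hf]
    simp
  have h₃ : ∑ p, ∑ q, (X (Sum.inl p) * X (Sum.inr q)) * cayleyOmega p q f =
      (a : MvPolynomial (Fin d ⊕ Fin d) K) * ((n - a) * f) + (n - a) * f := by
    rw [← sub_neg_eq_add, ← h₁, ← h₂, Finset.sum_comm, ← Finset.sum_sub_distrib]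
    refine Finset.sum_congr rfl fun q _ => ?_
    rw [← Finset.sum_sub_distrib]
    refine Finset.sum_congr rfl fun p _ => ?_
    rw [cayleyOmega, pderiv_comm (Sum.inl q)]
    ring
  have h₄ : ∑ p, ∑ q, (X (Sum.inl q) * X (Sum.inr p)) * cayleyOmega p q f =
      -∑ p, ∑ q, (X (Sum.inl p) * X (Sum.inr q)) * cayleyOmega p q f := by
    rw [Finset.sum_comm]
    simp only [← Finset.sum_neg_distrib]
    refine Finset.sum_congr rfl fun p _ => Finset.sum_congr rfl fun q _ => ?_
    simp only [cayleyOmega]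
    ring
  simp only [sub_mul, Finset.sum_sub_distrib, h₄, h₃]
  simp only [map_mul, map_add, map_sub, map_natCast, map_one, map_ofNat]
  ring

end Derivation

/-- A polynomial whose total degree does not exceed its degree in the `x` variables lies in
every subalgebra containing the `x` variables. -/
theorem mem_of_degree_le {A : Subalgebra K (MvPolynomial (Fin d ⊕ Fin d) K)}
    (hA : ∀ p : Fin d, X (Sum.inl p) ∈ A) {f : MvPolynomial (Fin d ⊕ Fin d) K} {a n : ℕ}
    (hn : IsHomogeneous f n) (ha : IsWeightedHomogeneous (xWeight d) f a) (h : n ≤ a) :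
    f ∈ A := by
  rw [f.as_sum]
  refine A.sum_mem fun s hs => ?_
  have hsn := hn (mem_support_iff.mp hs)
  have hsa := ha (mem_support_iff.mp hs)
  rw [Finsupp.weight_apply, Finsupp.sum_fintype _ _ (by simp), Fintype.sum_sum_type] at hsn hsa
  simp [xWeight] at hsn hsa
  have hy : ∑ q, s (Sum.inr q) = 0 := by omega
  rw [Finset.sum_eq_zero_iff] at hy
  rw [monomial_eq, Finsupp.prod_fintype _ _ (by simp), Fintype.prod_sum_type]
  refine A.mul_mem (A.algebraMap_mem _) (A.mul_mem ?_ ?_)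
  · exact A.prod_mem fun p _ => A.pow_mem (hA p) _
  · exact A.prod_mem fun q hq => by rw [hy q hq, pow_zero]; exact A.one_mem

theorem mem_of_isHomogeneous [CharZero K]
    {δ : Derivation K (MvPolynomial (Fin d ⊕ Fin d) K) (MvPolynomial (Fin d ⊕ Fin d) K)}
    (hx : ∀ i : Fin d, δ (X (Sum.inl i)) = 0)
    (hy : ∀ i : Fin d, δ (X (Sum.inr i)) = X (Sum.inl i))
    {A : Subalgebra K (MvPolynomial (Fin d ⊕ Fin d) K)}
    (hAx : ∀ p : Fin d, X (Sum.inl p) ∈ A)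
    (hAu : ∀ p q : Fin d, X (Sum.inl p) * X (Sum.inr q) - X (Sum.inl q) * X (Sum.inr p) ∈ A)
    (b : ℕ) : ∀ (a n : ℕ) (f : MvPolynomial (Fin d ⊕ Fin d) K), n ≤ a + b →
      IsHomogeneous f n → IsWeightedHomogeneous (xWeight d) f a → δ f = 0 → f ∈ A := by
  induction b with
  | zero => exact fun a n f h hn ha _ => mem_of_degree_le hAx hn ha h
  | succ b ih =>
    intro a n f h hn ha hf
    rcases le_or_gt n a with hle | hlt
    · exact mem_of_degree_le hAx hn ha hle
    have hΩ : ∀ p q, cayleyOmega p q f ∈ A := by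
      intro p q
      refine ih (a - 1) (n - 1 - 1) _ (by omega) ?_ ?_ ?_
      · exact hn.pderiv.pderiv.sub hn.pderiv.pderiv
      · have key : ∀ p q : Fin d, IsWeightedHomogeneous (xWeight d)
            (pderiv (Sum.inl p) (pderiv (Sum.inr q) f)) (a - 1) := fun p q =>
          isWeightedHomogeneous_pderiv_sub (isWeightedHomogeneous_pderiv_sub ha (Sum.inr q)) _
        exact (key p q).sub (key q p)
      · rw [derivation_cayleyOmega hx hy, hf]
        simp [cayleyOmega]
    have hmem : C (2 * ((a + 1) * (n - a)) : K) * f ∈ A := by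
      rw [← sum_sum_mul_cayleyOmega hx hy hn ha hf]
      exact A.sum_mem fun p _ => A.sum_mem fun q _ => A.mul_mem (hAu p q) (hΩ p q)
    have hc : (2 * ((a + 1) * (n - a)) : K) ≠ 0 := by
      refine mul_ne_zero two_ne_zero (mul_ne_zero (Nat.cast_add_one_ne_zero a) ?_)
      exact sub_ne_zero.mpr (Nat.cast_injective.ne hlt.ne')
    rw [← smul_eq_C_mul] at hmem
    have h := A.smul_mem hmem (2 * ((a + 1) * (n - a)) : K)⁻¹
    rwa [smul_smul, inv_mul_cancel₀ hc, one_smul] at h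

theorem mem_of_derivation_eq_zero [CharZero K]
    {δ : Derivation K (MvPolynomial (Fin d ⊕ Fin d) K) (MvPolynomial (Fin d ⊕ Fin d) K)}
    (hx : ∀ i : Fin d, δ (X (Sum.inl i)) = 0)
    (hy : ∀ i : Fin d, δ (X (Sum.inr i)) = X (Sum.inl i))
    {A : Subalgebra K (MvPolynomial (Fin d ⊕ Fin d) K)}
    (hAx : ∀ p : Fin d, X (Sum.inl p) ∈ A)
    (hAu : ∀ p q : Fin d, X (Sum.inl p) * X (Sum.inr q) - X (Sum.inl q) * X (Sum.inr p) ∈ A)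
    {f : MvPolynomial (Fin d ⊕ Fin d) K} (hf : δ f = 0) : f ∈ A := by
  have hδ : ∀ i, IsWeightedHomogeneous (1 : Fin d ⊕ Fin d → ℕ) (δ (X i)) (1 + 0) := by
    rintro (i | i)
    · rw [hx]; exact isWeightedHomogeneous_zero _ _ _
    · rw [hy]; exact isWeightedHomogeneous_X _ _ _
  have hδx : ∀ i, IsWeightedHomogeneous (xWeight d) (δ (X i)) (xWeight d i + 1) := by
    rintro (i | i)
    · rw [hx]; exact isWeightedHomogeneous_zero _ _ _
    · rw [hy]; exact isWeightedHomogeneous_X _ _ _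
  refine mem_of_weightedHomogeneousComponent_mem (1 : Fin d ⊕ Fin d → ℕ) A fun n => ?_
  refine mem_of_weightedHomogeneousComponent_mem (xWeight d) A fun a => ?_
  refine mem_of_isHomogeneous hx hy hAx hAu n a n _ (by omega) ?_ ?_ ?_
  · exact isWeightedHomogeneous_component_of_isWeightedHomogeneous
      (weightedHomogeneousComponent_isWeightedHomogeneous _ _) a
  · exact weightedHomogeneousComponent_isWeightedHomogeneous _ _
  · rw [← weightedHomogeneousComponent_derivation δ hδx,
      ← weightedHomogeneousComponent_derivation δ hδ, hf, map_zero, map_zero]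

end Nowicki

/-- **The Nowicki conjecture.** The algebra of constants of the Weitzenböck derivation
`δ` with `δ(xᵢ) = 0`, `δ(yᵢ) = xᵢ` on `K[x₁,…,x_d,y₁,…,y_d]` is generated as a
`K`-algebra by the `xᵢ` and the determinants `u_{pq} = x_p y_q - x_q y_p`, `p < q`. -/
theorem nowicki_conjecture (K : Type*) [Field K] [CharZero K] (d : ℕ) (hd : 2 ≤ d)
    (δ : Derivation K (MvPolynomial (Fin d ⊕ Fin d) K) (MvPolynomial (Fin d ⊕ Fin d) K))
    (hx : ∀ i : Fin d, δ (X (Sum.inl i)) = 0)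
    (hy : ∀ i : Fin d, δ (X (Sum.inr i)) = X (Sum.inl i)) :
    {f : MvPolynomial (Fin d ⊕ Fin d) K | δ f = 0} =
      (Algebra.adjoin K
        ((Set.range fun i : Fin d => (X (Sum.inl i) : MvPolynomial (Fin d ⊕ Fin d) K)) ∪
          {g : MvPolynomial (Fin d ⊕ Fin d) K | ∃ p q : Fin d, p < q ∧
            g = X (Sum.inl p) * X (Sum.inr q) - X (Sum.inl q) * X (Sum.inr p)}) :
        Set (MvPolynomial (Fin d ⊕ Fin d) K)) := by
  set G : Set (MvPolynomial (Fin d ⊕ Fin d) K) := _ ∪ _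
  have hu : ∀ p q : Fin d, p < q → (X (Sum.inl p) * X (Sum.inr q) -
      X (Sum.inl q) * X (Sum.inr p) : MvPolynomial (Fin d ⊕ Fin d) K) ∈ Algebra.adjoin K G :=
    fun p q h => Algebra.subset_adjoin (Or.inr ⟨p, q, h, rfl⟩)
  ext f
  refine ⟨fun hf => Nowicki.mem_of_derivation_eq_zero hx hy
    (fun p => Algebra.subset_adjoin (Or.inl ⟨p, rfl⟩)) (fun p q => ?_) hf, fun hf => ?_⟩
  · rcases lt_trichotomy p q with h | rfl | h
    · exact hu p q h
    · rw [sub_self]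
      exact Subalgebra.zero_mem _
    · rw [← neg_sub]
      exact Subalgebra.neg_mem _ (hu q p h)
  · change δ f = 0
    induction hf using Algebra.adjoin_induction with
    | mem g hg =>
      rcases hg with ⟨i, rfl⟩ | ⟨p, q, -, rfl⟩
      · exact hx i
      · simp only [map_sub, Derivation.leibniz, hx, hy, smul_eq_mul]
        ring
    | algebraMap c => exact δ.map_algebraMap c
    | add g h _ _ hg hh => rw [map_add, hg, hh, add_zero]
    | mul g h _ _ hg hh => rw [Derivation.leibniz, hg, hh, smul_zero, smul_zero, add_zero]
end

section
/- Let K[T,S] be the polynomial algebra over K in the variables t_1,…,t_d and s_{pq} (1 ≤ p < q ≤ d), and let Φ : K[T,S] → K[X_d,Y_d] be the K-algebra homomorphism determined by Φ(t_i) = x_i and Φ(s_{pq}) = u_{pq} = x_p·y_q − x_q·y_p. Then the kernel of Φ is the ideal of K[T,S] generated by the elements t_i·s_{jk} − t_j·s_{ik} + t_k·s_{ij} for 1 ≤ i < j < k ≤ d together with the elements s_{ij}·s_{kl} − s_{ik}·s_{jl} + s_{il}·s_{jk} for 1 ≤ i < j < k < l ≤ d. (These are the defining relations of the algebra of constants K[X_d,Y_d]^δ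 with respect to its generators x_i and u_{pq}.) -/
open MvPolynomial

namespace Nowicki

section LowWeight

variable {σ : Type*} (K : Type*) [Field K] (w : (σ →₀ ℕ) →+ ℕ)

/-- The polynomials all of whose monomials have weight less than `N`. -/
noncomputable def lowWeight (N : ℕ) : Submodule K (MvPolynomial σ K) :=
  restrictSupport K {m | w m < N}

variable {K w}

lemma lowWeight_mono {M N : ℕ} (h : M ≤ N) : lowWeight K w M ≤ lowWeight K w N :=
  fun _ hf _ hm => (hf hm).trans_le h

lemma monomial_mem_lowWeight {m : σ →₀ ℕ} {N : ℕ} (h : w m < N) (c : K) :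
    monomial m c ∈ lowWeight K w N := by
  classical
  intro n hn
  rwa [Finset.mem_singleton.1 (support_monomial_subset hn)]

lemma mul_mem_lowWeight {M N : ℕ} {f g : MvPolynomial σ K} (hf : f ∈ lowWeight K w M)
    (hg : g ∈ lowWeight K w (N + 1)) : f * g ∈ lowWeight K w (M + N) := by
  classical
  intro n hn
  obtain ⟨a, ha, b, hb, rfl⟩ := Finset.mem_add.1 (support_mul f g hn)
  have h₁ : w a < M := hf ha
  have h₂ : w b < N + 1 := hg hb
  change w (a + b) < M + N
  rw [map_add]
  lia

lemma eq_zero_of_mem_lowWeight_zero {f : MvPolynomial σ K} (hf : f ∈ lowWeight K w 0) :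
    f = 0 := by
  rw [← support_eq_empty, Finset.eq_empty_iff_forall_notMem]
  exact fun m hm => Nat.not_lt_zero _ (hf hm)

/-- A homomorphism sending each variable to a monomial plus terms of lower weight sends each
monomial to a monomial plus terms of lower weight. -/
lemma aeval_monomial_sub_mem_lowWeight {τ : Type*} {v : (τ →₀ ℕ) →+ ℕ}
    (Φ : MvPolynomial σ K →ₐ[K] MvPolynomial τ K) (e : (σ →₀ ℕ) →+ (τ →₀ ℕ))
    (h : ∀ s, Φ (X s) - monomial (e (Finsupp.single s 1)) 1 ∈
      lowWeight K v (v (e (Finsupp.single s 1)))) (m : σ →₀ ℕ) :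
    Φ (monomial m 1) - monomial (e m) 1 ∈ lowWeight K v (v (e m)) := by
  have hadd (a b : σ →₀ ℕ)
      (ha : Φ (monomial a 1) - monomial (e a) 1 ∈ lowWeight K v (v (e a)))
      (hb : Φ (monomial b 1) - monomial (e b) 1 ∈ lowWeight K v (v (e b))) :
      Φ (monomial (a + b) 1) - monomial (e (a + b)) 1 ∈ lowWeight K v (v (e (a + b))) := by
    have hb' : Φ (monomial b 1) ∈ lowWeight K v (v (e b) + 1) := by
      rw [← sub_add_cancel (Φ (monomial b 1)) (monomial (e b) 1)]
      exact add_mem (lowWeight_mono (Nat.le_succ _) hb)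
        (monomial_mem_lowWeight (Nat.lt_succ_self _) 1)
    have h₁ := mul_mem_lowWeight ha hb'
    have h₂ := mul_mem_lowWeight hb (monomial_mem_lowWeight (Nat.lt_succ_self (v (e a))) (1 : K))
    rw [add_comm] at h₂
    have hsum := add_mem h₁ h₂
    rw [map_add, map_add]
    convert hsum using 1
    have h₃ : (monomial (a + b) (1 : K)) = monomial a 1 * monomial b 1 := by
      rw [monomial_mul, one_mul]
    have h₄ : (monomial (e a + e b) (1 : K)) = monomial (e a) 1 * monomial (e b) 1 := by
      rw [monomial_mul, one_mul]
    rw [h₃, h₄, map_mul]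
    ring
  have hzero : Φ (monomial 0 1) - monomial (e 0) 1 ∈ lowWeight K v (v (e 0)) := by
    simp
  induction m using Finsupp.induction_linear with
  | zero => exact hzero
  | add a b ha hb => exact hadd a b ha hb
  | single s n =>
    induction n with
    | zero => simp
    | succ n ih =>
      rw [Finsupp.single_add]
      exact hadd _ _ ih (h s)

/-- If two monomials with the same leading term under `Φ` are congruent modulo an ideal
`I ≤ ker Φ` up to terms of lower weight, then `I` is the kernel of `Φ`. -/
lemma mem_of_aeval_eq_zero {τ : Type*} {v : (τ →₀ ℕ) →+ ℕ}
    (Φ : MvPolynomial σ K →ₐ[K] MvPolynomial τ K) (e : (σ →₀ ℕ) →+ (τ →₀ ℕ))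
    (h : ∀ s, Φ (X s) - monomial (e (Finsupp.single s 1)) 1 ∈
      lowWeight K v (v (e (Finsupp.single s 1))))
    (I : Ideal (MvPolynomial σ K)) (hI : ∀ f ∈ I, Φ f = 0)
    (hfib : ∀ m m', e m = e m' → monomial m (1 : K) - monomial m' 1 ∈
      I.restrictScalars K ⊔ lowWeight K (v.comp e) (v (e m)))
    {f : MvPolynomial σ K} (hf : Φ f = 0) : f ∈ I := by
  classical
  suffices H : ∀ N, ∀ f ∈ lowWeight K (v.comp e) N, Φ f = 0 → f ∈ I by
    refine H (f.support.sup (v.comp e) + 1) f (fun m hm => ?_) hf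
    exact Nat.lt_succ_of_le (Finset.le_sup (f := v.comp e) hm)
  intro N
  induction N with
  | zero =>
    intro f hf _
    rw [eq_zero_of_mem_lowWeight_zero hf]
    exact I.zero_mem
  | succ N ih =>
    intro f hf hΦ
    have hwt (m) (hm : m ∈ f.support) : v (e m) ≤ N := Nat.lt_succ_iff.1 (hf hm)
    let r : (τ →₀ ℕ) → (σ →₀ ℕ) := Function.invFun e
    have hr (m) : e (r (e m)) = e m := Function.invFun_eq ⟨m, rfl⟩
    let g : MvPolynomial τ K := ∑ m ∈ f.support, monomial (e m) (coeff m f)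
    let p : MvPolynomial σ K := ∑ m ∈ f.support, monomial (r (e m)) (coeff m f)
    have hg : g ∈ lowWeight K v N := by
      have hsub : Φ f - g ∈ lowWeight K v N := by
        have hsum : Φ f - g = ∑ m ∈ f.support,
            (Φ (monomial m (coeff m f)) - monomial (e m) (coeff m f)) := by
          rw [Finset.sum_sub_distrib, ← map_sum, ← f.as_sum]
        rw [hsum]
        refine sum_mem fun m hm => ?_
        have := (lowWeight K v N).smul_mem (coeff m f)
          (lowWeight_mono (hwt m hm) (aeval_monomial_sub_mem_lowWeight Φ e h m))
        simpa only [smul_sub, ← map_smul, smul_monomial, smul_eq_mul, mul_one] using this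
      simpa [hΦ] using hsub
    have hp : p ∈ lowWeight K (v.comp e) N := by
      intro n hn
      have hpn : coeff n p ≠ 0 := mem_support_iff.1 hn
      have hex : ∃ m ∈ f.support, r (e m) = n := by
        rw [coeff_sum] at hpn
        obtain ⟨m, hm, hne⟩ := Finset.exists_ne_zero_of_sum_ne_zero hpn
        refine ⟨m, hm, ?_⟩
        by_contra hcon
        exact hne (by rw [coeff_monomial, if_neg hcon])
      obtain ⟨m₀, -, rfl⟩ := hex
      have hcoeff : coeff (r (e m₀)) p = coeff (e m₀) g := by
        simp only [p, g, coeff_sum, coeff_monomial]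
        refine Finset.sum_congr rfl fun m _ => ?_
        refine if_congr ⟨fun hm => ?_, fun hm => by rw [hm]⟩ rfl rfl
        rw [← hr m, hm, hr]
      rw [hcoeff] at hpn
      have := hg (mem_support_iff.2 hpn)
      change v (e (r (e m₀))) < N
      rwa [hr]
    have hfp : f - p ∈ I.restrictScalars K ⊔ lowWeight K (v.comp e) N := by
      have hsum : f - p = ∑ m ∈ f.support,
          (monomial m (coeff m f) - monomial (r (e m)) (coeff m f)) := by
        rw [Finset.sum_sub_distrib, ← f.as_sum]
      rw [hsum]
      refine sum_mem fun m hm => ?_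
      have := Submodule.smul_mem _ (coeff m f)
        (sup_le_sup_left (lowWeight_mono (hwt m hm)) (I.restrictScalars K)
          (hfib m (r (e m)) (hr m).symm))
      simpa only [smul_sub, smul_monomial, smul_eq_mul, mul_one] using this
    obtain ⟨a, ha, b, hb, hab⟩ := Submodule.mem_sup.1 hfp
    have haI : a ∈ I := ha
    have hfe : f = a + (b + p) := by rw [← add_assoc, hab, sub_add_cancel]
    rw [hfe]
    refine I.add_mem haI (ih _ (add_mem hb hp) ?_)
    rwa [hfe, map_add, hI a haI, zero_add] at hΦ

lemma monomial_mul_mem_sup {I : Ideal (MvPolynomial σ K)} {N : ℕ} {f : MvPolynomial σ K}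
    (hf : f ∈ I.restrictScalars K ⊔ lowWeight K w N) (n : σ →₀ ℕ) :
    f * monomial n 1 ∈ I.restrictScalars K ⊔ lowWeight K w (N + w n) := by
  obtain ⟨a, ha, b, hb, rfl⟩ := Submodule.mem_sup.1 hf
  have haI : a ∈ I := ha
  rw [add_mul]
  exact Submodule.add_mem_sup (show a * _ ∈ I from I.mul_mem_right _ haI)
    (mul_mem_lowWeight hb (monomial_mem_lowWeight (Nat.lt_succ_self _) 1))

end LowWeight

section Fibres

variable {K : Type*} [Field K] {d : ℕ}

/-- The index set of the variables `tᵢ` and `s_{pq}`. -/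
abbrev Gen (d : ℕ) := Fin d ⊕ {pq : Fin d × Fin d // pq.1 < pq.2}

/-- The exponents of the leading monomials `xᵢ` and `x_p y_q` of the images of the generators. -/
noncomputable def genExp : Gen d → (Fin d ⊕ Fin d →₀ ℕ) :=
  Sum.elim (fun i => Finsupp.single (Sum.inl i) 1)
    fun pq => Finsupp.single (Sum.inl pq.1.1) 1 + Finsupp.single (Sum.inr pq.1.2) 1

/-- The exponent of the leading monomial of the image of a monomial in the generators. -/
noncomputable def leadExp : (Gen d →₀ ℕ) →+ (Fin d ⊕ Fin d →₀ ℕ) :=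
  (Finsupp.linearCombination ℕ genExp).toAddMonoidHom

/-- The weight for which every `xᵢ` has weight `0` and `y_q` has weight `q`. -/
noncomputable def yWeight : (Fin d ⊕ Fin d →₀ ℕ) →+ ℕ :=
  (Finsupp.linearCombination ℕ (Sum.elim (fun _ => 0) fun q : Fin d => (q : ℕ))).toAddMonoidHom

@[simp] lemma leadExp_single (s : Gen d) : leadExp (Finsupp.single s 1) = genExp s := by
  simp [leadExp]

@[simp] lemma yWeight_single_inl (i : Fin d) :
    yWeight (Finsupp.single (Sum.inl i) 1) = 0 := by
  simp [yWeight]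

@[simp] lemma yWeight_single_inr (q : Fin d) :
    yWeight (Finsupp.single (Sum.inr q) 1) = q := by
  simp [yWeight]

@[simp] lemma genExp_inl (i : Fin d) :
    genExp (Sum.inl i : Gen d) = Finsupp.single (Sum.inl i) 1 := rfl

@[simp] lemma genExp_inr (pq : {pq : Fin d × Fin d // pq.1 < pq.2}) :
    genExp (Sum.inr pq : Gen d) =
      Finsupp.single (Sum.inl pq.1.1) 1 + Finsupp.single (Sum.inr pq.1.2) 1 := rfl

lemma leadExp_ne_zero_iff {m : Gen d →₀ ℕ} {t : Fin d ⊕ Fin d} :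
    leadExp m t ≠ 0 ↔ ∃ s, m s ≠ 0 ∧ genExp s t ≠ 0 := by
  have h : leadExp m t = ∑ s ∈ m.support, m s * genExp s t := by
    simp [leadExp, Finsupp.linearCombination_apply, Finsupp.sum]
  rw [h, ne_eq, Finset.sum_eq_zero_iff]
  simp only [Finsupp.mem_support_iff, mul_eq_zero, not_forall, not_or, exists_prop]
  exact exists_congr fun s => by tauto

lemma leadExp_inl_ne_zero {m : Gen d →₀ ℕ} {i : Fin d} (h : leadExp m (Sum.inl i) ≠ 0) :
    m (Sum.inl i) ≠ 0 ∨ ∃ q, ∃ hq : i < q, m (Sum.inr ⟨(i, q), hq⟩) ≠ 0 := by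
  obtain ⟨s | ⟨⟨p, q⟩, hpq⟩, hm, hs⟩ := leadExp_ne_zero_iff.1 h
  · obtain rfl : s = i := by
      by_contra hne
      exact hs (by simp [hne])
    exact Or.inl hm
  · obtain rfl : p = i := by
      by_contra hne
      exact hs (by simp [hne])
    exact Or.inr ⟨q, hpq, hm⟩

lemma leadExp_inr_ne_zero {m : Gen d →₀ ℕ} {q : Fin d} (h : leadExp m (Sum.inr q) ≠ 0) :
    ∃ p, ∃ hp : p < q, m (Sum.inr ⟨(p, q), hp⟩) ≠ 0 := by
  obtain ⟨s | ⟨⟨p, q'⟩, hpq⟩, hm, hs⟩ := leadExp_ne_zero_iff.1 h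
  · exact absurd (by simp) hs
  · obtain rfl : q' = q := by
      by_contra hne
      exact hs (by simp [hne])
    exact ⟨p, hpq, hm⟩

lemma exists_eq_single_add {σ : Type*} {m : σ →₀ ℕ} {s : σ} (h : m s ≠ 0) :
    ∃ m', m = Finsupp.single s 1 + m' := by
  classical
  refine ⟨m - Finsupp.single s 1, (add_tsub_cancel_of_le ?_).symm⟩
  exact Finsupp.single_le_iff.2 (Nat.one_le_iff_ne_zero.2 h)

/-- The ideal contains the three-term relations among the `tᵢ` and `s_{pq}`. -/
structure HasRelations (I : Ideal (MvPolynomial (Gen d) K)) : Prop where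
  linear : ∀ (i j k : Fin d) (hij : i < j) (hjk : j < k),
    X (Sum.inl i) * X (Sum.inr ⟨(j, k), hjk⟩)
      - X (Sum.inl j) * X (Sum.inr ⟨(i, k), hij.trans hjk⟩)
      + X (Sum.inl k) * X (Sum.inr ⟨(i, j), hij⟩) ∈ I
  quadratic : ∀ (i j k l : Fin d) (hij : i < j) (hjk : j < k) (hkl : k < l),
    X (Sum.inr ⟨(i, j), hij⟩) * X (Sum.inr ⟨(k, l), hkl⟩)
      - X (Sum.inr ⟨(i, k), hij.trans hjk⟩) * X (Sum.inr ⟨(j, l), hjk.trans hkl⟩)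
      + X (Sum.inr ⟨(i, l), (hij.trans hjk).trans hkl⟩) * X (Sum.inr ⟨(j, k), hjk⟩) ∈ I

/-- The generators `a, b` may be exchanged for `a', b'` modulo `I` and lower weight when
`a b - a' b'` differs from an element of `I` by a product `c c'` of smaller weight. -/
lemma exchange {I : Ideal (MvPolynomial (Gen d) K)} {a b a' b' c c' : Gen d}
    (hrel : (X a * X b - X a' * X b' + X c * X c' : MvPolynomial (Gen d) K) ∈ I)
    (hexp : genExp a' + genExp b' = genExp a + genExp b)
    (hwt : yWeight (genExp c + genExp c') < yWeight (genExp a + genExp b))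
    (n : Gen d →₀ ℕ) :
    leadExp (Finsupp.single a' 1 + (Finsupp.single b' 1 + n)) =
        leadExp (Finsupp.single a 1 + (Finsupp.single b 1 + n)) ∧
      monomial (Finsupp.single a 1 + (Finsupp.single b 1 + n)) (1 : K) -
          monomial (Finsupp.single a' 1 + (Finsupp.single b' 1 + n)) 1 ∈
        I.restrictScalars K ⊔ lowWeight K (yWeight.comp leadExp)
          (yWeight (leadExp (Finsupp.single a 1 + (Finsupp.single b 1 + n)))) := by
  have hX (s s' : Gen d) : (monomial (Finsupp.single s 1 + (Finsupp.single s' 1 + n)) (1 : K)) =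
      X s * X s' * monomial n 1 := by
    rw [X, X, monomial_mul, monomial_mul, add_assoc, one_mul, one_mul]
  refine ⟨by simp only [map_add, leadExp_single, ← add_assoc, hexp], ?_⟩
  have hc : (X c * X c' : MvPolynomial (Gen d) K) ∈
      lowWeight K (yWeight.comp leadExp) (yWeight (genExp a + genExp b)) := by
    rw [X, X, monomial_mul]
    exact monomial_mem_lowWeight (by simpa using hwt) _
  have hab : (X a * X b - X a' * X b' : MvPolynomial (Gen d) K) ∈
      I.restrictScalars K ⊔
        lowWeight K (yWeight.comp leadExp) (yWeight (genExp a + genExp b)) := by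
    rw [← add_sub_cancel_right (X a * X b - X a' * X b') (X c * X c')]
    exact sub_mem (Submodule.mem_sup_left hrel) (Submodule.mem_sup_right hc)
  have := monomial_mul_mem_sup hab n
  rw [hX, hX, ← sub_mul]
  simpa only [map_add, leadExp_single, AddMonoidHom.comp_apply, add_assoc] using this

/-- All monomials with a given leading exponent are divisible by a common generator, modulo the
relations and terms of lower weight. -/
lemma exists_common_generator {I : Ideal (MvPolynomial (Gen d) K)} (hI : HasRelations I)
    {m₀ : Gen d →₀ ℕ} (hm₀ : m₀ ≠ 0) :
    ∃ a, ∀ m, leadExp m = leadExp m₀ → ∃ n,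
      leadExp (Finsupp.single a 1 + n) = leadExp m ∧
      monomial m (1 : K) - monomial (Finsupp.single a 1 + n) 1 ∈
        I.restrictScalars K ⊔ lowWeight K (yWeight.comp leadExp) (yWeight (leadExp m)) := by
  classical
  have hdvd {m : Gen d →₀ ℕ} {a : Gen d} (ha : m a ≠ 0) : ∃ n,
      leadExp (Finsupp.single a 1 + n) = leadExp m ∧
      monomial m (1 : K) - monomial (Finsupp.single a 1 + n) 1 ∈
        I.restrictScalars K ⊔ lowWeight K (yWeight.comp leadExp) (yWeight (leadExp m)) := by
    obtain ⟨n, rfl⟩ := exists_eq_single_add ha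
    exact ⟨n, rfl, by rw [sub_self]; exact zero_mem _⟩
  have hx : ∃ i, leadExp m₀ (Sum.inl i) ≠ 0 := by
    obtain ⟨s, hs⟩ := Finsupp.ne_iff.1 hm₀
    rcases s with i | ⟨⟨p, q⟩, hpq⟩
    · exact ⟨i, leadExp_ne_zero_iff.2 ⟨_, hs, by simp⟩⟩
    · exact ⟨p, leadExp_ne_zero_iff.2 ⟨_, hs, by simp⟩⟩
  by_cases hy : ∃ j, leadExp m₀ (Sum.inr j) ≠ 0
  · obtain ⟨i, hi, hi_min⟩ := exists_minimal_of_wellFoundedLT _ hx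
    obtain ⟨j, hj, hj_min⟩ := exists_minimal_of_wellFoundedLT _ hy
    replace hi_min (p : Fin d) (hp : leadExp m₀ (Sum.inl p) ≠ 0) : i ≤ p :=
      (le_total i p).elim id (hi_min hp)
    replace hj_min (q : Fin d) (hq : leadExp m₀ (Sum.inr q) ≠ 0) : j ≤ q :=
      (le_total j q).elim id (hj_min hq)
    have hpj {m : Gen d →₀ ℕ} (hm : leadExp m = leadExp m₀) :
        ∃ p, ∃ hp : p < j, i ≤ p ∧ m (Sum.inr ⟨(p, j), hp⟩) ≠ 0 := by
      obtain ⟨p, hp, hmp⟩ := leadExp_inr_ne_zero (hm ▸ hj)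
      exact ⟨p, hp, hi_min p (hm ▸ leadExp_ne_zero_iff.2 ⟨_, hmp, by simp⟩), hmp⟩
    have hij : i < j := by
      obtain ⟨p, hp, hip, -⟩ := hpj rfl
      exact hip.trans_lt hp
    refine ⟨Sum.inr ⟨(i, j), hij⟩, fun m hm => ?_⟩
    obtain ⟨p, hp, hip, hmp⟩ := hpj hm
    rcases hip.eq_or_lt with rfl | hip
    · exact hdvd hmp
    rcases leadExp_inl_ne_zero (hm ▸ hi) with hmi | ⟨q, hq, hmi⟩
    · obtain ⟨m', rfl⟩ := exists_eq_single_add hmi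
      obtain ⟨n, rfl⟩ := exists_eq_single_add (m := m') (by simpa using hmp)
      refine ⟨Finsupp.single (Sum.inl p) 1 + n, exchange (c := Sum.inl j)
        (c' := Sum.inr ⟨(i, p), hip⟩) ?_ ?_ ?_ n⟩
      · convert hI.linear i p j hip hp using 1
        ring
      · simp only [genExp_inl, genExp_inr]
        abel
      · simpa using hp
    · have hjq : j ≤ q := hj_min q (hm ▸ leadExp_ne_zero_iff.2 ⟨_, hmi, by simp⟩)
      rcases hjq.eq_or_lt with rfl | hjq
      · exact hdvd hmi
      obtain ⟨m', rfl⟩ := exists_eq_single_add hmi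
      obtain ⟨n, rfl⟩ := exists_eq_single_add (m := m')
        (s := Sum.inr ⟨(p, j), hp⟩) (by simpa [Finsupp.single_apply, hip.ne] using hmp)
      refine ⟨Finsupp.single (Sum.inr ⟨(p, q), hp.trans hjq⟩) 1 + n, exchange
        (c := Sum.inr ⟨(i, p), hip⟩) (c' := Sum.inr ⟨(j, q), hjq⟩) ?_ ?_ ?_ n⟩
      · convert hI.quadratic i p j q hip hp hjq using 1
        ring
      · simp only [genExp_inr]
        abel
      · simp only [genExp_inr, map_add, yWeight_single_inl, yWeight_single_inr]
        have : (p : ℕ) < j := hp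
        lia
  · obtain ⟨i, hi⟩ := hx
    refine ⟨Sum.inl i, fun m hm => ?_⟩
    rcases leadExp_inl_ne_zero (hm ▸ hi) with hmi | ⟨q, hq, hmi⟩
    · exact hdvd hmi
    · exact absurd ⟨q, hm ▸ leadExp_ne_zero_iff.2 ⟨_, hmi, by simp⟩⟩ hy

/-- Monomials with the same leading exponent agree modulo the relations and lower weight. -/
lemma monomial_sub_monomial_mem {I : Ideal (MvPolynomial (Gen d) K)} (hI : HasRelations I)
    (m m' : Gen d →₀ ℕ) (h : leadExp m = leadExp m') :
    monomial m (1 : K) - monomial m' 1 ∈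
      I.restrictScalars K ⊔ lowWeight K (yWeight.comp leadExp) (yWeight (leadExp m)) := by
  have hpos (a : Gen d) : 0 < (genExp a).degree := by
    rcases a with i | pq <;> simp
  induction hN : (leadExp m).degree using Nat.strong_induction_on generalizing m m' with
  | _ N ih =>
    by_cases hm : m = 0
    · subst hm
      have : m' = 0 := by
        by_contra hne
        obtain ⟨s, hs⟩ := Finsupp.ne_iff.1 hne
        obtain ⟨n, rfl⟩ := exists_eq_single_add hs
        have h' := congrArg Finsupp.degree h
        rw [map_zero, map_zero, map_add, leadExp_single, map_add] at h'
        have := hpos s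
        lia
      rw [this, sub_self]
      exact zero_mem _
    · obtain ⟨a, ha⟩ := exists_common_generator hI hm
      obtain ⟨n, hn, hmn⟩ := ha m rfl
      obtain ⟨n', hn', hmn'⟩ := ha m' h.symm
      have hnn : leadExp n = leadExp n' := by
        have := hn.trans (h.trans hn'.symm)
        rwa [map_add, map_add, add_right_inj] at this
      have hlt : (leadExp n).degree < N := by
        rw [← hN, ← hn, map_add, map_add, leadExp_single]
        have := hpos a
        lia
      have key := monomial_mul_mem_sup (ih _ hlt n n' hnn rfl) (Finsupp.single a 1)
      rw [AddMonoidHom.comp_apply, ← map_add, ← map_add, add_comm n, hn, sub_mul, monomial_mul,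
        monomial_mul, one_mul, add_comm n, add_comm n'] at key
      rw [← h] at hmn'
      convert sub_mem (add_mem hmn key) hmn' using 1
      ring

end Fibres

end Nowicki

/-- The defining relations of the algebra of constants `K[X_d,Y_d]^δ` with respect to the
generators `xᵢ` and `u_{pq} = x_p y_q - x_q y_p`: the kernel of the homomorphism
`Φ : K[T,S] → K[X_d,Y_d]`, `tᵢ ↦ xᵢ`, `s_{pq} ↦ u_{pq}`, is generated by the relations
`tᵢ s_{jk} - tⱼ s_{ik} + t_k s_{ij}` (`i < j < k`) and
`s_{ij} s_{kl} - s_{ik} s_{jl} + s_{il} s_{jk}` (`i < j < k < l`). -/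
theorem nowicki_defining_relations (K : Type*) [Field K] [CharZero K] (d : ℕ) (hd : 2 ≤ d) :
    RingHom.ker ((aeval (R := K)
        (Sum.elim (fun i : Fin d => (X (Sum.inl i) : MvPolynomial (Fin d ⊕ Fin d) K))
          (fun pq : {pq : Fin d × Fin d // pq.1 < pq.2} =>
            X (Sum.inl pq.1.1) * X (Sum.inr pq.1.2) - X (Sum.inl pq.1.2) * X (Sum.inr pq.1.1)))) :
        MvPolynomial (Fin d ⊕ {pq : Fin d × Fin d // pq.1 < pq.2}) K →+*
          MvPolynomial (Fin d ⊕ Fin d) K) =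
      Ideal.span
        ({g : MvPolynomial (Fin d ⊕ {pq : Fin d × Fin d // pq.1 < pq.2}) K |
            ∃ i j k : Fin d, ∃ hij : i < j, ∃ hjk : j < k,
              g = X (Sum.inl i) * X (Sum.inr ⟨(j, k), hjk⟩)
                - X (Sum.inl j) * X (Sum.inr ⟨(i, k), hij.trans hjk⟩)
                + X (Sum.inl k) * X (Sum.inr ⟨(i, j), hij⟩)} ∪
          {g : MvPolynomial (Fin d ⊕ {pq : Fin d × Fin d // pq.1 < pq.2}) K |
            ∃ i j k l : Fin d, ∃ hij : i < j, ∃ hjk : j < k, ∃ hkl : k < l,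
              g = X (Sum.inr ⟨(i, j), hij⟩) * X (Sum.inr ⟨(k, l), hkl⟩)
                - X (Sum.inr ⟨(i, k), hij.trans hjk⟩) * X (Sum.inr ⟨(j, l), hjk.trans hkl⟩)
                + X (Sum.inr ⟨(i, l), (hij.trans hjk).trans hkl⟩) * X (Sum.inr ⟨(j, k), hjk⟩)}) := by
  set Φ := aeval (R := K)
    (Sum.elim (fun i : Fin d => (X (Sum.inl i) : MvPolynomial (Fin d ⊕ Fin d) K))
      (fun pq : {pq : Fin d × Fin d // pq.1 < pq.2} =>
        X (Sum.inl pq.1.1) * X (Sum.inr pq.1.2) - X (Sum.inl pq.1.2) * X (Sum.inr pq.1.1)))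
    with hΦ
  have hlead (s : Nowicki.Gen d) :
      Φ (X s) - monomial (Nowicki.leadExp (Finsupp.single s 1)) 1 ∈
        Nowicki.lowWeight K Nowicki.yWeight
          (Nowicki.yWeight (Nowicki.leadExp (Finsupp.single s 1))) := by
    rcases s with i | ⟨⟨p, q⟩, hpq⟩
    · rw [hΦ, aeval_X, Nowicki.leadExp_single]
      simp [X]
    · rw [hΦ, aeval_X, Nowicki.leadExp_single]
      simp only [Sum.elim_inr, Nowicki.genExp_inr, X, monomial_mul, one_mul, sub_sub_cancel_left]
      exact neg_mem (Nowicki.monomial_mem_lowWeight (by simpa using hpq) 1)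
  set I : Ideal (MvPolynomial (Nowicki.Gen d) K) := Ideal.span (_ ∪ _) with hI
  have hle : I ≤ RingHom.ker (Φ : MvPolynomial (Nowicki.Gen d) K →+* MvPolynomial (Fin d ⊕ Fin d) K) := by
    rw [hI, Ideal.span_le]
    rintro g (⟨i, j, k, hij, hjk, rfl⟩ | ⟨i, j, k, l, hij, hjk, hkl, rfl⟩) <;>
    · simp only [SetLike.mem_coe, RingHom.mem_ker, RingHom.coe_coe, hΦ, map_add, map_sub, map_mul,
        aeval_X, Sum.elim_inl, Sum.elim_inr]
      ring
  have hrel : Nowicki.HasRelations I :=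
    ⟨fun i j k hij hjk => Ideal.subset_span (Or.inl ⟨i, j, k, hij, hjk, rfl⟩),
      fun i j k l hij hjk hkl => Ideal.subset_span (Or.inr ⟨i, j, k, l, hij, hjk, hkl, rfl⟩)⟩
  exact hle.antisymm' fun f hf => Nowicki.mem_of_aeval_eq_zero Φ Nowicki.leadExp hlead I
    (fun g hg => hle hg) (Nowicki.monomial_sub_monomial_mem hrel) hf
end

section
/- Call a product x_{i_1}⋯x_{i_m}·u_{k_1 l_1}⋯u_{k_s l_s} (with m, s ≥ 0, 1 ≤ i_1 ≤ … ≤ i_m ≤ d, 1 ≤ k_t < l_t ≤ d, the pairs (k_t, l_t) ordered so that k_1 ≤ … ≤ k_s and l_t ≤ l_{t+1} whenever k_t = k_{t+1}) canonical if: (i) no two of the open intervals (k_α, l_α), (k_β, l_β) cross, i.e., there are no α, β with k_α < k_β < l_α < l_β; and (ii) no i_γ lies strictly inside any interval, i.e., never k_α < i_γ < l_α. Then the canonical products form a basis of the K-vector space K[X_d,Y_d]^δ = {f ∈ K[X_d,Y_d] : δ(f) = 0}: they are linearly independent over K and span K[X_d,Y_d]^δ. -/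
open MvPolynomial

/-- An index for a canonical product `x_{i₁} ⋯ x_{i_m} · u_{k₁l₁} ⋯ u_{k_s l_s}`:
the exponents of the `x`'s are recorded by the finitely supported function `e`, and the
(unordered) list of factors `u_{kl}` (`k < l`) by the multiset `m`.  The conditions say
that no two of the open intervals `(k_α, l_α)` cross each other, and that no variable
`x_γ` occurring in the product is covered by one of the intervals. -/
structure CanonicalIndex (d : ℕ) where
  e : Fin d →₀ ℕ
  m : Multiset {pq : Fin d × Fin d // pq.1 < pq.2}
  noncross : ∀ a ∈ m, ∀ b ∈ m, ¬(a.1.1 < b.1.1 ∧ b.1.1 < a.1.2 ∧ a.1.2 < b.1.2)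
  nocover : ∀ a ∈ m, ∀ γ : Fin d, e γ ≠ 0 → ¬(a.1.1 < γ ∧ γ < a.1.2)

/-- The canonical product `x_{i₁} ⋯ x_{i_m} · u_{k₁l₁} ⋯ u_{k_s l_s}` attached to a
canonical index. -/
noncomputable def canonicalProduct (K : Type*) [Field K] (d : ℕ) (c : CanonicalIndex d) :
    MvPolynomial (Fin d ⊕ Fin d) K :=
  (c.e.prod fun γ n => X (Sum.inl γ) ^ n) *
    (c.m.map fun a =>
      X (Sum.inl a.1.1) * X (Sum.inr a.1.2) - X (Sum.inl a.1.2) * X (Sum.inr a.1.1)).prod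

section SlTwo

variable {K V : Type*} [Field K] [AddCommGroup V] [Module K V]

/-- A vector of weight `μ` for an `sl₂`-action has its weight shifted by `2 * n` under `E ^ n`. -/
lemma sl2_weight_raise {E H : Module.End K V} (hE : ∀ v, H (E v) = E (H v) + (2 : K) • E v)
    {μ : K} {v : V} (hv : H v = μ • v) (n : ℕ) :
    H ((E ^ n) v) = (μ + 2 * n) • (E ^ n) v := by
  induction n with
  | zero => simpa using hv
  | succ n ih =>
    rw [pow_succ', Module.End.mul_apply, hE, ih, map_smul, ← add_smul]
    push_cast
    ring_nf

/-- A vector of weight `μ` for an `sl₂`-action has its weight shifted by `-2 * n` under `F ^ n`. -/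
lemma sl2_weight_lower {F H : Module.End K V} (hF : ∀ v, H (F v) = F (H v) - (2 : K) • F v)
    {μ : K} {v : V} (hv : H v = μ • v) (n : ℕ) :
    H ((F ^ n) v) = (μ - 2 * n) • (F ^ n) v := by
  induction n with
  | zero => simpa using hv
  | succ n ih =>
    rw [pow_succ', Module.End.mul_apply, hF, ih, map_smul, ← sub_smul]
    push_cast
    ring_nf

lemma sl2_pow_comm {E F H : Module.End K V} (hEF : ∀ v, E (F v) = F (E v) + H v)
    (hE : ∀ v, H (E v) = E (H v) + (2 : K) • E v)
    {μ : K} {v : V} (hv : H v = μ • v) (n : ℕ) :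
    (E ^ n) (F (E v)) = F ((E ^ (n + 1)) v) + (n * (μ + n + 1)) • (E ^ n) v := by
  induction n with
  | zero => simp
  | succ n ih =>
    rw [pow_succ' E n, Module.End.mul_apply, ih, map_add, map_smul, hEF,
      sl2_weight_raise hE hv, pow_succ' E (n + 1), Module.End.mul_apply, Module.End.mul_apply,
      add_assoc, pow_succ' E n, Module.End.mul_apply, ← add_smul]
    congr 2
    push_cast
    ring

/-- In a locally nilpotent `sl₂`-module, `E ^ j` is injective on vectors of weight `≤ -j`. -/
theorem sl2_eq_zero_of_pow_eq_zero [CharZero K] {E F H : Module.End K V}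
    (hEF : ∀ v, E (F v) = F (E v) + H v)
    (hE : ∀ v, H (E v) = E (H v) + (2 : K) • E v)
    (hF : ∀ v, H (F v) = F (H v) - (2 : K) • F v)
    (hnil : ∀ v, ∃ n, (F ^ n) v = 0) (j : ℕ) (μ : ℤ) (hj : (j : ℤ) ≤ -μ) (v : V)
    (hv : H v = (μ : K) • v) (hEv : (E ^ j) v = 0) : v = 0 := by
  induction j generalizing v with
  | zero => simpa using hEv
  | succ n ih =>
    have key : F (E v) = ((n * (μ + n + 1) : ℤ) : K) • v := by
      refine sub_eq_zero.1 (ih (by push_cast at hj; omega) _ ?_ ?_)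
      · rw [map_sub, hF, hE, hv]
        simp only [map_smul, map_add, hv]
        module
      · rw [map_sub, sl2_pow_comm hEF hE hv, hEv, map_zero, zero_add, map_smul]
        push_cast
        exact sub_self _
    have hc : (n : ℤ) * (μ + n + 1) ≤ 0 :=
      mul_nonpos_of_nonneg_of_nonpos (by positivity) (by push_cast at hj; omega)
    have step : ∀ k : ℕ, ∃ c : ℤ, c ≤ 0 ∧ F (E ((F ^ k) v)) = (c : K) • (F ^ k) v := by
      intro k
      induction k with
      | zero => exact ⟨_, hc, by simpa using key⟩
      | succ k ihk =>
        obtain ⟨c, hc0, hck⟩ := ihk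
        refine ⟨c + (μ - 2 * k), by push_cast at hj; omega, ?_⟩
        rw [pow_succ', Module.End.mul_apply, hEF, hck, sl2_weight_lower hF hv, ← add_smul, map_smul]
        push_cast
        ring_nf
    have inj : ∀ k : ℕ, (F ^ (k + 1)) v = 0 → (F ^ k) v = 0 := by
      intro k hk
      obtain ⟨c, hc0, hck⟩ := step k
      have h : E (F ((F ^ k) v)) = ((c + (μ - 2 * k) : ℤ) : K) • (F ^ k) v := by
        rw [hEF, hck, sl2_weight_lower hF hv, ← add_smul]
        push_cast
        ring_nf
      rw [← Module.End.mul_apply F, ← pow_succ', hk, map_zero] at h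
      refine (smul_eq_zero.1 h.symm).resolve_left ?_
      rw [Int.cast_eq_zero]
      push_cast at hj
      omega
    obtain ⟨N, hN⟩ := hnil v
    induction N with
    | zero => simpa using hN
    | succ N ihN => exact ihN (inj N hN)

end SlTwo

section Combinatorics

variable {d : ℕ}

/-- The exponent of the monomial `x^e * ∏ x_k y_l`, the product being over `(k, l) ∈ m`. -/
noncomputable def leadExp (e : Fin d →₀ ℕ) (m : Multiset {pq : Fin d × Fin d // pq.1 < pq.2}) :
    Fin d ⊕ Fin d →₀ ℕ :=
  e.mapDomain Sum.inl +
    (m.map fun a => Finsupp.single (Sum.inl a.1.1) 1 + Finsupp.single (Sum.inr a.1.2) 1).sum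

lemma leadExp_cons (e : Fin d →₀ ℕ) (a : {pq : Fin d × Fin d // pq.1 < pq.2})
    (m : Multiset {pq : Fin d × Fin d // pq.1 < pq.2}) :
    leadExp e (a ::ₘ m) = leadExp e m +
      (Finsupp.single (Sum.inl a.1.1) 1 + Finsupp.single (Sum.inr a.1.2) 1) := by
  simp only [leadExp, Multiset.map_cons, Multiset.sum_cons]
  abel

lemma leadExp_zero_inl (e : Fin d →₀ ℕ) (i : Fin d) : leadExp e 0 (Sum.inl i) = e i := by
  simp [leadExp, Finsupp.mapDomain_apply Sum.inl_injective]

lemma leadExp_zero_inr (e : Fin d →₀ ℕ) (i : Fin d) : leadExp e 0 (Sum.inr i) = 0 := by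
  simp [leadExp, Finsupp.mapDomain_of_notMem_range]

lemma leadExp_inl_ne_zero (e : Fin d →₀ ℕ) (m : Multiset {pq : Fin d × Fin d // pq.1 < pq.2})
    (k : Fin d) : leadExp e m (Sum.inl k) ≠ 0 ↔ e k ≠ 0 ∨ ∃ a ∈ m, a.1.1 = k := by
  induction m using Multiset.induction with
  | empty => simp [leadExp_zero_inl]
  | cons a m ih =>
    by_cases h : a.1.1 = k
    · simp [leadExp_cons, h]
    · simp [leadExp_cons, h, ih]

lemma leadExp_inr_ne_zero (e : Fin d →₀ ℕ) (m : Multiset {pq : Fin d × Fin d // pq.1 < pq.2})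
    (l : Fin d) : leadExp e m (Sum.inr l) ≠ 0 ↔ ∃ a ∈ m, a.1.2 = l := by
  induction m using Multiset.induction with
  | empty => simp [leadExp_zero_inr]
  | cons a m ih =>
    by_cases h : a.1.2 = l
    · simp [leadExp_cons, h]
    · simp [leadExp_cons, h, ih]

/-- If `l` is the first index with `y_l` in the monomial, and `k < l` is the last index with
`x_k` in the monomial, then any canonical index for this monomial contains `(k, l)`. -/
lemma CanonicalIndex.mem_of_extremal (c : CanonicalIndex d) {k l : Fin d} (hkl : k < l)
    (hl : leadExp c.e c.m (Sum.inr l) ≠ 0)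
    (hlmin : ∀ l' < l, leadExp c.e c.m (Sum.inr l') = 0)
    (hk : leadExp c.e c.m (Sum.inl k) ≠ 0)
    (hkmax : ∀ k', k < k' → k' < l → leadExp c.e c.m (Sum.inl k') = 0) :
    (⟨(k, l), hkl⟩ : {pq : Fin d × Fin d // pq.1 < pq.2}) ∈ c.m := by
  obtain ⟨⟨⟨k₀, l₀⟩, h₀⟩, ha, rfl⟩ := (leadExp_inr_ne_zero _ _ _).1 hl
  dsimp only at h₀ hkl hlmin hkmax ⊢
  have hk₀ : ¬ k < k₀ := fun h =>
    (leadExp_inl_ne_zero _ _ _).2 (Or.inr ⟨_, ha, rfl⟩) (hkmax k₀ h h₀)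
  rcases (not_lt.1 hk₀).eq_or_lt with rfl | hlt
  · exact ha
  rcases (leadExp_inl_ne_zero _ _ _).1 hk with he | ⟨⟨⟨k₁, l₁⟩, h₁⟩, hb, rfl⟩
  · exact absurd ⟨hlt, hkl⟩ (c.nocover _ ha k he)
  · dsimp only at *
    have hl₁ : ¬ l₁ < l₀ := fun h =>
      (leadExp_inr_ne_zero _ _ _).2 ⟨_, hb, rfl⟩ (hlmin l₁ h)
    rcases (not_lt.1 hl₁).eq_or_lt with rfl | hlt'
    · exact hb
    · exact absurd ⟨hlt, hkl, hlt'⟩ (c.noncross _ ha _ hb)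

/-- The ballot condition on exponents: for each `l`, the total degree in `y_1, …, y_l` is at most
the total degree in `x_1, …, x_{l-1}`. -/
def IsBallot (s : Fin d ⊕ Fin d →₀ ℕ) : Prop :=
  ∀ l : Fin d, ∑ i ∈ Finset.Iic l, s (Sum.inr i) ≤ ∑ i ∈ Finset.Iio l, s (Sum.inl i)

lemma IsBallot.exists_extremal {s : Fin d ⊕ Fin d →₀ ℕ} (hs : IsBallot s)
    (h : ∃ l, s (Sum.inr l) ≠ 0) :
    ∃ k l, k < l ∧ s (Sum.inr l) ≠ 0 ∧ (∀ l' < l, s (Sum.inr l') = 0) ∧ s (Sum.inl k) ≠ 0 ∧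
      ∀ k', k < k' → k' < l → s (Sum.inl k') = 0 := by
  classical
  obtain ⟨l, hl, hlmin⟩ := WellFounded.has_min (wellFounded_lt (α := Fin d))
    {l | s (Sum.inr l) ≠ 0} h
  have hex : ∃ k, k < l ∧ s (Sum.inl k) ≠ 0 := by
    have h1 : 0 < ∑ i ∈ Finset.Iio l, s (Sum.inl i) :=
      lt_of_lt_of_le (Nat.pos_of_ne_zero hl) <|
        (Finset.single_le_sum (f := fun i => s (Sum.inr i)) (fun _ _ => Nat.zero_le _)
          (Finset.mem_Iic.2 le_rfl)).trans (hs l)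
    obtain ⟨k, hk, hk0⟩ := Finset.exists_ne_zero_of_sum_ne_zero h1.ne'
    exact ⟨k, Finset.mem_Iio.1 hk, hk0⟩
  obtain ⟨k, ⟨hkl, hk⟩, hkmax⟩ := WellFounded.has_min (wellFounded_gt (α := Fin d))
    {k | k < l ∧ s (Sum.inl k) ≠ 0} hex
  refine ⟨k, l, hkl, hl, fun l' h' => ?_, hk, fun k' h1 h2 => ?_⟩
  · by_contra h0
    exact hlmin l' h0 h'
  · by_contra h0
    exact hkmax k' ⟨h2, h0⟩ h1

lemma isBallot_leadExp (e : Fin d →₀ ℕ) (m : Multiset {pq : Fin d × Fin d // pq.1 < pq.2}) :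
    IsBallot (leadExp e m) := by
  intro l
  induction m using Multiset.induction with
  | empty => simp [leadExp_zero_inr]
  | cons a m ih =>
    simp only [leadExp_cons, Finsupp.add_apply, Finset.sum_add_distrib]
    refine add_le_add ih ?_
    have ha := a.2
    simp only [Finsupp.single_apply, Sum.inl.injEq, Sum.inr.injEq, reduceCtorEq, if_false,
      Finset.sum_const_zero, zero_add, add_zero, Finset.sum_ite_eq, Finset.mem_Iic,
      Finset.mem_Iio]
    split_ifs with h1 h2
    · rfl
    · exact absurd (ha.trans_le h1) h2
    · exact Nat.zero_le _
    · rfl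

/-- Removing an element of the multiset of intervals. -/
def CanonicalIndex.erase (c : CanonicalIndex d) (a : {pq : Fin d × Fin d // pq.1 < pq.2}) :
    CanonicalIndex d where
  e := c.e
  m := c.m.erase a
  noncross x hx y hy := c.noncross x (Multiset.mem_of_mem_erase hx) y (Multiset.mem_of_mem_erase hy)
  nocover x hx := c.nocover x (Multiset.mem_of_mem_erase hx)

lemma CanonicalIndex.leadExp_injective :
    Function.Injective fun c : CanonicalIndex d => leadExp c.e c.m := by
  suffices ∀ n, ∀ c c' : CanonicalIndex d, Multiset.card c.m = n →
      leadExp c.e c.m = leadExp c'.e c'.m → c.e = c'.e ∧ c.m = c'.m by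
    intro c c' h
    obtain ⟨h1, h2⟩ := this _ c c' rfl h
    cases c
    cases c'
    simp_all
  intro n
  induction n with
  | zero =>
    intro c c' hc h
    rw [Multiset.card_eq_zero] at hc
    have hm : c'.m = 0 := by
      refine Multiset.eq_zero_of_forall_notMem fun a ha => ?_
      refine (leadExp_inr_ne_zero c'.e c'.m a.1.2).2 ⟨a, ha, rfl⟩ ?_
      rw [← h, hc, leadExp_zero_inr]
    refine ⟨?_, hc.trans hm.symm⟩
    ext i
    rw [← leadExp_zero_inl c.e i, ← leadExp_zero_inl c'.e i, ← hc, h, hc, hm]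
  | succ n ih =>
    intro c c' hc h
    obtain ⟨a, ha⟩ := Multiset.card_pos_iff_exists_mem.1 (n.succ_pos.trans_eq hc.symm)
    obtain ⟨k, l, hkl, h1, h2, h3, h4⟩ := (isBallot_leadExp c.e c.m).exists_extremal
      ⟨a.1.2, (leadExp_inr_ne_zero c.e c.m a.1.2).2 ⟨a, ha, rfl⟩⟩
    have hmem := c.mem_of_extremal hkl h1 h2 h3 h4
    rw [h] at h1 h3
    simp only [h] at h2 h4
    have hmem' := c'.mem_of_extremal hkl h1 h2 h3 h4
    have e1 := Multiset.cons_erase hmem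
    have e2 := Multiset.cons_erase hmem'
    obtain ⟨r1, r2⟩ := ih (c.erase ⟨(k, l), hkl⟩) (c'.erase ⟨(k, l), hkl⟩)
      (by simp [CanonicalIndex.erase, Multiset.card_erase_of_mem hmem, hc]) (by
        rw [← e1, ← e2, leadExp_cons, leadExp_cons] at h
        exact add_right_cancel h)
    refine ⟨r1, ?_⟩
    rw [← e1, ← e2]
    exact congrArg _ r2

lemma IsBallot.exists_canonicalIndex {s : Fin d ⊕ Fin d →₀ ℕ} (hs : IsBallot s) :
    ∃ c : CanonicalIndex d, leadExp c.e c.m = s := by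
  induction hn : ∑ l, s (Sum.inr l) generalizing s with
  | zero =>
    refine ⟨⟨s.comapDomain Sum.inl Sum.inl_injective.injOn, 0, by simp, by simp⟩, ?_⟩
    ext (i | i)
    · simp [leadExp_zero_inl]
    · rw [leadExp_zero_inr]
      exact (Finset.sum_eq_zero_iff.1 hn i (Finset.mem_univ i)).symm
  | succ n ih =>
    obtain ⟨l₀, -, hl₀⟩ := Finset.exists_ne_zero_of_sum_ne_zero (hn.trans_ne n.succ_ne_zero)
    obtain ⟨k, l, hkl, h1, h2, h3, h4⟩ := hs.exists_extremal ⟨l₀, hl₀⟩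
    set u : Fin d ⊕ Fin d →₀ ℕ := Finsupp.single (Sum.inl k) 1 + Finsupp.single (Sum.inr l) 1
      with hu
    obtain ⟨t, rfl⟩ : ∃ t, s = t + u := by
      refine ⟨s - u, (tsub_add_cancel_of_le fun i => ?_).symm⟩
      rcases i with i | i
      · simp only [hu, Finsupp.add_apply, Finsupp.single_apply, Sum.inl.injEq, reduceCtorEq,
          if_false, add_zero]
        split_ifs with h
        · exact Nat.pos_of_ne_zero (h ▸ h3)
        · exact Nat.zero_le _
      · simp only [hu, Finsupp.add_apply, Finsupp.single_apply, Sum.inr.injEq, reduceCtorEq,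
          if_false, zero_add]
        split_ifs with h
        · exact Nat.pos_of_ne_zero (h ▸ h1)
        · exact Nat.zero_le _
    have ux : ∀ i, u (Sum.inl i) = if k = i then 1 else 0 := by
      intro i
      simp [hu, Finsupp.single_apply]
    have uy : ∀ i, u (Sum.inr i) = if l = i then 1 else 0 := by
      intro i
      simp [hu, Finsupp.single_apply]
    have ht : IsBallot t := by
      intro l'
      by_cases hl' : l ≤ l'
      · have := hs l'
        simp only [Finsupp.add_apply, Finset.sum_add_distrib, ux, uy, Finset.sum_ite_eq,
          Finset.mem_Iic, Finset.mem_Iio, hl', hkl.trans_le hl', if_true] at this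
        exact Nat.le_of_add_le_add_right this
      · rw [Finset.sum_eq_zero fun i hi => ?_]
        · exact Nat.zero_le _
        · have := h2 i ((Finset.mem_Iic.1 hi).trans_lt (not_le.1 hl'))
          exact (Nat.add_eq_zero_iff.1 this).1
    obtain ⟨c, hc⟩ := ih ht (by
      simp only [Finsupp.add_apply, Finset.sum_add_distrib, uy, Finset.sum_ite_eq,
        Finset.mem_univ, if_true] at hn
      exact Nat.succ_injective hn)
    have hend : ∀ a ∈ c.m, l ≤ a.1.2 := fun a ha => by
      by_contra h
      refine (leadExp_inr_ne_zero c.e c.m a.1.2).2 ⟨a, ha, rfl⟩ ?_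
      rw [hc]
      exact (Nat.add_eq_zero_iff.1 (h2 _ (not_le.1 h))).1
    have hx : ∀ i, leadExp c.e c.m (Sum.inl i) ≠ 0 → ¬ (k < i ∧ i < l) := fun i hi h => by
      rw [hc] at hi
      exact hi (Nat.add_eq_zero_iff.1 (h4 i h.1 h.2)).1
    refine ⟨⟨c.e, ⟨(k, l), hkl⟩ ::ₘ c.m, ?_, ?_⟩, ?_⟩
    · intro a ha b hb
      rcases Multiset.mem_cons.1 ha with rfl | ha <;> rcases Multiset.mem_cons.1 hb with rfl | hb
      · exact fun h => h.1.false
      · exact fun h => hx b.1.1 ((leadExp_inl_ne_zero _ _ _).2 (Or.inr ⟨b, hb, rfl⟩)) ⟨h.1, h.2.1⟩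
      · exact fun h => (hend a ha).not_gt h.2.2
      · exact c.noncross a ha b hb
    · intro a ha γ hγ
      rcases Multiset.mem_cons.1 ha with rfl | ha
      · exact hx γ ((leadExp_inl_ne_zero _ _ _).2 (Or.inl hγ))
      · exact c.nocover a ha γ hγ
    · rw [leadExp_cons, hc]

end Combinatorics

section Graded

variable {K σ M : Type*} [Field K] [AddCommGroup M]

lemma weightedHomogeneousComponent_X_mul_pderiv (w : σ → M) (n : M) (i j : σ)
    (f : MvPolynomial σ K) :
    weightedHomogeneousComponent w n (X i * pderiv j f) =
      X i * pderiv j (weightedHomogeneousComponent w (n - w i + w j) f) := by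
  classical
  induction f using MvPolynomial.induction_on' with
  | add p q hp hq => simp only [map_add, mul_add, hp, hq]
  | monomial s r =>
    by_cases hs : s j = 0
    · have h0 : pderiv j (monomial s r) = 0 := by simp [hs]
      rw [h0, mul_zero, map_zero]
      by_cases hn : Finsupp.weight w s = n - w i + w j
      · rw [(isWeightedHomogeneous_monomial w s r hn).weightedHomogeneousComponent_same, h0,
          mul_zero]
      · rw [(isWeightedHomogeneous_monomial w s r rfl).weightedHomogeneousComponent_ne _
            (Ne.symm hn), map_zero, mul_zero]
    · have hw : Finsupp.weight w (Finsupp.single i 1 + (s - Finsupp.single j 1)) =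
          Finsupp.weight w s + w i - w j := by
        have h : s = (s - Finsupp.single j 1) + Finsupp.single j 1 :=
          (tsub_add_cancel_of_le (Finsupp.single_le_iff.2 (Nat.pos_of_ne_zero hs))).symm
        conv_rhs => rw [h]
        simp only [map_add, Finsupp.weight_single, one_smul]
        abel
      have hm : X i * pderiv j (monomial s r) =
          monomial (Finsupp.single i 1 + (s - Finsupp.single j 1)) (r * s j) := by
        rw [pderiv_monomial, X, monomial_mul, one_mul]
      by_cases hn : Finsupp.weight w s = n - w i + w j
      · rw [(isWeightedHomogeneous_monomial w s r hn).weightedHomogeneousComponent_same, hm,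
          (isWeightedHomogeneous_monomial w _ _ ?_).weightedHomogeneousComponent_same]
        rw [hw, hn]
        abel
      · rw [(isWeightedHomogeneous_monomial w s r rfl).weightedHomogeneousComponent_ne _
            (Ne.symm hn), hm,
          (isWeightedHomogeneous_monomial w _ _ rfl).weightedHomogeneousComponent_ne, map_zero,
          mul_zero]
        rw [hw]
        intro h
        exact hn (by rw [h]; abel)

lemma X_mul_pderiv_eq_smul {i : σ} {n : ℕ} {f : MvPolynomial σ K}
    (hf : ∀ s ∈ f.support, s i = n) : X i * pderiv i f = n • f := by
  rw [f.as_sum, map_sum, Finset.mul_sum, Finset.smul_sum]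
  refine Finset.sum_congr rfl fun s hs => ?_
  rw [X_mul_pderiv_monomial, hf s hs]

end Graded

section Operators

variable (K : Type*) [Field K] {d : ℕ}

/-- The derivation `∑ i < l, x_i ∂/∂y_i`. -/
noncomputable def raiseBelow (l : Fin d) :
    Derivation K (MvPolynomial (Fin d ⊕ Fin d) K) (MvPolynomial (Fin d ⊕ Fin d) K) :=
  ∑ i ∈ Finset.Iio l, X (R := K) (Sum.inl i : Fin d ⊕ Fin d) • pderiv (Sum.inr i)

/-- The derivation `∑ i < l, y_i ∂/∂x_i`. -/
noncomputable def lowerBelow (l : Fin d) :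
    Derivation K (MvPolynomial (Fin d ⊕ Fin d) K) (MvPolynomial (Fin d ⊕ Fin d) K) :=
  ∑ i ∈ Finset.Iio l, X (R := K) (Sum.inr i : Fin d ⊕ Fin d) • pderiv (Sum.inl i)

/-- The derivation `∑ i < l, (x_i ∂/∂x_i - y_i ∂/∂y_i)`. -/
noncomputable def weightBelow (l : Fin d) :
    Derivation K (MvPolynomial (Fin d ⊕ Fin d) K) (MvPolynomial (Fin d ⊕ Fin d) K) :=
  ∑ i ∈ Finset.Iio l, (X (R := K) (Sum.inl i : Fin d ⊕ Fin d) • pderiv (Sum.inl i) -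
    X (R := K) (Sum.inr i : Fin d ⊕ Fin d) • pderiv (Sum.inr i))

variable {K}

lemma derivation_finset_sum_apply {σ ι : Type*} (s : Finset ι)
    (D : ι → Derivation K (MvPolynomial σ K) (MvPolynomial σ K)) (f : MvPolynomial σ K) :
    (∑ i ∈ s, D i) f = ∑ i ∈ s, D i f := by
  classical
  induction s using Finset.induction_on with
  | empty => simp
  | insert a s ha ih => rw [Finset.sum_insert ha, Finset.sum_insert ha, Derivation.add_apply, ih]

lemma raiseBelow_apply (l : Fin d) (f : MvPolynomial (Fin d ⊕ Fin d) K) :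
    raiseBelow K l f = ∑ i ∈ Finset.Iio l, X (Sum.inl i) * pderiv (Sum.inr i) f := by
  simp [raiseBelow, derivation_finset_sum_apply]

lemma lowerBelow_apply (l : Fin d) (f : MvPolynomial (Fin d ⊕ Fin d) K) :
    lowerBelow K l f = ∑ i ∈ Finset.Iio l, X (Sum.inr i) * pderiv (Sum.inl i) f := by
  simp [lowerBelow, derivation_finset_sum_apply]

lemma weightBelow_apply (l : Fin d) (f : MvPolynomial (Fin d ⊕ Fin d) K) :
    weightBelow K l f = ∑ i ∈ Finset.Iio l,
      (X (Sum.inl i) * pderiv (Sum.inl i) f - X (Sum.inr i) * pderiv (Sum.inr i) f) := by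
  simp [weightBelow, derivation_finset_sum_apply]

lemma raiseBelow_X_inl (l i : Fin d) : raiseBelow K l (X (Sum.inl i)) = 0 := by
  simp [raiseBelow_apply]

lemma raiseBelow_X_inr (l i : Fin d) :
    raiseBelow K l (X (Sum.inr i)) = if i < l then X (Sum.inl i) else 0 := by
  simp [raiseBelow_apply, pderiv_X, Pi.single_apply]

lemma lowerBelow_X_inl (l i : Fin d) :
    lowerBelow K l (X (Sum.inl i)) = if i < l then X (Sum.inr i) else 0 := by
  simp [lowerBelow_apply, pderiv_X, Pi.single_apply]

lemma lowerBelow_X_inr (l i : Fin d) : lowerBelow K l (X (Sum.inr i)) = 0 := by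
  simp [lowerBelow_apply]

lemma weightBelow_X_inl (l i : Fin d) :
    weightBelow K l (X (Sum.inl i)) = if i < l then X (Sum.inl i) else 0 := by
  simp [weightBelow_apply, pderiv_X, Pi.single_apply]

lemma weightBelow_X_inr (l i : Fin d) :
    weightBelow K l (X (Sum.inr i)) = if i < l then -X (Sum.inr i) else 0 := by
  split_ifs with h <;> simp [weightBelow_apply, pderiv_X, Pi.single_apply, h]

lemma raiseBelow_lowerBelow (l : Fin d) (f : MvPolynomial (Fin d ⊕ Fin d) K) :
    raiseBelow K l (lowerBelow K l f) = lowerBelow K l (raiseBelow K l f) + weightBelow K l f := by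
  have h : ⁅raiseBelow K l, lowerBelow K l⁆ = weightBelow K l := by
    refine derivation_ext fun i => ?_
    rw [Derivation.commutator_apply]
    rcases i with i | i <;> by_cases hi : i < l <;>
      simp [hi, raiseBelow_X_inl, raiseBelow_X_inr, lowerBelow_X_inl, lowerBelow_X_inr,
        weightBelow_X_inl, weightBelow_X_inr]
  rw [← h, Derivation.commutator_apply]
  abel

lemma weightBelow_raiseBelow (l : Fin d) (f : MvPolynomial (Fin d ⊕ Fin d) K) :
    weightBelow K l (raiseBelow K l f) =
      raiseBelow K l (weightBelow K l f) + (2 : K) • raiseBelow K l f := by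
  have h : ⁅weightBelow K l, raiseBelow K l⁆ = (2 : K) • raiseBelow K l := by
    refine derivation_ext fun i => ?_
    rw [Derivation.commutator_apply]
    rcases i with i | i <;> by_cases hi : i < l <;>
      simp [hi, raiseBelow_X_inl, raiseBelow_X_inr, weightBelow_X_inl, weightBelow_X_inr, two_smul]
  rw [← Derivation.smul_apply, ← h, Derivation.commutator_apply]
  abel

lemma weightBelow_lowerBelow (l : Fin d) (f : MvPolynomial (Fin d ⊕ Fin d) K) :
    weightBelow K l (lowerBelow K l f) =
      lowerBelow K l (weightBelow K l f) - (2 : K) • lowerBelow K l f := by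
  have h : ⁅lowerBelow K l, weightBelow K l⁆ = (2 : K) • lowerBelow K l := by
    refine derivation_ext fun i => ?_
    rw [Derivation.commutator_apply]
    rcases i with i | i <;> by_cases hi : i < l <;>
      simp [hi, lowerBelow_X_inl, lowerBelow_X_inr, weightBelow_X_inl, weightBelow_X_inr, two_smul]
  rw [← Derivation.smul_apply, ← h, Derivation.commutator_apply]
  abel

lemma lowerBelow_pow_monomial (l : Fin d) (n : ℕ) (s : Fin d ⊕ Fin d →₀ ℕ) (r : K)
    (hs : ∑ i, s (Sum.inl i) < n) :
    ((lowerBelow K l : Module.End K (MvPolynomial (Fin d ⊕ Fin d) K)) ^ n) (monomial s r) = 0 := by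
  induction n generalizing s r with
  | zero => simp at hs
  | succ n ih =>
    rw [pow_succ, Module.End.mul_apply, Derivation.coeFn_coe, lowerBelow_apply, map_sum]
    refine Finset.sum_eq_zero fun i _ => ?_
    rw [pderiv_monomial, X, monomial_mul, one_mul]
    by_cases hi : s (Sum.inl i) = 0
    · simp [hi]
    refine ih _ _ ?_
    have h : (∑ j, (Finsupp.single (Sum.inr i) 1 + (s - Finsupp.single (Sum.inl i) 1) :
        Fin d ⊕ Fin d →₀ ℕ) (Sum.inl j)) < ∑ j, s (Sum.inl j) := by
      refine Finset.sum_lt_sum (fun j _ => by simp) ⟨i, Finset.mem_univ i, ?_⟩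
      simp
      omega
    omega

lemma exists_lowerBelow_pow_eq_zero (l : Fin d) (f : MvPolynomial (Fin d ⊕ Fin d) K) :
    ∃ n, ((lowerBelow K l : Module.End K (MvPolynomial (Fin d ⊕ Fin d) K)) ^ n) f = 0 := by
  obtain ⟨N, hN⟩ : ∃ N, ∀ s ∈ f.support, ∑ i, s (Sum.inl i) < N :=
    ⟨f.support.sup (fun s => ∑ i, s (Sum.inl i)) + 1, fun s hs =>
      Nat.lt_succ_of_le (Finset.le_sup (f := fun s => ∑ i, s (Sum.inl i)) hs)⟩
  refine ⟨N, ?_⟩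
  rw [f.as_sum, map_sum]
  exact Finset.sum_eq_zero fun s hs => lowerBelow_pow_monomial l _ _ _ (hN s hs)

lemma weightBelow_eq_smul {l : Fin d} {μ : ℤ} {f : MvPolynomial (Fin d ⊕ Fin d) K}
    (hf : ∀ s ∈ f.support, ∑ i ∈ Finset.Iio l, ((s (Sum.inl i) : ℤ) - s (Sum.inr i)) = μ) :
    weightBelow K l f = (μ : K) • f := by
  conv_lhs => rw [f.as_sum]
  conv_rhs => rw [f.as_sum]
  rw [map_sum, Finset.smul_sum]
  refine Finset.sum_congr rfl fun s hs => ?_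
  rw [weightBelow_apply, ← hf s hs, Int.cast_sum, Finset.sum_smul]
  refine Finset.sum_congr rfl fun i _ => ?_
  rw [X_mul_pderiv_monomial, X_mul_pderiv_monomial]
  push_cast
  rw [sub_smul, Nat.cast_smul_eq_nsmul, Nat.cast_smul_eq_nsmul]

lemma raiseBelow_comm (l : Fin d) (f : MvPolynomial (Fin d ⊕ Fin d) K) :
    raiseBelow K l (X (Sum.inl l) * pderiv (Sum.inr l) f) =
      X (Sum.inl l) * pderiv (Sum.inr l) (raiseBelow K l f) := by
  have h : ⁅raiseBelow K l, X (R := K) (Sum.inl l : Fin d ⊕ Fin d) •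
      pderiv (R := K) (Sum.inr l : Fin d ⊕ Fin d)⁆ = 0 := by
    refine derivation_ext fun i => ?_
    rw [Derivation.commutator_apply]
    rcases i with i | i <;> by_cases hi : i < l <;>
      simp [hi, raiseBelow_X_inl, raiseBelow_X_inr, pderiv_X, Pi.single_apply, apply_ite]
  have h2 := congrArg
    (fun D : Derivation K (MvPolynomial (Fin d ⊕ Fin d) K) (MvPolynomial (Fin d ⊕ Fin d) K) => D f) h
  simp only [Derivation.commutator_apply, Derivation.smul_apply, smul_eq_mul] at h2
  exact sub_eq_zero.1 (by simpa using h2)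

end Operators

section Ballot

variable {K : Type*} [Field K] {d : ℕ}

/-- The multigrading recording the `sl₂`-weight of the part of a monomial in the variables of index
less than `l`, and the exponents of the `y_i` with `l ≤ i`. -/
def tailWeight (l : Fin d) : Fin d ⊕ Fin d → ℤ × (Fin d → ℤ)
  | Sum.inl i => (if i < l then 1 else 0, 0)
  | Sum.inr i => if i < l then (-1, 0) else (0, Pi.single i 1)

lemma weight_tailWeight (l : Fin d) (s : Fin d ⊕ Fin d →₀ ℕ) :
    Finsupp.weight (tailWeight l) s =
      (∑ i ∈ Finset.Iio l, ((s (Sum.inl i) : ℤ) - s (Sum.inr i)),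
        fun i => if i < l then 0 else (s (Sum.inr i) : ℤ)) := by
  classical
  rw [Finsupp.weight_apply, Finsupp.sum_fintype _ _ (by simp), Fintype.sum_sum_type]
  have hfilter : Finset.Iio l = Finset.univ.filter (· < l) := by ext; simp
  refine Prod.ext ?_ (funext fun j => ?_)
  · rw [Prod.fst_add, Prod.fst_sum, Prod.fst_sum, hfilter, Finset.sum_filter,
      ← Finset.sum_add_distrib]
    refine Finset.sum_congr rfl fun i _ => ?_
    by_cases h : i < l <;> simp [tailWeight, h, sub_eq_add_neg]
  · rw [Prod.snd_add, Prod.snd_sum, Prod.snd_sum, Pi.add_apply, Finset.sum_apply,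
      Finset.sum_apply, Finset.sum_eq_zero (by simp [tailWeight]), zero_add,
      Finset.sum_eq_single j]
    · by_cases h : j < l <;> simp [tailWeight, h]
    · intro i _ hij
      by_cases h : i < l <;> simp [tailWeight, h, hij.symm]
    · simp

/-- Every monomial of a component of `f` for `tailWeight l` is a monomial of `f`, and its
multidegree can be read off from the index of the component. -/
lemma weight_of_mem_support_component {l : Fin d} {n : ℤ × (Fin d → ℤ)}
    {f : MvPolynomial (Fin d ⊕ Fin d) K} {s : Fin d ⊕ Fin d →₀ ℕ}
    (hs : s ∈ (weightedHomogeneousComponent (tailWeight l) n f).support) :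
    s ∈ f.support ∧ ∑ i ∈ Finset.Iio l, ((s (Sum.inl i) : ℤ) - s (Sum.inr i)) = n.1 ∧
      ∀ i, l ≤ i → (s (Sum.inr i) : ℤ) = n.2 i := by
  classical
  rw [support_weightedHomogeneousComponent, Finset.mem_filter, weight_tailWeight] at hs
  obtain ⟨h1, rfl⟩ := hs
  exact ⟨h1, rfl, fun i hi => by simp [hi.not_gt]⟩

/-- If `s` is a monomial of a constant `f` of the Weitzenböck derivation and the exponents of the
variables `y_i` in `s` are maximal among the monomials of `f`, in the lexicographic order in which
the last `y_i` is the most significant one, then `s` satisfies the ballot condition. -/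
theorem isBallot_of_isMax [CharZero K] {f : MvPolynomial (Fin d ⊕ Fin d) K}
    (hf : ∑ i, X (Sum.inl i) * pderiv (Sum.inr i) f = 0) {s : Fin d ⊕ Fin d →₀ ℕ}
    (hs : s ∈ f.support)
    (hmax : ∀ t ∈ f.support, ∀ i, (∀ j, i < j → t (Sum.inr j) = s (Sum.inr j)) →
      t (Sum.inr i) ≤ s (Sum.inr i)) : IsBallot s := by
  classical
  intro l
  by_contra hl
  rw [not_le] at hl
  set b := s (Sum.inr l) with hb
  set μ : ℤ := ∑ i ∈ Finset.Iio l, ((s (Sum.inl i) : ℤ) - s (Sum.inr i)) with hμ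
  have hμb : μ + 1 ≤ b := by
    have h1 : ∑ i ∈ Finset.Iic l, s (Sum.inr i) = b + ∑ i ∈ Finset.Iio l, s (Sum.inr i) := by
      rw [← Finset.Iio_insert l, Finset.sum_insert (by simp)]
    rw [hμ, Finset.sum_sub_distrib]
    rw [h1] at hl
    zify at hl
    linarith
  let n : ℕ → ℤ × (Fin d → ℤ) := fun j =>
    (μ - 2 * j, (fun i => if i < l then 0 else (s (Sum.inr i) : ℤ)) - Pi.single l (j : ℤ))
  let C := weightedHomogeneousComponent (R := K) (tailWeight l)
  let E := raiseBelow K l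
  have hshift : ∀ m : ℤ × (Fin d → ℤ), E (C m f) +
      ∑ i ∈ Finset.Ici l, X (Sum.inl i) *
        pderiv (Sum.inr i) (C (m + (2, 0) + (0, Pi.single i 1)) f) = 0 := by
    intro m
    have h := congrArg (C (m + (2, 0))) hf
    rw [map_sum, map_zero, ← Finset.sum_filter_add_sum_filter_not _ (· < l)] at h
    rw [← h]
    simp only [C, weightedHomogeneousComponent_X_mul_pderiv, E, raiseBelow_apply]
    congr 1
    · refine Finset.sum_congr (by ext; simp) fun i hi => ?_
      have hi' := (Finset.mem_filter.1 hi).2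
      have e : m = m + (2, 0) - tailWeight l (Sum.inl i) + tailWeight l (Sum.inr i) := by
        simp only [tailWeight, hi', if_true]
        refine Prod.ext ?_ ?_
        · simp only [Prod.fst_add, Prod.fst_sub]
          ring
        · simp
      rw [← e]
    · refine Finset.sum_congr (by ext; simp) fun i hi => ?_
      have hi' := (Finset.mem_filter.1 hi).2
      have e : m + (2, 0) + (0, Pi.single i 1) =
          m + (2, 0) - tailWeight l (Sum.inl i) + tailWeight l (Sum.inr i) := by
        simp only [tailWeight, hi', if_false]
        refine Prod.ext ?_ ?_ <;> simp
      rw [← e]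
  have hvanish : ∀ (m : ℤ × (Fin d → ℤ)) (i : Fin d), l ≤ i →
      m.2 i = s (Sum.inr i) + 1 → (∀ j, i < j → m.2 j = s (Sum.inr j)) → C m f = 0 := by
    intro m i hi hmi hmj
    rw [← support_eq_empty, Finset.eq_empty_iff_forall_notMem]
    intro t ht
    obtain ⟨h1, -, h3⟩ := weight_of_mem_support_component ht
    have h4 := hmax t h1 i fun j hj => by
      have := (h3 j (hi.trans hj.le)).trans (hmj j hj)
      exact_mod_cast this
    have h5 := (h3 i hi).trans hmi
    omega
  have hrel : ∀ j, E (C (n j) f) +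
      X (Sum.inl l) * pderiv (Sum.inr l) (C (n j + (2, 0) + (0, Pi.single l 1)) f) = 0 := by
    intro j
    rw [← hshift (n j), Finset.sum_eq_single_of_mem l (by simp)]
    intro i hi hil
    have hli : l < i := lt_of_le_of_ne (Finset.mem_Ici.1 hi) hil.symm
    rw [hvanish _ i hli.le, map_zero, mul_zero]
    · simp [n, hli.not_gt, hil]
    · intro k hk
      simp [n, (hli.trans hk).not_gt, (hli.trans hk).ne', hk.ne']
  have h0 : E (C (n 0) f) = 0 := by
    have h := hrel 0
    rwa [hvanish (n 0 + (2, 0) + (0, Pi.single l 1)) l le_rfl, map_zero, mul_zero, add_zero] at h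
    · simp [n]
    · intro k hk
      simp [n, hk.not_gt, hk.ne']
  have hsucc : ∀ j, E (C (n (j + 1)) f) +
      X (Sum.inl l) * pderiv (Sum.inr l) (C (n j) f) = 0 := by
    intro j
    have e : n (j + 1) + (2, 0) + (0, Pi.single l 1) = n j := by
      refine Prod.ext ?_ (funext fun i => ?_)
      · simp only [n, Prod.fst_add]
        push_cast
        ring
      · by_cases h : i = l
        · subst h
          simp [n]
          ring
        · simp [n, h]
    rw [← hrel (j + 1), e]
  have hpow : ∀ j, ((E : Module.End K (MvPolynomial (Fin d ⊕ Fin d) K)) ^ (j + 1)) (C (n j) f) = 0 ∧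
      ((E : Module.End K (MvPolynomial (Fin d ⊕ Fin d) K)) ^ (j + 1))
        (X (Sum.inl l) * pderiv (Sum.inr l) (C (n j) f)) = 0 := by
    have comm : ∀ (j : ℕ) (g : MvPolynomial (Fin d ⊕ Fin d) K),
        ((E : Module.End K (MvPolynomial (Fin d ⊕ Fin d) K)) ^ j)
          (X (Sum.inl l) * pderiv (Sum.inr l) g) =
        X (Sum.inl l) * pderiv (Sum.inr l)
          (((E : Module.End K (MvPolynomial (Fin d ⊕ Fin d) K)) ^ j) g) := by
      intro j
      induction j with
      | zero => simp
      | succ j ih =>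
        intro g
        rw [pow_succ', Module.End.mul_apply, ih, Module.End.mul_apply]
        exact raiseBelow_comm l _
    intro j
    induction j with
    | zero =>
      have h : ((E : Module.End K (MvPolynomial (Fin d ⊕ Fin d) K)) ^ (0 + 1)) (C (n 0) f) = 0 := by
        simpa using h0
      exact ⟨h, by rw [comm, h]; simp⟩
    | succ j ih =>
      have h : ((E : Module.End K (MvPolynomial (Fin d ⊕ Fin d) K)) ^ (j + 1 + 1))
          (C (n (j + 1)) f) = 0 := by
        rw [pow_succ, Module.End.mul_apply, Derivation.coeFn_coe,
          eq_neg_of_add_eq_zero_left (hsucc j), map_neg, ih.2, neg_zero]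
      exact ⟨h, by rw [comm, h]; simp⟩
  have hzero : C (n b) f = 0 := by
    refine sl2_eq_zero_of_pow_eq_zero (E := (E : Module.End K _))
      (F := (lowerBelow K l : Module.End K _)) (H := (weightBelow K l : Module.End K _))
      (raiseBelow_lowerBelow l) (weightBelow_raiseBelow l) (weightBelow_lowerBelow l)
      (exists_lowerBelow_pow_eq_zero l) (b + 1) (μ - 2 * b) (by push_cast; linarith) _ ?_ (hpow b).1
    exact weightBelow_eq_smul fun t ht => (weight_of_mem_support_component ht).2.1
  have hdesc : ∀ j, j ≤ b → C (n (b - j)) f = 0 := by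
    intro j
    induction j with
    | zero => exact fun _ => hzero
    | succ j ih =>
      intro hj
      have h := hsucc (b - (j + 1))
      rw [show b - (j + 1) + 1 = b - j by omega, ih (by omega), map_zero, zero_add] at h
      have h' : pderiv (Sum.inr l) (C (n (b - (j + 1))) f) = 0 :=
        (mul_eq_zero.1 h).resolve_left (X_ne_zero _)
      have h2 := X_mul_pderiv_eq_smul (i := Sum.inr l) (n := j + 1)
        (f := C (n (b - (j + 1))) f) fun t ht => by
          have h3 := (weight_of_mem_support_component ht).2.2 l le_rfl
          simp only [n, Pi.sub_apply, lt_irrefl, if_false, Pi.single_eq_same] at h3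
          omega
      rw [h', mul_zero, eq_comm, smul_eq_zero] at h2
      exact h2.resolve_left j.succ_ne_zero
  have hcoeff : coeff s (C (n 0) f) = coeff s f := by
    rw [coeff_weightedHomogeneousComponent, if_pos]
    rw [weight_tailWeight]
    simp [n, hμ]
  have := hdesc b le_rfl
  rw [Nat.sub_self] at this
  rw [this, coeff_zero] at hcoeff
  exact mem_support_iff.1 hs hcoeff.symm

end Ballot

section LeadingMonomial

variable {d : ℕ}

/-- The position of a variable in the order `y_d, …, y_1, x_1, …, x_d`. -/
def varRank : Fin d ⊕ Fin d → ℤ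
  | Sum.inl i => i
  | Sum.inr i => -(i + 1)

lemma varRank_injective : Function.Injective (varRank (d := d)) := by
  rintro (i | i) (j | j) h <;> simp only [varRank, Sum.inl.injEq, Sum.inr.injEq] at h ⊢ <;> omega

/-- The lexicographic monomial order on a finite set of variables for the order induced by an
injective rank function; variables of smaller rank are larger. -/
noncomputable def MonomialOrder.lexOfRank {σ : Type*} [Finite σ] (r : σ → ℤ)
    (hr : Function.Injective r) : MonomialOrder σ :=
  letI : LinearOrder σ := LinearOrder.lift' r hr
  MonomialOrder.lex

lemma MonomialOrder.lexOfRank_lt {σ : Type*} [Finite σ] {r : σ → ℤ}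
    (hr : Function.Injective r) {s t : σ →₀ ℕ} {i : σ} (hi : s i < t i)
    (hj : ∀ j, r j < r i → s j = t j) :
    (MonomialOrder.lexOfRank r hr).toSyn s < (MonomialOrder.lexOfRank r hr).toSyn t :=
  let : LinearOrder σ := LinearOrder.lift' r hr
  MonomialOrder.lex_lt_iff.2 (Finsupp.Lex.lt_iff.2 ⟨i, hj, hi⟩)

/-- The lexicographic monomial order for `y_d > ⋯ > y_1 > x_1 > ⋯ > x_d`. -/
noncomputable def yLex (d : ℕ) : MonomialOrder (Fin d ⊕ Fin d) :=
  MonomialOrder.lexOfRank varRank varRank_injective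

lemma yLex_lt {s t : Fin d ⊕ Fin d →₀ ℕ} {i : Fin d} (hi : s (Sum.inr i) < t (Sum.inr i))
    (hj : ∀ j, i < j → s (Sum.inr j) = t (Sum.inr j)) :
    (yLex d).toSyn s < (yLex d).toSyn t := by
  refine MonomialOrder.lexOfRank_lt varRank_injective hi fun v hv => ?_
  rcases v with j | j
  · simp only [varRank] at hv
    omega
  · refine hj j (Fin.lt_def.2 ?_)
    simp only [varRank] at hv
    omega

variable (K : Type*) [Field K]

lemma monic_degree_minor {k l : Fin d} (hkl : k < l) :
    (yLex d).Monic (X (R := K) (Sum.inl k) * X (Sum.inr l) - X (Sum.inl l) * X (Sum.inr k)) ∧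
      (yLex d).degree (X (R := K) (Sum.inl k) * X (Sum.inr l) - X (Sum.inl l) * X (Sum.inr k)) =
        Finsupp.single (Sum.inl k) 1 + Finsupp.single (Sum.inr l) 1 := by
  classical
  have hX : ∀ i j : Fin d, (X (R := K) (Sum.inl i) * X (Sum.inr j) :
      MvPolynomial (Fin d ⊕ Fin d) K) =
        monomial (Finsupp.single (Sum.inl i) 1 + Finsupp.single (Sum.inr j) 1) 1 := by
    intro i j
    rw [X, X, monomial_mul, one_mul]
  have hlt : (yLex d).toSyn ((yLex d).degree (X (R := K) (Sum.inl l) * X (Sum.inr k))) <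
      (yLex d).toSyn ((yLex d).degree (X (R := K) (Sum.inl k) * X (Sum.inr l))) := by
    rw [hX, hX, MonomialOrder.degree_monomial, MonomialOrder.degree_monomial,
      if_neg one_ne_zero, if_neg one_ne_zero]
    refine yLex_lt (i := l) ?_ fun j hj => ?_
    · simp [hkl.ne]
    · simp [(hkl.trans hj).ne, hj.ne]
  constructor
  · rw [MonomialOrder.Monic, MonomialOrder.leadingCoeff_sub_of_lt hlt, hX,
      MonomialOrder.leadingCoeff_monomial]
  · rw [MonomialOrder.degree_sub_of_lt hlt, hX, MonomialOrder.degree_monomial,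
      if_neg one_ne_zero]

lemma monic_degree_canonicalProduct (c : CanonicalIndex d) :
    (yLex d).Monic (canonicalProduct K d c) ∧
      (yLex d).degree (canonicalProduct K d c) = leadExp c.e c.m := by
  classical
  obtain ⟨e, m, h1, h2⟩ := c
  simp only [canonicalProduct]
  clear h1 h2
  induction m using Multiset.induction with
  | empty =>
    have h : (e.prod fun γ n => X (R := K) (Sum.inl γ : Fin d ⊕ Fin d) ^ n) =
        monomial (e.mapDomain Sum.inl) 1 := by
      rw [monomial_eq, Finsupp.prod_mapDomain_index (by simp) (by simp [pow_add]), C_1, one_mul]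
    rw [Multiset.map_zero, Multiset.prod_zero, mul_one, h, MonomialOrder.degree_monomial,
      if_neg one_ne_zero]
    exact ⟨MonomialOrder.monic_monomial_one, by simp [leadExp]⟩
  | cons a m ih =>
    rw [Multiset.map_cons, Multiset.prod_cons, mul_left_comm, leadExp_cons]
    obtain ⟨ha1, ha2⟩ := monic_degree_minor K a.2
    refine ⟨ha1.mul ih.1, ?_⟩
    rw [MonomialOrder.degree_mul ha1.ne_zero ih.1.ne_zero, ha2, ih.2, add_comm]

end LeadingMonomial

section MonicFamily

variable {K σ ι : Type*} [Field K]

/-- A family of monic polynomials with distinct degrees is linearly independent. -/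
lemma MonomialOrder.linearIndependent_of_monic (m : MonomialOrder σ) {v : ι → MvPolynomial σ K}
    (hv : ∀ i, m.Monic (v i)) (hinj : Function.Injective fun i => m.degree (v i)) :
    LinearIndependent K v := by
  classical
  rw [linearIndependent_iff']
  intro s g hg
  by_contra! hne
  obtain ⟨i₀, hi₀, hgi₀⟩ := hne
  obtain ⟨c, hc, hmax⟩ := Finset.exists_max_image (s.filter (g · ≠ 0))
    (fun i => m.toSyn (m.degree (v i))) ⟨i₀, Finset.mem_filter.2 ⟨hi₀, hgi₀⟩⟩
  obtain ⟨hcs, hgc⟩ := Finset.mem_filter.1 hc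
  have h := congrArg (coeff (m.degree (v c))) hg
  rw [coeff_sum, coeff_zero, Finset.sum_eq_single_of_mem c hcs, coeff_smul,
    (hv c).coeff_degree, smul_eq_mul, mul_one] at h
  · exact hgc h
  · intro i hi hic
    rw [coeff_smul, smul_eq_zero]
    refine or_iff_not_imp_left.2 fun hgi => m.coeff_eq_zero_of_lt ?_
    refine lt_of_le_of_ne (hmax i (Finset.mem_filter.2 ⟨hi, hgi⟩)) fun h' => hic ?_
    exact hinj (m.toSyn.injective h')

/-- A family of monic elements of a subspace spans it if every leading exponent of a nonzero
element of the subspace is the degree of a member of the family. -/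
lemma MonomialOrder.span_eq_of_monic (m : MonomialOrder σ) {v : ι → MvPolynomial σ K}
    (hv : ∀ i, m.Monic (v i)) (W : Submodule K (MvPolynomial σ K)) (hvW : ∀ i, v i ∈ W)
    (hW : ∀ f ∈ W, f ≠ 0 → ∃ i, m.degree (v i) = m.degree f) :
    Submodule.span K (Set.range v) = W := by
  refine le_antisymm (Submodule.span_le.2 (Set.range_subset_iff.2 hvW)) fun f hf => ?_
  induction hn : m.toSyn (m.degree f) using WellFoundedLT.induction generalizing f with
  | _ n ih =>
  subst hn
  by_cases hf0 : f = 0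
  · exact hf0 ▸ Submodule.zero_mem _
  obtain ⟨i, hi⟩ := hW f hf hf0
  have hvi : coeff (m.degree f) (v i) = 1 := hi ▸ (hv i).coeff_degree
  set g := f - m.leadingCoeff f • v i with hg
  have hgW : g ∈ W := W.sub_mem hf (W.smul_mem _ (hvW i))
  have hmem : g ∈ Submodule.span K (Set.range v) := by
    by_cases hg0 : g = 0
    · exact hg0 ▸ Submodule.zero_mem _
    refine ih _ (lt_of_le_of_ne ?_ fun h => hg0 ?_) g hgW rfl
    · refine m.degree_sub_le.trans (sup_le le_rfl ?_)
      exact m.degree_smul_le.trans_eq (congrArg _ hi)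
    · rw [← m.leadingCoeff_eq_zero_iff, MonomialOrder.leadingCoeff, m.toSyn.injective h, hg,
        coeff_sub, coeff_smul, hvi, smul_eq_mul, mul_one]
      exact sub_self _
  rw [← sub_add_cancel f (m.leadingCoeff f • v i)]
  exact Submodule.add_mem _ hmem (Submodule.smul_mem _ _ (Submodule.subset_span ⟨i, rfl⟩))

end MonicFamily

section Constants

variable {K : Type*} [Field K] {d : ℕ}

lemma canonicalProduct_mem_ker
    {δ : Derivation K (MvPolynomial (Fin d ⊕ Fin d) K) (MvPolynomial (Fin d ⊕ Fin d) K)}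
    (hx : ∀ i : Fin d, δ (X (Sum.inl i)) = 0)
    (hy : ∀ i : Fin d, δ (X (Sum.inr i)) = X (Sum.inl i)) (c : CanonicalIndex d) :
    δ (canonicalProduct K d c) = 0 := by
  have hmul : ∀ p q, δ p = 0 → δ q = 0 → δ (p * q) = 0 := fun p q hp hq => by
    simp [Derivation.leibniz, hp, hq]
  refine hmul _ _ ?_ ?_
  · refine Finset.prod_induction _ (fun p => δ p = 0) hmul δ.map_one_eq_zero fun i _ => ?_
    simp [Derivation.leibniz_pow, hx]
  · refine Multiset.prod_induction (fun p => δ p = 0) _ hmul δ.map_one_eq_zero fun p hp => ?_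
    obtain ⟨a, -, rfl⟩ := Multiset.mem_map.1 hp
    simp [Derivation.leibniz, hx, hy, mul_comm]

lemma weitzenboeck_apply
    {δ : Derivation K (MvPolynomial (Fin d ⊕ Fin d) K) (MvPolynomial (Fin d ⊕ Fin d) K)}
    (hx : ∀ i : Fin d, δ (X (Sum.inl i)) = 0)
    (hy : ∀ i : Fin d, δ (X (Sum.inr i)) = X (Sum.inl i)) (f : MvPolynomial (Fin d ⊕ Fin d) K) :
    δ f = ∑ i, X (Sum.inl i) * pderiv (Sum.inr i) f := by
  classical
  have h : δ = ∑ i, X (R := K) (Sum.inl i : Fin d ⊕ Fin d) • pderiv (Sum.inr i) := by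
    refine derivation_ext fun i => ?_
    rw [derivation_finset_sum_apply]
    rcases i with i | i <;> simp [hx, hy, pderiv_X, Pi.single_apply]
  rw [h, derivation_finset_sum_apply]
  simp

end Constants

/-- The canonical products form a `K`-linear basis of the algebra of constants
`K[X_d,Y_d]^δ` of the Weitzenböck derivation `δ(xᵢ) = 0`, `δ(yᵢ) = xᵢ`. -/
theorem canonicalProducts_basis_of_constants (K : Type*) [Field K] [CharZero K]
    (d : ℕ) (hd : 2 ≤ d)
    (δ : Derivation K (MvPolynomial (Fin d ⊕ Fin d) K) (MvPolynomial (Fin d ⊕ Fin d) K))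
    (hx : ∀ i : Fin d, δ (X (Sum.inl i)) = 0)
    (hy : ∀ i : Fin d, δ (X (Sum.inr i)) = X (Sum.inl i)) :
    LinearIndependent K (canonicalProduct K d) ∧
      Submodule.span K (Set.range (canonicalProduct K d)) = LinearMap.ker δ.toLinearMap := by
  have hmonic := fun c => monic_degree_canonicalProduct K (d := d) c
  refine ⟨(yLex d).linearIndependent_of_monic (fun c => (hmonic c).1) fun c c' h => ?_,
    (yLex d).span_eq_of_monic (fun c => (hmonic c).1) _
      (fun c => canonicalProduct_mem_ker hx hy c) fun f hf hf0 => ?_⟩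
  · exact CanonicalIndex.leadExp_injective ((hmonic c).2.symm.trans (h.trans (hmonic c').2))
  · have hδ : δ f = 0 := hf
    rw [weitzenboeck_apply hx hy] at hδ
    have hballot : IsBallot ((yLex d).degree f) := by
      refine isBallot_of_isMax hδ ((yLex d).degree_mem_support hf0) fun t ht i hi => ?_
      by_contra! hlt
      exact ((yLex d).le_degree ht).not_gt (yLex_lt hlt fun j hj => (hi j hj).symm)
    obtain ⟨c, hc⟩ := hballot.exists_canonicalIndex
    exact ⟨c, (hmonic c).2.trans hc⟩
end

section
/- The algebra of constants K[A_d,B_d,X_d,Y_d]^δ = {f ∈ K[A_d,B_d,X_d,Y_d] : δ(f) = 0} is the K-subalgebra of K[A_d,B_d,X_d,Y_d] generated by the set {a_1,…,a_d} ∪ {x_1,…,x_d} ∪ {a_p·b_q − a_q·b_p : 1 ≤ p < q ≤ d} ∪ {u_{pq} = x_p·y_q − x_q·y_p : 1 ≤ p < q ≤ d} ∪ {w_{pq} = a_p·y_q − b_p·x_q : 1 ≤ p, q ≤ d}. -/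
open MvPolynomial

/-- The variables of `K[A_d,B_d,X_d,Y_d]`: `Sum.inl (Sum.inl i) = aᵢ`,
`Sum.inl (Sum.inr i) = bᵢ`, `Sum.inr (Sum.inl i) = xᵢ`, `Sum.inr (Sum.inr i) = yᵢ`. -/
abbrev Var4 (d : ℕ) : Type := (Fin d ⊕ Fin d) ⊕ (Fin d ⊕ Fin d)

namespace MvPolynomial

theorem pderiv_pderiv_comm {R σ : Type*} [CommRing R] (i j : σ) (f : MvPolynomial σ R) :
    pderiv i (pderiv j f) = pderiv j (pderiv i f) := by
  classical
  let D (k : σ) : Derivation R (MvPolynomial σ R) (MvPolynomial σ R) := pderiv k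
  have h : ⁅D i, D j⁆ = 0 := derivation_ext fun k => by
    simp [D, Derivation.commutator_apply, pderiv_X, Pi.single_apply, apply_ite]
  have := DFunLike.congr_fun h f
  rwa [Derivation.commutator_apply, Derivation.zero_apply, sub_eq_zero] at this

section Component

variable {R σ M : Type*} [CommSemiring R]

/-- A linear map that shifts degrees by `c` commutes, up to the shift, with taking weighted
homogeneous components. -/
theorem weightedHomogeneousComponent_map_of_shift [AddCancelCommMonoid M] {w : σ → M} {c : M}
    (L : MvPolynomial σ R →ₗ[R] MvPolynomial σ R)
    (hL : ∀ f m, IsWeightedHomogeneous w f m → IsWeightedHomogeneous w (L f) (m + c))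
    (f : MvPolynomial σ R) (m : M) :
    weightedHomogeneousComponent w (m + c) (L f) = L (weightedHomogeneousComponent w m f) := by
  classical
  induction f using MvPolynomial.induction_on' with
  | monomial d a =>
    have h := isWeightedHomogeneous_monomial w d a rfl
    rw [weightedHomogeneousComponent_of_mem h, weightedHomogeneousComponent_of_mem (hL _ _ h)]
    simp only [add_left_inj]
    split_ifs <;> simp
  | add f g hf hg => rw [map_add, map_add, map_add, map_add, hf, hg]

end Component

section PairedVariables

variable {K ι σ : Type*} (e : ι ⊕ ι ≃ σ)

section CommRing

variable [CommRing K]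

/-- The bidegree of the variables: `(1, 0)` for the `xᵢ` and `(0, 1)` for the `yᵢ`. -/
def pairWeight (s : σ) : ℤ × ℤ :=
  Sum.elim (fun _ => (1, 0)) (fun _ => (0, 1)) (e.symm s)

@[simp] theorem pairWeight_inl (i : ι) : pairWeight e (e (Sum.inl i)) = (1, 0) := by
  simp [pairWeight]

@[simp] theorem pairWeight_inr (i : ι) : pairWeight e (e (Sum.inr i)) = (0, 1) := by
  simp [pairWeight]

/-- Cayley's operator `∂²/∂xᵢ∂yⱼ - ∂²/∂xⱼ∂yᵢ`. -/
noncomputable def cayleyOmega (i j : ι) (f : MvPolynomial σ K) : MvPolynomial σ K :=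
  pderiv (e (Sum.inl i)) (pderiv (e (Sum.inr j)) f) -
    pderiv (e (Sum.inl j)) (pderiv (e (Sum.inr i)) f)

theorem IsWeightedHomogeneous.cayleyOmega {f : MvPolynomial σ K} {m : ℤ × ℤ}
    (hf : IsWeightedHomogeneous (pairWeight e) f m) (i j : ι) :
    IsWeightedHomogeneous (pairWeight e) (cayleyOmega e i j f) (m - (1, 1)) := by
  have h (i j : ι) : IsWeightedHomogeneous (pairWeight e)
      (pderiv (e (Sum.inl i)) (pderiv (e (Sum.inr j)) f)) (m - (1, 1)) :=
    (hf.pderiv (n' := m - (0, 1)) (by simp)).pderiv (by ext <;> simp)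
  exact (h i j).sub (h j i)

variable [Fintype ι]

/-- The derivation `∑ᵢ xᵢ ∂/∂yᵢ`, where `xᵢ` and `yᵢ` are the variables indexed by
`e (Sum.inl i)` and `e (Sum.inr i)`. -/
noncomputable def pairDerivation : Derivation K (MvPolynomial σ K) (MvPolynomial σ K) :=
  ∑ i, (X (e (Sum.inl i)) : MvPolynomial σ K) • pderiv (e (Sum.inr i))

theorem pairDerivation_apply (f : MvPolynomial σ K) :
    pairDerivation e f = ∑ i, X (e (Sum.inl i)) * pderiv (e (Sum.inr i)) f := by
  rw [pairDerivation, ← Derivation.coeFnAddMonoidHom_apply, map_sum, Finset.sum_apply]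
  rfl

theorem pairDerivation_X_inl (i : ι) :
    pairDerivation e (X (e (Sum.inl i)) : MvPolynomial σ K) = 0 := by
  classical
  simp [pairDerivation_apply, pderiv_X]

theorem pairDerivation_X_inr (i : ι) :
    pairDerivation e (X (e (Sum.inr i)) : MvPolynomial σ K) = X (e (Sum.inl i)) := by
  classical
  simp [pairDerivation_apply, pderiv_X, Pi.single_apply]

theorem eq_pairDerivation {δ : Derivation K (MvPolynomial σ K) (MvPolynomial σ K)}
    (hx : ∀ i, δ (X (e (Sum.inl i))) = 0)
    (hy : ∀ i, δ (X (e (Sum.inr i))) = X (e (Sum.inl i))) : δ = pairDerivation e := by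
  refine derivation_ext fun s => ?_
  obtain ⟨i | i, rfl⟩ := e.surjective s
  · rw [hx, pairDerivation_X_inl]
  · rw [hy, pairDerivation_X_inr]

theorem pairDerivation_pderiv_inr (i : ι) (f : MvPolynomial σ K) :
    pairDerivation e (pderiv (e (Sum.inr i)) f) = pderiv (e (Sum.inr i)) (pairDerivation e f) := by
  classical
  simp only [pairDerivation_apply, map_sum, pderiv_mul, pderiv_X, Pi.single_apply,
    EmbeddingLike.apply_eq_iff_eq, reduceCtorEq, if_false, zero_mul, zero_add]
  exact Finset.sum_congr rfl fun j _ => by rw [pderiv_pderiv_comm]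

theorem pairDerivation_pderiv_inl (i : ι) (f : MvPolynomial σ K) :
    pairDerivation e (pderiv (e (Sum.inl i)) f) =
      pderiv (e (Sum.inl i)) (pairDerivation e f) - pderiv (e (Sum.inr i)) f := by
  classical
  simp only [pairDerivation_apply, map_sum, pderiv_mul, pderiv_X, Pi.single_apply,
    EmbeddingLike.apply_eq_iff_eq, Sum.inl.injEq, ite_mul, one_mul, zero_mul,
    Finset.sum_add_distrib, Finset.sum_ite_eq', Finset.mem_univ, if_true,
    add_sub_cancel_left]
  exact Finset.sum_congr rfl fun j _ => by rw [pderiv_pderiv_comm]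

theorem pairDerivation_cayleyOmega {f : MvPolynomial σ K} (hf : pairDerivation e f = 0)
    (i j : ι) : pairDerivation e (cayleyOmega e i j f) = 0 := by
  rw [cayleyOmega, map_sub]
  simp only [pairDerivation_pderiv_inl, pairDerivation_pderiv_inr, hf, map_zero]
  rw [pderiv_pderiv_comm (e (Sum.inr i))]
  ring

/-- Capelli's identity for the pairs of variables, applied to a constant of `∑ᵢ xᵢ ∂/∂yᵢ`. -/
theorem sum_det_mul_cayleyOmega {f : MvPolynomial σ K} (hf : pairDerivation e f = 0) :
    ∑ i, ∑ j, (X (e (Sum.inl i)) * X (e (Sum.inr j)) - X (e (Sum.inl j)) * X (e (Sum.inr i))) *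
        cayleyOmega e i j f =
      2 * (∑ i, X (e (Sum.inl i)) * pderiv (e (Sum.inl i))
          (∑ j, X (e (Sum.inr j)) * pderiv (e (Sum.inr j)) f) +
        ∑ j, X (e (Sum.inr j)) * pderiv (e (Sum.inr j)) f) := by
  classical
  have hxy : ∑ i, X (e (Sum.inl i)) * pderiv (e (Sum.inl i))
        (∑ j, X (e (Sum.inr j)) * pderiv (e (Sum.inr j)) f) =
      ∑ i, ∑ j, X (e (Sum.inl i)) * X (e (Sum.inr j)) *
        pderiv (e (Sum.inl i)) (pderiv (e (Sum.inr j)) f) := by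
    simp [pderiv_X, Finset.mul_sum, mul_assoc]
  have hΔ : ∑ j, X (e (Sum.inr j)) * pderiv (e (Sum.inr j)) f +
      ∑ i, ∑ j, X (e (Sum.inl i)) * X (e (Sum.inr j)) *
        pderiv (e (Sum.inl j)) (pderiv (e (Sum.inr i)) f) = 0 := by
    rw [Finset.sum_comm, ← Finset.sum_add_distrib]
    refine Finset.sum_eq_zero fun j _ => ?_
    have h : X (e (Sum.inr j)) * pderiv (e (Sum.inl j)) (pairDerivation e f) = 0 := by
      rw [hf, map_zero, mul_zero]
    rw [← h]
    simp only [pairDerivation_apply, map_sum, pderiv_mul, pderiv_X, Pi.single_apply,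
      EmbeddingLike.apply_eq_iff_eq, Sum.inl.injEq, ite_mul, one_mul, zero_mul,
      Finset.sum_add_distrib, Finset.sum_ite_eq', Finset.mem_univ, if_true,
      mul_add, Finset.mul_sum]
    congr 1
    exact Finset.sum_congr rfl fun i _ => by ring
  have hsplit : ∀ i j : ι,
      (X (e (Sum.inl i)) * X (e (Sum.inr j)) - X (e (Sum.inl j)) * X (e (Sum.inr i))) *
        cayleyOmega e i j f =
      (X (e (Sum.inl i)) * X (e (Sum.inr j)) *
          pderiv (e (Sum.inl i)) (pderiv (e (Sum.inr j)) f) -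
        X (e (Sum.inl i)) * X (e (Sum.inr j)) *
          pderiv (e (Sum.inl j)) (pderiv (e (Sum.inr i)) f)) +
      (X (e (Sum.inl j)) * X (e (Sum.inr i)) *
          pderiv (e (Sum.inl j)) (pderiv (e (Sum.inr i)) f) -
        X (e (Sum.inl j)) * X (e (Sum.inr i)) *
          pderiv (e (Sum.inl i)) (pderiv (e (Sum.inr j)) f)) := fun i j => by
    rw [cayleyOmega]; ring
  rw [hxy]
  simp only [hsplit, Finset.sum_add_distrib]
  rw [Finset.sum_comm (f := fun i j => X (e (Sum.inl j)) * X (e (Sum.inr i)) *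
          pderiv (e (Sum.inl j)) (pderiv (e (Sum.inr i)) f) -
        X (e (Sum.inl j)) * X (e (Sum.inr i)) *
          pderiv (e (Sum.inl i)) (pderiv (e (Sum.inr j)) f))]
  simp only [Finset.sum_sub_distrib]
  linear_combination (-2) * hΔ

theorem weight_pairWeight (d : σ →₀ ℕ) : Finsupp.weight (pairWeight e) d =
    ((∑ i, d (e (Sum.inl i)) : ℤ), (∑ i, d (e (Sum.inr i)) : ℤ)) := by
  have : Fintype σ := Fintype.ofEquiv _ e
  rw [Finsupp.weight_apply, Finsupp.sum_fintype _ _ (by simp), ← e.sum_comp,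
    Fintype.sum_sum_type]
  simp only [pairWeight_inl, pairWeight_inr]
  ext <;> simp [Prod.fst_sum, Prod.snd_sum]

theorem IsWeightedHomogeneous.pairDerivation {f : MvPolynomial σ K} {m : ℤ × ℤ}
    (hf : IsWeightedHomogeneous (pairWeight e) f m) :
    IsWeightedHomogeneous (pairWeight e) (pairDerivation e f) (m + (1, -1)) := by
  rw [pairDerivation_apply]
  refine IsWeightedHomogeneous.sum _ _ _ fun i _ => ?_
  have h : m + (1, -1) = (1, 0) + (m - (0, 1)) := by ext <;> simp <;> ring
  rw [h]
  refine IsWeightedHomogeneous.mul ?_ (hf.pderiv (by simp))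
  simpa using isWeightedHomogeneous_X K (pairWeight e) (e (Sum.inl i))

/-- Euler's identity for a family of variables in which every monomial has the same degree. -/
theorem sum_X_mul_pderiv_of_forall_mem_support {f : MvPolynomial σ K} (v : ι → σ) {n : ℤ}
    (hf : ∀ d ∈ f.support, ∑ i, (d (v i) : ℤ) = n) :
    ∑ i, X (v i) * pderiv (v i) f = (n : MvPolynomial σ K) * f := by
  conv_lhs => rw [f.as_sum]
  conv_rhs => rw [f.as_sum]
  simp only [map_sum, Finset.mul_sum]
  rw [Finset.sum_comm]
  refine Finset.sum_congr rfl fun d hd => ?_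
  simp only [X_mul_pderiv_monomial, ← hf d hd, nsmul_eq_mul]
  push_cast
  rw [Finset.sum_mul]

end CommRing

section Field

variable [Fintype ι] [Field K] [CharZero K]

theorem mem_of_isWeightedHomogeneous_of_pairDerivation_eq_zero
    {A : Subalgebra K (MvPolynomial σ K)} (hx : ∀ i, X (e (Sum.inl i)) ∈ A)
    (hu : ∀ i j, X (e (Sum.inl i)) * X (e (Sum.inr j)) -
      X (e (Sum.inl j)) * X (e (Sum.inr i)) ∈ A) (q : ℕ) :
    ∀ (p : ℤ) (f : MvPolynomial σ K), IsWeightedHomogeneous (pairWeight e) f (p, (q : ℤ)) →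
      pairDerivation e f = 0 → f ∈ A := by
  induction q with
  | zero =>
    intro p f hf _
    rw [f.as_sum]
    refine sum_mem fun d hd => ?_
    have hw := hf (mem_support_iff.1 hd)
    rw [weight_pairWeight, Prod.mk.injEq] at hw
    have hd0 : ∀ i, d (e (Sum.inr i)) = 0 := by
      have h := hw.2
      rw [← Nat.cast_sum, Nat.cast_inj, Finset.sum_eq_zero_iff] at h
      exact fun i => h i (Finset.mem_univ i)
    rw [monomial_eq, Finsupp.prod]
    refine mul_mem (A.algebraMap_mem _) (prod_mem fun s _ => ?_)
    obtain ⟨i | i, rfl⟩ := e.surjective s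
    · exact pow_mem (hx i) _
    · rw [hd0, pow_zero]
      exact one_mem A
  | succ q ih =>
    intro p f hf hδ
    by_cases hf0 : f = 0
    · rw [hf0]
      exact zero_mem A
    have hw (d) (hd : d ∈ f.support) : ∑ i, (d (e (Sum.inl i)) : ℤ) = p ∧
        ∑ i, (d (e (Sum.inr i)) : ℤ) = (q + 1 : ℕ) := by
      have h := hf (mem_support_iff.1 hd)
      rwa [weight_pairWeight, Prod.mk.injEq] at h
    have hp : 0 ≤ p := by
      obtain ⟨d, hd⟩ := support_nonempty.2 hf0
      rw [← (hw d hd).1]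
      positivity
    have hEx := sum_X_mul_pderiv_of_forall_mem_support (fun i => e (Sum.inl i))
      fun d hd => (hw d hd).1
    have hEy := sum_X_mul_pderiv_of_forall_mem_support (fun i => e (Sum.inr i))
      fun d hd => (hw d hd).2
    have hmem : ∑ i, ∑ j, (X (e (Sum.inl i)) * X (e (Sum.inr j)) -
        X (e (Sum.inl j)) * X (e (Sum.inr i))) * cayleyOmega e i j f ∈ A := by
      refine sum_mem fun i _ => sum_mem fun j _ => mul_mem (hu i j) (ih (p - 1) _ ?_ ?_)
      · have h : (p - 1, (q : ℤ)) = (p, ((q + 1 : ℕ) : ℤ)) - (1, 1) := by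
          rw [Prod.mk_sub_mk, Nat.cast_succ, add_sub_cancel_right]
        rw [h]
        exact hf.cayleyOmega e i j
      · exact pairDerivation_cayleyOmega e hδ i j
    have hc : (2 * ((p + 1) * (q + 1)) : K) ≠ 0 := by
      have : (2 * ((p + 1) * (q + 1)) : ℤ) ≠ 0 := by positivity
      exact_mod_cast this
    have hkey : ∑ i, ∑ j, (X (e (Sum.inl i)) * X (e (Sum.inr j)) -
        X (e (Sum.inl j)) * X (e (Sum.inr i))) * cayleyOmega e i j f =
        (2 * ((p + 1) * (q + 1)) : K) • f := by
      rw [sum_det_mul_cayleyOmega e hδ, hEy]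
      have hcast : (((q + 1 : ℕ) : ℤ) : MvPolynomial σ K) = C ((q : K) + 1) := by simp
      simp only [hcast, pderiv_C_mul, mul_left_comm _ (C _), ← Finset.mul_sum, hEx]
      rw [smul_eq_C_mul]
      simp only [map_mul, map_add, map_one, map_ofNat, map_intCast, map_natCast]
      ring
    rw [hkey] at hmem
    rw [← inv_smul_smul₀ hc f]
    exact A.smul_mem hmem _

/-- A subalgebra that contains all `xᵢ` and all `xᵢ yⱼ - xⱼ yᵢ` contains every constant of
`∑ᵢ xᵢ ∂/∂yᵢ`. -/
theorem mem_of_pairDerivation_eq_zero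
    {A : Subalgebra K (MvPolynomial σ K)} (hx : ∀ i, X (e (Sum.inl i)) ∈ A)
    (hu : ∀ i j, X (e (Sum.inl i)) * X (e (Sum.inr j)) -
      X (e (Sum.inl j)) * X (e (Sum.inr i)) ∈ A)
    {f : MvPolynomial σ K} (hf : pairDerivation e f = 0) : f ∈ A := by
  rw [← finsum_weightedHomogeneousComponent (pairWeight e) f,
    finsum_eq_sum _ (weightedHomogeneousComponent_finsupp f)]
  refine sum_mem fun m hm => ?_
  have hhom := weightedHomogeneousComponent_isWeightedHomogeneous (w := pairWeight e) m f
  have hδ : pairDerivation e (weightedHomogeneousComponent (pairWeight e) m f) = 0 := by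
    have h := weightedHomogeneousComponent_map_of_shift (pairDerivation e).toLinearMap
      (fun _ _ => IsWeightedHomogeneous.pairDerivation e) f m
    simpa [hf] using h.symm
  have hne : weightedHomogeneousComponent (pairWeight e) m f ≠ 0 :=
    (weightedHomogeneousComponent_finsupp f).mem_toFinset.1 hm
  obtain ⟨d, hd⟩ := support_nonempty.2 hne
  have hw := hhom (mem_support_iff.1 hd)
  have hm2 : m = (m.1, ((∑ i, d (e (Sum.inr i)) : ℕ) : ℤ)) := by
    rw [← hw, weight_pairWeight]
    simp
  rw [hm2] at hhom
  rw [hm2] at hδ ⊢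
  exact mem_of_isWeightedHomogeneous_of_pairDerivation_eq_zero e hx hu _ _ _ hhom hδ

end Field

end PairedVariables

end MvPolynomial

/-- The algebra of constants of the Weitzenböck derivation `δ(aᵢ) = 0`, `δ(bᵢ) = aᵢ`,
`δ(xᵢ) = 0`, `δ(yᵢ) = xᵢ` on `K[A_d,B_d,X_d,Y_d]` is generated by the `aᵢ`, the `xᵢ`
and the determinants `a_p b_q - a_q b_p`, `u_{pq} = x_p y_q - x_q y_p` (`p < q`) and
`w_{pq} = a_p y_q - b_p x_q` (all `p, q`). -/
theorem constants_of_4d_generated (K : Type*) [Field K] [CharZero K] (d : ℕ) (hd : 2 ≤ d)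
    (δ : Derivation K (MvPolynomial (Var4 d) K) (MvPolynomial (Var4 d) K))
    (ha : ∀ i : Fin d, δ (X (Sum.inl (Sum.inl i))) = 0)
    (hb : ∀ i : Fin d, δ (X (Sum.inl (Sum.inr i))) = X (Sum.inl (Sum.inl i)))
    (hx : ∀ i : Fin d, δ (X (Sum.inr (Sum.inl i))) = 0)
    (hy : ∀ i : Fin d, δ (X (Sum.inr (Sum.inr i))) = X (Sum.inr (Sum.inl i))) :
    {f : MvPolynomial (Var4 d) K | δ f = 0} =
      (Algebra.adjoin K
        ((Set.range fun i : Fin d => (X (Sum.inl (Sum.inl i)) : MvPolynomial (Var4 d) K)) ∪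
          (Set.range fun i : Fin d => (X (Sum.inr (Sum.inl i)) : MvPolynomial (Var4 d) K)) ∪
          {g : MvPolynomial (Var4 d) K | ∃ p q : Fin d, p < q ∧
            g = X (Sum.inl (Sum.inl p)) * X (Sum.inl (Sum.inr q))
              - X (Sum.inl (Sum.inl q)) * X (Sum.inl (Sum.inr p))} ∪
          {g : MvPolynomial (Var4 d) K | ∃ p q : Fin d, p < q ∧
            g = X (Sum.inr (Sum.inl p)) * X (Sum.inr (Sum.inr q))
              - X (Sum.inr (Sum.inl q)) * X (Sum.inr (Sum.inr p))} ∪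
          {g : MvPolynomial (Var4 d) K | ∃ p q : Fin d,
            g = X (Sum.inl (Sum.inl p)) * X (Sum.inr (Sum.inr q))
              - X (Sum.inl (Sum.inr p)) * X (Sum.inr (Sum.inl q))}) :
        Set (MvPolynomial (Var4 d) K)) := by
  set S : Set (MvPolynomial (Var4 d) K) := _ ∪ _
  ext f
  simp only [Set.mem_ofPred_eq, SetLike.mem_coe]
  constructor
  · intro hf
    let e : (Fin d ⊕ Fin d) ⊕ (Fin d ⊕ Fin d) ≃ Var4 d := Equiv.sumSumSumComm _ _ _ _
    have hδ : δ = pairDerivation e :=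
      eq_pairDerivation e (Sum.rec ha hx) (Sum.rec hb hy)
    have hab (p q : Fin d) : (X (Sum.inl (Sum.inl p)) * X (Sum.inl (Sum.inr q))
        - X (Sum.inl (Sum.inl q)) * X (Sum.inl (Sum.inr p)) : MvPolynomial (Var4 d) K)
        ∈ Algebra.adjoin K S := by
      rcases lt_trichotomy p q with h | rfl | h
      · exact Algebra.subset_adjoin (Or.inl (Or.inl (Or.inr ⟨p, q, h, rfl⟩)))
      · rw [sub_self]
        exact zero_mem _
      · rw [← neg_sub]
        exact neg_mem (Algebra.subset_adjoin (Or.inl (Or.inl (Or.inr ⟨q, p, h, rfl⟩))))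
    have hxy (p q : Fin d) : (X (Sum.inr (Sum.inl p)) * X (Sum.inr (Sum.inr q))
        - X (Sum.inr (Sum.inl q)) * X (Sum.inr (Sum.inr p)) : MvPolynomial (Var4 d) K)
        ∈ Algebra.adjoin K S := by
      rcases lt_trichotomy p q with h | rfl | h
      · exact Algebra.subset_adjoin (Or.inl (Or.inr ⟨p, q, h, rfl⟩))
      · rw [sub_self]
        exact zero_mem _
      · rw [← neg_sub]
        exact neg_mem (Algebra.subset_adjoin (Or.inl (Or.inr ⟨q, p, h, rfl⟩)))
    have hw (p q : Fin d) : (X (Sum.inl (Sum.inl p)) * X (Sum.inr (Sum.inr q))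
        - X (Sum.inl (Sum.inr p)) * X (Sum.inr (Sum.inl q)) : MvPolynomial (Var4 d) K)
        ∈ Algebra.adjoin K S :=
      Algebra.subset_adjoin (Or.inr ⟨p, q, rfl⟩)
    refine mem_of_pairDerivation_eq_zero e ?_ ?_ (hδ ▸ hf)
    · rintro (i | i)
      · exact Algebra.subset_adjoin (Or.inl (Or.inl (Or.inl (Or.inl ⟨i, rfl⟩))))
      · exact Algebra.subset_adjoin (Or.inl (Or.inl (Or.inl (Or.inr ⟨i, rfl⟩))))
    · rintro (i | i) (j | j)
      · exact hab i j
      · convert hw i j using 1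
        simp [e, mul_comm]
      · convert neg_mem (hw j i) using 1
        simp [e, mul_comm]
      · exact hxy i j
  · intro hf
    induction hf using Algebra.adjoin_induction with
    | mem g hg =>
      rcases hg with (((⟨i, rfl⟩ | ⟨i, rfl⟩) | ⟨p, q, -, rfl⟩) | ⟨p, q, -, rfl⟩) | ⟨p, q, rfl⟩
      · exact ha i
      · exact hx i
      all_goals
        simp only [map_sub, Derivation.leibniz, ha, hb, hx, hy, smul_eq_mul, mul_zero]
        ring
    | algebraMap r => exact δ.map_algebraMap r
    | add g h _ _ hg hh => rw [map_add, hg, hh, add_zero]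
    | mul g h _ _ hg hh => rw [Derivation.leibniz, hg, hh, smul_zero, smul_zero, add_zero]
end

section
/- Every constant of δ in C_{2d} is a K[X_d,Y_d]^δ-linear combination of the elements a_1,…,a_d and w_{pq} (1 ≤ p, q ≤ d): if f ∈ C_{2d} satisfies δ(f) = 0, then there exist polynomials F_1,…,F_d and G_{pq} (1 ≤ p, q ≤ d) in K[X_d,Y_d] with δ(F_i) = 0 and δ(G_{pq}) = 0 such that f = Σ_{i=1}^d a_i·F_i + Σ_{p,q=1}^d w_{pq}·G_{pq}. -/
open MvPolynomial

noncomputable section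

variable (K : Type*) [Field K] (d : ℕ)

def aP (i : Fin d) : MvPolynomial (Var4 d) K := X (Sum.inl (Sum.inl i))
def bP (i : Fin d) : MvPolynomial (Var4 d) K := X (Sum.inl (Sum.inr i))
def xP (i : Fin d) : MvPolynomial (Var4 d) K := X (Sum.inr (Sum.inl i))
def yP (i : Fin d) : MvPolynomial (Var4 d) K := X (Sum.inr (Sum.inr i))

/-- `u_{pq} = x_p y_q - x_q y_p`. -/
def uP (p q : Fin d) : MvPolynomial (Var4 d) K := xP K d p * yP K d q - xP K d q * yP K d p

/-- `w_{pq} = a_p y_q - b_p x_q`. -/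
def wP (p q : Fin d) : MvPolynomial (Var4 d) K := aP K d p * yP K d q - bP K d p * xP K d q

/-- The canonical embedding of `K[X_d,Y_d]` into `K[A_d,B_d,X_d,Y_d]`. -/
def embXY : MvPolynomial (Fin d ⊕ Fin d) K →ₐ[K] MvPolynomial (Var4 d) K := rename Sum.inr

/-- `C_{2d}`, the free `K[X_d,Y_d]`-module with basis `a₁,…,a_d,b₁,…,b_d`, viewed as a
subset of `K[A_d,B_d,X_d,Y_d]`. -/
def Cmod : Set (MvPolynomial (Var4 d) K) :=
  {f | ∃ F G : Fin d → MvPolynomial (Fin d ⊕ Fin d) K,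
    f = ∑ i, aP K d i * embXY K d (F i) + ∑ i, bP K d i * embXY K d (G i)}

/-- The generators of the module `L`. -/
def Lgens : Set (MvPolynomial (Var4 d) K) :=
  (Set.range fun i : Fin d => wP K d i i) ∪
  {g | ∃ i j : Fin d, i < j ∧ g = wP K d i j + wP K d j i} ∪
  {g | ∃ i j : Fin d, i < j ∧ g = aP K d i * xP K d j - aP K d j * xP K d i} ∪
  {g | ∃ i p q : Fin d, p < q ∧ g = aP K d i * uP K d p q - wP K d p q * xP K d i} ∪
  {g | ∃ i j k : Fin d, i < j ∧ j < k ∧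
    g = aP K d i * uP K d j k - aP K d j * uP K d i k + aP K d k * uP K d i j} ∪
  {g | ∃ i j p q : Fin d, i < j ∧ p < q ∧
    g = wP K d i j * uP K d p q - wP K d p q * uP K d i j}

/-- The `K[X_d,Y_d]^δ`-submodule `L` of `C_{2d}` generated by `Lgens`: the set of all
finite sums `Σ g·h` with `g ∈ Lgens` and `h` a constant of `δ` in (the image of)
`K[X_d,Y_d]`. -/
def Lsub (δ : Derivation K (MvPolynomial (Var4 d) K) (MvPolynomial (Var4 d) K)) :
    Submodule K (MvPolynomial (Var4 d) K) :=
  Submodule.span K {z | ∃ g ∈ Lgens K d, ∃ h : MvPolynomial (Fin d ⊕ Fin d) K,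
    δ (embXY K d h) = 0 ∧ z = g * embXY K d h}


namespace MvPolynomial

section Weighted

variable {R σ M : Type*} [CommRing R]

theorem sum_derivation_apply {κ : Type*} (s : Finset κ)
    (D : κ → Derivation R (MvPolynomial σ R) (MvPolynomial σ R)) (φ : MvPolynomial σ R) :
    (∑ i ∈ s, D i) φ = ∑ i ∈ s, D i φ := by
  classical
  induction s using Finset.induction_on with
  | empty => simp
  | insert a s ha ih => simp [Finset.sum_insert ha, ih]

/-- Every derivation of a polynomial ring is a combination of partial derivatives. -/
theorem derivation_eq_sum_pderiv [Fintype σ]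
    (D : Derivation R (MvPolynomial σ R) (MvPolynomial σ R)) (φ : MvPolynomial σ R) :
    D φ = ∑ i, D (X i) * pderiv i φ := by
  classical
  have h : D = ∑ i, D (X i) • pderiv i := by
    refine derivation_ext fun j => ?_
    rw [sum_derivation_apply, Finset.sum_eq_single j] <;>
      simp +contextual [pderiv_X, eq_comm]
  conv_lhs => rw [h]
  simp [sum_derivation_apply]

/-- A derivation shifting the weights of the variables by `c` shifts all weights by `c`. -/
theorem IsWeightedHomogeneous.derivation [Fintype σ] [AddCommGroup M] {w : σ → M} {c m : M}
    {D : Derivation R (MvPolynomial σ R) (MvPolynomial σ R)}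
    (hD : ∀ i, (D (X i)).IsWeightedHomogeneous w (w i + c))
    {φ : MvPolynomial σ R} (hφ : φ.IsWeightedHomogeneous w m) :
    (D φ).IsWeightedHomogeneous w (m + c) := by
  rw [derivation_eq_sum_pderiv]
  refine IsWeightedHomogeneous.sum _ _ _ fun i _ => ?_
  have h := (hD i).mul (hφ.pderiv (sub_add_cancel m (w i)))
  rwa [show w i + c + (m - w i) = m + c by abel] at h

/-- A derivation shifting the weights of the variables by `c` maps homogeneous components
to homogeneous components. -/
theorem weightedHomogeneousComponent_derivation [Fintype σ] [AddCommGroup M] {w : σ → M} {c : M}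
    {D : Derivation R (MvPolynomial σ R) (MvPolynomial σ R)}
    (hD : ∀ i, (D (X i)).IsWeightedHomogeneous w (w i + c)) (m : M) (φ : MvPolynomial σ R) :
    weightedHomogeneousComponent w (m + c) (D φ) = D (weightedHomogeneousComponent w m φ) := by
  classical
  induction φ using MvPolynomial.induction_on' with
  | monomial s r =>
    have hs := isWeightedHomogeneous_monomial w s r rfl
    rw [weightedHomogeneousComponent_of_mem (IsWeightedHomogeneous.derivation hD hs),
      weightedHomogeneousComponent_of_mem hs]
    by_cases h : m = Finsupp.weight w s <;> simp [h]
  | add p q hp hq => simp only [map_add, hp, hq]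

/-- Euler's identity for weights in an arbitrary monoid, evaluated through an additive
character. -/
theorem IsWeightedHomogeneous.sum_character_smul_X_mul_pderiv [Fintype σ] [AddCommMonoid M]
    {w : σ → M} {m : M} (χ : M →+ R) {φ : MvPolynomial σ R} (hφ : φ.IsWeightedHomogeneous w m) :
    ∑ i, χ (w i) • (X i * pderiv i φ) = χ m • φ := by
  have key : ∀ s : σ →₀ ℕ, Finsupp.weight w s = m → ∀ r : R,
      ∑ i, χ (w i) • (X i * pderiv i (monomial s r)) = χ m • monomial s r := by
    rintro s rfl r
    simp_rw [X_mul_pderiv_monomial, Finsupp.weight_apply]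
    rw [Finsupp.sum_fintype _ _ (by simp), map_sum, Finset.sum_smul]
    refine Finset.sum_congr rfl fun i _ => ?_
    rw [map_nsmul, smul_comm, smul_assoc]
  conv_lhs => rw [φ.as_sum]
  conv_rhs => rw [φ.as_sum]
  simp_rw [map_sum, Finset.mul_sum, Finset.smul_sum]
  rw [Finset.sum_comm]
  refine Finset.sum_congr rfl fun s hs => ?_
  rw [key s (hφ (mem_support_iff.mp hs))]

end Weighted

section Raising

variable {K ι : Type*} [Field K]

variable (K ι) in
/-- The derivation `xᵢ ↦ 0`, `yᵢ ↦ xᵢ`. -/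
def raising : Derivation K (MvPolynomial (ι ⊕ ι) K) (MvPolynomial (ι ⊕ ι) K) :=
  mkDerivation K (Sum.elim (fun _ => 0) fun i => X (Sum.inl i))

variable (K ι) in
/-- The derivation `xᵢ ↦ yᵢ`, `yᵢ ↦ 0`. -/
def lowering : Derivation K (MvPolynomial (ι ⊕ ι) K) (MvPolynomial (ι ⊕ ι) K) :=
  mkDerivation K (Sum.elim (fun i => X (Sum.inr i)) fun _ => 0)

variable (ι) in
/-- The bidegree in the `xᵢ` and the `yᵢ`. -/
def bidegree : ι ⊕ ι → ℤ × ℤ := Sum.elim (fun _ => (1, 0)) fun _ => (0, 1)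

@[simp] theorem raising_X_inl (i : ι) : raising K ι (X (Sum.inl i)) = 0 := by
  simp [raising, mkDerivation_X]

@[simp] theorem raising_X_inr (i : ι) : raising K ι (X (Sum.inr i)) = X (Sum.inl i) := by
  simp [raising, mkDerivation_X]

@[simp] theorem lowering_X_inl (i : ι) : lowering K ι (X (Sum.inl i)) = X (Sum.inr i) := by
  simp [lowering, mkDerivation_X]

@[simp] theorem lowering_X_inr (i : ι) : lowering K ι (X (Sum.inr i)) = 0 := by
  simp [lowering, mkDerivation_X]

theorem isWeightedHomogeneous_raising_X (i : ι ⊕ ι) :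
    (raising K ι (X i)).IsWeightedHomogeneous (bidegree ι) (bidegree ι i + (1, -1)) := by
  rcases i with i | i
  · simpa using isWeightedHomogeneous_zero K (bidegree ι) _
  · simpa [bidegree] using isWeightedHomogeneous_X K (bidegree ι) (Sum.inl i)

theorem isWeightedHomogeneous_lowering_X (i : ι ⊕ ι) :
    (lowering K ι (X i)).IsWeightedHomogeneous (bidegree ι) (bidegree ι i + (-1, 1)) := by
  rcases i with i | i
  · simpa [bidegree] using isWeightedHomogeneous_X K (bidegree ι) (Sum.inr i)
  · simpa using isWeightedHomogeneous_zero K (bidegree ι) _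

theorem raising_pderiv_inl (q : ι) (g : MvPolynomial (ι ⊕ ι) K) :
    raising K ι (pderiv (Sum.inl q) g) =
      pderiv (Sum.inl q) (raising K ι g) - pderiv (Sum.inr q) g := by
  classical
  have h : ⁅raising K ι, pderiv (R := K) (Sum.inl q)⁆ = -pderiv (Sum.inr q) := by
    refine derivation_ext fun i => ?_
    rcases i with i | i <;>
      simp [Derivation.commutator_apply, pderiv_X, Pi.single_apply, apply_ite (raising K ι)]
  have := congrArg (fun D => D g) h
  simp only [Derivation.commutator_apply, Derivation.neg_apply] at this
  linear_combination this

theorem raising_pderiv_inr (q : ι) (g : MvPolynomial (ι ⊕ ι) K) :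
    raising K ι (pderiv (Sum.inr q) g) = pderiv (Sum.inr q) (raising K ι g) := by
  classical
  have h : ⁅raising K ι, pderiv (R := K) (Sum.inr q : ι ⊕ ι)⁆ = 0 := by
    refine derivation_ext fun i => ?_
    rcases i with i | i <;>
      simp [Derivation.commutator_apply, pderiv_X, Pi.single_apply, apply_ite (raising K ι)]
  have := congrArg (fun D => D g) h
  simp only [Derivation.commutator_apply, Derivation.coe_zero, Pi.zero_apply] at this
  linear_combination this

variable [Fintype ι]

theorem sum_X_mul_pderiv_inl {n : ℤ × ℤ} {g : MvPolynomial (ι ⊕ ι) K}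
    (hg : g.IsWeightedHomogeneous (bidegree ι) n) :
    ∑ i : ι, X (Sum.inl i) * pderiv (Sum.inl i) g = (n.1 : K) • g := by
  simpa [bidegree] using hg.sum_character_smul_X_mul_pderiv
    ((Int.castAddHom K).comp (AddMonoidHom.fst ℤ ℤ))

theorem sum_X_mul_pderiv_inr {n : ℤ × ℤ} {g : MvPolynomial (ι ⊕ ι) K}
    (hg : g.IsWeightedHomogeneous (bidegree ι) n) :
    ∑ i : ι, X (Sum.inr i) * pderiv (Sum.inr i) g = (n.2 : K) • g := by
  simpa [bidegree] using hg.sum_character_smul_X_mul_pderiv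
    ((Int.castAddHom K).comp (AddMonoidHom.snd ℤ ℤ))

theorem raising_eq_sum (g : MvPolynomial (ι ⊕ ι) K) :
    raising K ι g = ∑ i : ι, X (Sum.inl i) * pderiv (Sum.inr i) g := by
  rw [derivation_eq_sum_pderiv]
  simp

theorem IsWeightedHomogeneous.raising {n : ℤ × ℤ} {g : MvPolynomial (ι ⊕ ι) K}
    (hg : g.IsWeightedHomogeneous (bidegree ι) n) :
    (raising K ι g).IsWeightedHomogeneous (bidegree ι) (n + (1, -1)) :=
  IsWeightedHomogeneous.derivation isWeightedHomogeneous_raising_X hg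

theorem IsWeightedHomogeneous.lowering {n : ℤ × ℤ} {g : MvPolynomial (ι ⊕ ι) K}
    (hg : g.IsWeightedHomogeneous (bidegree ι) n) :
    (lowering K ι g).IsWeightedHomogeneous (bidegree ι) (n + (-1, 1)) :=
  IsWeightedHomogeneous.derivation isWeightedHomogeneous_lowering_X hg

theorem raising_lowering {n : ℤ × ℤ} {g : MvPolynomial (ι ⊕ ι) K}
    (hg : g.IsWeightedHomogeneous (bidegree ι) n) :
    raising K ι (lowering K ι g) =
      lowering K ι (raising K ι g) + ((n.1 : K) - n.2) • g := by
  classical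
  have h : ⁅raising K ι, lowering K ι⁆ =
      ∑ i : ι, ((X (Sum.inl i) : MvPolynomial (ι ⊕ ι) K) • pderiv (Sum.inl i)
        - (X (Sum.inr i) : MvPolynomial (ι ⊕ ι) K) • pderiv (Sum.inr i)) := by
    refine derivation_ext fun i => ?_
    rcases i with i | i <;>
      simp [Derivation.commutator_apply, sum_derivation_apply, pderiv_X, Pi.single_apply]
  have := congrArg (fun D => D g) h
  simp only [Derivation.commutator_apply, sum_derivation_apply,
    Derivation.sub_apply, Derivation.smul_apply, smul_eq_mul, Finset.sum_sub_distrib,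
    sum_X_mul_pderiv_inl hg, sum_X_mul_pderiv_inr hg] at this
  rw [sub_smul]
  linear_combination this

theorem eq_zero_of_bidegree_fst_neg {n : ℤ × ℤ} {g : MvPolynomial (ι ⊕ ι) K}
    (hg : g.IsWeightedHomogeneous (bidegree ι) n) (hn : n.1 < 0) : g = 0 := by
  ext s
  by_contra hs
  have h := congrArg Prod.fst (hg hs)
  rw [Finsupp.weight_apply, Finsupp.sum_fintype _ _ (by simp), Prod.fst_sum] at h
  have : 0 ≤ ∑ i, (s i • bidegree ι i).1 := Finset.sum_nonneg fun i _ => by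
    rcases i with i | i <;> simp [bidegree]
  omega

variable [CharZero K]

/-- A vector of negative weight killed by `lowering ∘ raising` vanishes. -/
theorem eq_zero_of_lowering_raising_eq_zero {n : ℤ × ℤ} {g : MvPolynomial (ι ⊕ ι) K}
    (hg : g.IsWeightedHomogeneous (bidegree ι) n) (hn : n.1 < n.2)
    (h0 : lowering K ι (raising K ι g) = 0) : g = 0 := by
  have hw : ∀ k : ℕ, ((lowering K ι)^[k] g).IsWeightedHomogeneous (bidegree ι)
      (n.1 - k, n.2 + k) := by
    intro k
    induction k with
    | zero => simpa using hg
    | succ k ih =>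
      rw [Function.iterate_succ_apply']
      convert ih.lowering using 1
      ext <;> simp <;> ring
  have hr : ∀ k : ℕ, raising K ι ((lowering K ι)^[k + 1] g) =
      ((k + 1 : K) * (n.1 - n.2 - k)) • (lowering K ι)^[k] g := by
    intro k
    induction k with
    | zero => simp [raising_lowering hg, h0]
    | succ k ih =>
      rw [Function.iterate_succ_apply', raising_lowering (hw (k + 1)), ih, Derivation.map_smul,
        ← Function.iterate_succ_apply' (lowering K ι), ← add_smul]
      congr 1
      push_cast
      ring
  have hz : ∀ k : ℕ, (lowering K ι)^[k] g = 0 → g = 0 := by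
    intro k
    induction k with
    | zero => exact id
    | succ k ih =>
      intro hk
      have h := hr k
      rw [hk, map_zero, eq_comm, smul_eq_zero] at h
      refine ih (h.resolve_left (mul_ne_zero (by exact_mod_cast k.succ_ne_zero) ?_))
      have : n.1 - n.2 - k ≠ 0 := by omega
      exact_mod_cast this
  refine hz (n.1.toNat + 1) (eq_zero_of_bidegree_fst_neg (hw _) ?_)
  simp only
  omega

/-- A constant of positive weight lies in the ideal of constants generated by the `xᵢ`. -/
theorem exists_eq_sum_X_mul_of_raising_eq_zero {n : ℤ × ℤ} {g : MvPolynomial (ι ⊕ ι) K}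
    (hg : g.IsWeightedHomogeneous (bidegree ι) n) (hn : n.2 < n.1) (h0 : raising K ι g = 0) :
    ∃ c : ι → MvPolynomial (ι ⊕ ι) K, (∀ q, raising K ι (c q) = 0) ∧
      g = ∑ q, X (Sum.inl q) * c q := by
  rcases lt_or_ge n.1 0 with hneg | hpos
  · exact ⟨0, by simp, by simp [eq_zero_of_bidegree_fst_neg hg hneg]⟩
  have hl : (n.1 : K) - n.2 + 1 ≠ 0 := by
    have : n.1 - n.2 + 1 ≠ 0 := by omega
    exact_mod_cast this
  have hy : ∀ q : ι, (pderiv (Sum.inr q) g).IsWeightedHomogeneous (bidegree ι) (n - (0, 1)) :=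
    fun q => hg.pderiv (by simp [bidegree])
  set l : K := (n.1 : K) - n.2 + 1 with hldef
  let c : ι → MvPolynomial (ι ⊕ ι) K := fun q =>
    l • pderiv (Sum.inl q) g + lowering K ι (pderiv (Sum.inr q) g)
  have hc : ∀ q, raising K ι (c q) = 0 := by
    intro q
    simp only [c, map_add, Derivation.map_smul, raising_pderiv_inl, h0, raising_lowering (hy q),
      raising_pderiv_inr, map_zero, Prod.fst_sub, Prod.snd_sub]
    have : ((n.1 - 0 : ℤ) : K) - ((n.2 - 1 : ℤ) : K) = l := by
      rw [hldef]; push_cast; ring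
    rw [this]
    simp
  have hsum : ∑ q, X (Sum.inl q) * c q = (((n.1 : K) - n.2) * (n.1 + 1)) • g := by
    have h1 : ∑ q : ι, X (Sum.inl q) * lowering K ι (pderiv (Sum.inr q) g) =
        -((n.2 : K) • g) := by
      have h2 := congrArg (lowering K ι) (raising_eq_sum g)
      simp only [h0, map_zero, map_sum, Derivation.leibniz, lowering_X_inl, smul_eq_mul,
        Finset.sum_add_distrib] at h2
      have h3 := sum_X_mul_pderiv_inr hg
      simp only [mul_comm (pderiv _ g)] at h2
      linear_combination -h2 - h3
    simp only [c, mul_add, Finset.sum_add_distrib, h1, mul_smul_comm, ← Finset.smul_sum,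
      sum_X_mul_pderiv_inl hg, smul_smul, ← sub_eq_add_neg, ← sub_smul]
    congr 1
    rw [hldef]
    ring
  have hk : ((n.1 : K) - n.2) * (n.1 + 1) ≠ 0 := by
    have : (n.1 - n.2) * (n.1 + 1) ≠ 0 := mul_ne_zero (by omega) (by omega)
    exact_mod_cast this
  refine ⟨fun q => (((n.1 : K) - n.2) * (n.1 + 1))⁻¹ • c q, fun q => ?_, ?_⟩
  · rw [Derivation.map_smul, hc, smul_zero]
  · simp only [mul_smul_comm, ← Finset.smul_sum, hsum]
    rw [smul_smul, inv_mul_cancel₀ hk, one_smul]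

/-- A constant in the image of `raising` is a combination of the `xᵢ` with constant
coefficients; homogeneous case. -/
theorem exists_raising_eq_sum_of_isWeightedHomogeneous {n : ℤ × ℤ} {h : MvPolynomial (ι ⊕ ι) K}
    (hh : h.IsWeightedHomogeneous (bidegree ι) n) (h0 : raising K ι (raising K ι h) = 0) :
    ∃ c : ι → MvPolynomial (ι ⊕ ι) K, (∀ q, raising K ι (c q) = 0) ∧
      raising K ι h = ∑ q, X (Sum.inl q) * c q := by
  have hg := hh.raising
  rcases lt_or_ge (n.2 - 1) (n.1 + 1) with hn | hn
  · exact exists_eq_sum_X_mul_of_raising_eq_zero hg (by simpa [sub_eq_add_neg] using hn) h0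
  suffices hz : raising K ι h = 0 from ⟨0, by simp, by simp [hz]⟩
  rcases hn.lt_or_eq with hn | hn
  · exact eq_zero_of_lowering_raising_eq_zero hg (by simpa [sub_eq_add_neg] using hn)
      (by rw [h0, map_zero])
  have hl : lowering K ι (raising K ι h) = 0 := by
    refine eq_zero_of_lowering_raising_eq_zero hg.lowering (by simp; omega) ?_
    have hK : ((n.1 + 1 : ℤ) : K) = ((n.2 - 1 : ℤ) : K) := by rw [hn]
    rw [raising_lowering hg, h0]
    simp [← sub_eq_add_neg] at hK ⊢
    left
    linear_combination hK
  rw [eq_zero_of_lowering_raising_eq_zero hh (by omega) hl, map_zero]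

/-- If `raising` kills `h` twice, then `h` is a combination of `1` and the `yᵢ` with constant
coefficients. -/
theorem exists_eq_add_sum_X_mul {h : MvPolynomial (ι ⊕ ι) K}
    (h0 : raising K ι (raising K ι h) = 0) :
    ∃ (b : MvPolynomial (ι ⊕ ι) K) (c : ι → MvPolynomial (ι ⊕ ι) K),
      raising K ι b = 0 ∧ (∀ q, raising K ι (c q) = 0) ∧
      h = b + ∑ q, X (Sum.inr q) * c q := by
  have hcomp : ∀ n, raising K ι (raising K ι
      (weightedHomogeneousComponent (bidegree ι) n h)) = 0 := fun n => by
    rw [← weightedHomogeneousComponent_derivation isWeightedHomogeneous_raising_X,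
      ← weightedHomogeneousComponent_derivation isWeightedHomogeneous_raising_X, h0, map_zero]
  choose c hc hcs using fun n => exists_raising_eq_sum_of_isWeightedHomogeneous
    (weightedHomogeneousComponent_isWeightedHomogeneous n h) (hcomp n)
  have hfin := sum_weightedHomogeneousComponent (bidegree ι) h
  rw [finsum_eq_sum _ (weightedHomogeneousComponent_finsupp h)] at hfin
  set S := (weightedHomogeneousComponent_finsupp (w := bidegree ι) h).toFinset
  have hrc : ∀ q, raising K ι (∑ n ∈ S, c n q) = 0 := fun q => by simp [map_sum, hc]
  refine ⟨h - ∑ q, X (Sum.inr q) * ∑ n ∈ S, c n q, fun q => ∑ n ∈ S, c n q, ?_, hrc, by ring⟩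
  have hr : raising K ι h = ∑ q, X (Sum.inl q) * ∑ n ∈ S, c n q := by
    conv_lhs => rw [← hfin]
    simp_rw [map_sum, hcs, Finset.mul_sum]
    exact Finset.sum_comm
  rw [map_sub, hr, map_sum, sub_eq_zero]
  refine Finset.sum_congr rfl fun q _ => ?_
  rw [Derivation.leibniz, hrc, raising_X_inr]
  simp [mul_comm]

end Raising

end MvPolynomial

section Constants

variable {K : Type*} [Field K] {d : ℕ}

theorem derivation_embXY
    {δ : Derivation K (MvPolynomial (Var4 d) K) (MvPolynomial (Var4 d) K)}
    (hx : ∀ i : Fin d, δ (xP K d i) = 0) (hy : ∀ i : Fin d, δ (yP K d i) = xP K d i)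
    (h : MvPolynomial (Fin d ⊕ Fin d) K) :
    δ (embXY K d h) = embXY K d (raising K (Fin d) h) := by
  have hX : ∀ i, δ (embXY K d (X i)) = embXY K d (raising K (Fin d) (X i)) := by
    rintro (i | i)
    · simpa [embXY, xP] using hx i
    · simpa [embXY, xP, yP] using hy i
  induction h using MvPolynomial.induction_on with
  | C a => simp [embXY]
  | add p q hp hq => simp only [map_add, hp, hq]
  | mul_X p i hp => simp only [map_mul, Derivation.leibniz, smul_eq_mul, map_add, hp, hX]

theorem embXY_injective : Function.Injective (embXY K d) :=
  rename_injective _ Sum.inr_injective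

theorem pderiv_inl_embXY (i : Fin d ⊕ Fin d) (h : MvPolynomial (Fin d ⊕ Fin d) K) :
    pderiv (Sum.inl i) (embXY K d h) = 0 := by
  classical
  refine pderiv_eq_zero_of_notMem_vars fun hi => ?_
  simpa using vars_rename _ _ hi

/-- The elements `a₁,…,a_d,b₁,…,b_d` are linearly independent over `K[X_d,Y_d]`. -/
theorem eq_zero_of_sum_aP_add_sum_bP_eq_zero {F G : Fin d → MvPolynomial (Fin d ⊕ Fin d) K}
    (h : ∑ i, aP K d i * embXY K d (F i) + ∑ i, bP K d i * embXY K d (G i) = 0) (j : Fin d) :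
    F j = 0 ∧ G j = 0 := by
  classical
  constructor <;> apply embXY_injective
  · simpa [aP, bP, pderiv_inl_embXY, pderiv_X, Pi.single_apply] using
      congrArg (pderiv (Sum.inl (Sum.inl j))) h
  · simpa [aP, bP, pderiv_inl_embXY, pderiv_X, Pi.single_apply] using
      congrArg (pderiv (Sum.inl (Sum.inr j))) h

end Constants

/-- Every constant of `δ` in `C_{2d}` is a `K[X_d,Y_d]^δ`-linear combination of the
elements `a₁,…,a_d` and `w_{pq}` (`1 ≤ p, q ≤ d`). -/
theorem constants_in_C_generated (K : Type*) [Field K] [CharZero K] (d : ℕ) (hd : 2 ≤ d)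
    (δ : Derivation K (MvPolynomial (Var4 d) K) (MvPolynomial (Var4 d) K))
    (ha : ∀ i : Fin d, δ (aP K d i) = 0)
    (hb : ∀ i : Fin d, δ (bP K d i) = aP K d i)
    (hx : ∀ i : Fin d, δ (xP K d i) = 0)
    (hy : ∀ i : Fin d, δ (yP K d i) = xP K d i)
    (f : MvPolynomial (Var4 d) K) (hf : f ∈ Cmod K d) (hδf : δ f = 0) :
    ∃ (F : Fin d → MvPolynomial (Fin d ⊕ Fin d) K)
      (G : Fin d → Fin d → MvPolynomial (Fin d ⊕ Fin d) K),
      (∀ i, δ (embXY K d (F i)) = 0) ∧ (∀ p q, δ (embXY K d (G p q)) = 0) ∧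
      f = ∑ i, aP K d i * embXY K d (F i) +
            ∑ p, ∑ q, wP K d p q * embXY K d (G p q) := by
  obtain ⟨F, G, rfl⟩ := hf
  have hδ := derivation_embXY hx hy
  have hsum : ∑ i, aP K d i * embXY K d (raising K (Fin d) (F i) + G i) +
      ∑ i, bP K d i * embXY K d (raising K (Fin d) (G i)) = 0 := by
    rw [← hδf]
    simp only [map_add, map_sum, Derivation.leibniz, ha, hb, hδ, smul_eq_mul, mul_add,
      Finset.sum_add_distrib, mul_comm (embXY K d _),
      zero_mul, Finset.sum_const_zero]
    ring
  have hG : ∀ i, G i = -raising K (Fin d) (F i) := fun i =>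
    (neg_eq_of_add_eq_zero_right (eq_zero_of_sum_aP_add_sum_bP_eq_zero hsum i).1).symm
  have hFF : ∀ i, raising K (Fin d) (raising K (Fin d) (F i)) = 0 := fun i => by
    simpa [hG] using (eq_zero_of_sum_aP_add_sum_bP_eq_zero hsum i).2
  choose b c hb0 hc0 hF using fun i => exists_eq_add_sum_X_mul (hFF i)
  refine ⟨b, c, fun i => by rw [hδ, hb0, map_zero], fun p q => by rw [hδ, hc0, map_zero], ?_⟩
  rw [← Finset.sum_add_distrib, ← Finset.sum_add_distrib]
  refine Finset.sum_congr rfl fun i _ => ?_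
  have hR : raising K (Fin d) (F i) = ∑ q, X (Sum.inl q) * c i q := by
    rw [hF i]
    simp [hb0, hc0, mul_comm]
  have hxe : ∀ q, embXY K d (X (Sum.inl q)) = xP K d q := fun q => by simp [embXY, xP]
  have hye : ∀ q, embXY K d (X (Sum.inr q)) = yP K d q := fun q => by simp [embXY, yP]
  rw [hG, hR, hF i]
  simp only [map_add, map_neg, map_sum, map_mul, hxe, hye, wP, sub_mul, Finset.sum_sub_distrib,
    mul_add, mul_neg, Finset.mul_sum, mul_assoc]
  ring

end
end
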